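/- Let d ≥ 2 and let p be a generic configuration of n ≥ d+2 points in ℝ^d. Let v = ⟨α⃗, p⟩, where α⃗ is a path (respectively loop) measurement ensemble that allows for trilateration. Suppose there is a configuration q of n points in ℝ^d together with a path (respectively loop) measurement ensemble β⃗ such that v = ⟨β⃗, q⟩. Then there is a vertex relabeling of q such that, up to congruence, q = (1/s)·p for some whole number s ≥ 1, and moreover, under this vertex relabeling, β⃗ = s·α⃗. If in addition β⃗ also allows for trilateration, then there is a vertex relabeling of q such that, up to congruence, q = p, and under this relabeling β⃗ = α⃗. -/

import Mathlib

/-- Euclidean distance between two points of ℝ^d. -/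
noncomputable def eudist {d : ℕ} (x y : Fin d → ℝ) : ℝ :=
  Real.sqrt (∑ k, (x k - y k) ^ 2)

/-- Squared Euclidean length along an edge (an unordered pair of vertices) of a
configuration. -/
noncomputable def sqLenR {n d : ℕ} (p : Fin n → Fin d → ℝ) : Sym2 (Fin n) → ℝ :=
  Sym2.lift ⟨fun i j => ∑ k, (p i k - p j k) ^ 2,
    fun i j => Finset.sum_congr rfl fun k _ => by ring⟩

/-- Euclidean length along an edge of a configuration. -/
noncomputable def lenR {n d : ℕ} (p : Fin n → Fin d → ℝ) (e : Sym2 (Fin n)) : ℝ :=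
  Real.sqrt (sqLenR p e)

/-- A generic configuration of `n` points in ℝ^d: its `d·n` coordinates satisfy no
nontrivial polynomial equation with rational coefficients. -/
def GenericConfig {n d : ℕ} (p : Fin n → Fin d → ℝ) : Prop :=
  ∀ f : MvPolynomial (Fin n × Fin d) ℚ, f ≠ 0 →
    MvPolynomial.aeval (fun ik : Fin n × Fin d => p ik.1 ik.2) f ≠ 0

/-- A congruence of ℝ^d: a distance-preserving bijection. -/
def IsCongruence {d : ℕ} (f : (Fin d → ℝ) → (Fin d → ℝ)) : Prop :=
  Function.Bijective f ∧ ∀ x y, eudist (f x) (f y) = eudist x y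

/-- A similarity of ℝ^d: a bijection scaling all distances by a fixed positive
ratio (equivalently, the composition of a positive scaling and a
distance-preserving bijection). -/
def IsSimilarity {d : ℕ} (f : (Fin d → ℝ) → (Fin d → ℝ)) : Prop :=
  Function.Bijective f ∧ ∃ r : ℝ, 0 < r ∧ ∀ x y, eudist (f x) (f y) = r * eudist x y

/-- The multiset of edges (with multiplicity) traversed by a vertex sequence. -/
def pathEdges {n : ℕ} (α : List (Fin n)) : Multiset (Sym2 (Fin n)) :=
  ↑((α.zip α.tail).map fun e => s(e.1, e.2))

/-- A path: a finite nonempty sequence of vertices with no vertex immediately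
repeated. -/
def IsPathSeq {n : ℕ} (α : List (Fin n)) : Prop :=
  α ≠ [] ∧ α.Chain' (· ≠ ·)

/-- A loop: a path whose endpoints coincide. -/
def IsLoopSeq {n : ℕ} (α : List (Fin n)) : Prop :=
  IsPathSeq α ∧ α.head? = α.getLast?

/-- `GoodSeq loop α`: `α` is a loop when `loop = true`, and a path when
`loop = false`. -/
def GoodSeq {n : ℕ} (loop : Bool) (α : List (Fin n)) : Prop :=
  match loop with
  | true => IsLoopSeq α
  | false => IsPathSeq α

/-- The Euclidean length of a path or loop in the configuration `p`: the sum of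
the Euclidean lengths of its edges, with multiplicity. -/
noncomputable def pathLen {n d : ℕ} (p : Fin n → Fin d → ℝ) (α : List (Fin n)) : ℝ :=
  ((α.zip α.tail).map fun e => eudist (p e.1) (p e.2)).sum

/-- A path measurement ensemble allows for trilateration: after reordering the
vertices by a permutation `π`, the ensemble contains (as single-edge paths) all
edges of a base `K_{d+2}` on the first `d+2` vertices, and for every later
vertex `j` it contains `d+1` edges from `j` back to earlier vertices.
(Paths are identified with their edge multisets.) -/
def PathTrilat {n m : ℕ} (d : ℕ) (hn : d + 2 ≤ n) (A : Fin m → List (Fin n)) : Prop :=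
  ∃ π : Equiv.Perm (Fin n),
    (∀ i j : Fin n, i.val < d + 2 → j.val < d + 2 → i ≠ j →
      ∃ k, pathEdges (A k) = {s(π i, π j)}) ∧
    (∀ j : Fin n, d + 2 ≤ j.val →
      ∃ I : Fin (d + 1) → Fin n, Function.Injective I ∧
        ∀ t, (I t).val < j.val ∧ ∃ k, pathEdges (A k) = {s(π (I t), π j)})

/-- A loop measurement ensemble allows for trilateration: after reordering the
vertices by a permutation `π`, the ensemble contains a base `K_{d+2}` over the
first `d+2` vertices — namely the `d+1` pings `[v₀,a,v₀]` and all triangles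
`[v₀,a,b,v₀]` with endpoints at the first vertex `v₀` — and, for every later
vertex `j`, a ping from `j` back to some earlier vertex `i₁` together with `d`
triangles `[i₁, iₜ, j, i₁]` over earlier vertices.
(Loops are identified with their edge multisets.) -/
def LoopTrilat {n m : ℕ} (d : ℕ) (hn : d + 2 ≤ n) (A : Fin m → List (Fin n)) : Prop :=
  ∃ π : Equiv.Perm (Fin n),
    (∀ a : Fin n, 0 < a.val → a.val < d + 2 →
      ∃ k, pathEdges (A k) =
        {s(π ⟨0, by omega⟩, π a), s(π ⟨0, by omega⟩, π a)}) ∧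
    (∀ a b : Fin n, 0 < a.val → a.val < b.val → b.val < d + 2 →
      ∃ k, pathEdges (A k) =
        {s(π ⟨0, by omega⟩, π a), s(π a, π b), s(π b, π ⟨0, by omega⟩)}) ∧
    (∀ j : Fin n, d + 2 ≤ j.val →
      ∃ I : Fin (d + 1) → Fin n, Function.Injective I ∧ (∀ t, (I t).val < j.val) ∧
        (∃ k, pathEdges (A k) = {s(π (I 0), π j), s(π (I 0), π j)}) ∧
        (∀ t : Fin (d + 1), t ≠ 0 →
          ∃ k, pathEdges (A k) =
            {s(π (I 0), π (I t)), s(π (I t), π j), s(π j, π (I 0))}))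

/-- `Trilat loop`: trilateration in the loop setting when `loop = true` and in the
path setting when `loop = false`. -/
def Trilat {n m : ℕ} (loop : Bool) (d : ℕ) (hn : d + 2 ≤ n)
    (A : Fin m → List (Fin n)) : Prop :=
  match loop with
  | true => LoopTrilat d hn A
  | false => PathTrilat d hn A



namespace UPL
set_option linter.all false

open MvPolynomial

section dd
variable {σ : Type*} [Fintype σ] [DecidableEq σ]

/-- directional derivative -/
noncomputable def dd (h : σ → ℝ) : Derivation ℝ (MvPolynomial σ ℝ) (MvPolynomial σ ℝ) :=
  mkDerivation ℝ (fun a => C (h a))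

lemma dd_X (h : σ → ℝ) (a : σ) : dd h (X a) = C (h a) := mkDerivation_X _ _ _

lemma dd_add (h k : σ → ℝ) : dd (h + k) = dd h + dd k := by
  apply derivation_ext; intro i; simp [dd_X]

lemma dd_smul (c : ℝ) (h : σ → ℝ) : dd (c • h) = c • dd h := by
  apply derivation_ext; intro i; simp [dd_X, smul_eq_C_mul]

lemma dd_single (a : σ) : dd (Pi.single a 1) = pderiv (R := ℝ) a := by
  apply derivation_ext; intro i
  rw [dd_X, pderiv_X]
  by_cases h : i = a
  · subst h; simp
  · simp [h]

lemma der_sum_apply (s : Finset σ) (D : σ → Derivation ℝ (MvPolynomial σ ℝ) (MvPolynomial σ ℝ))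
    (G : MvPolynomial σ ℝ) : (∑ a ∈ s, D a) G = ∑ a ∈ s, D a G := by
  induction s using Finset.induction_on with
  | empty => simp
  | insert a s ha ih => rw [Finset.sum_insert ha, Finset.sum_insert ha, Derivation.add_apply, ih]

lemma dd_eq_sum (h : σ → ℝ) (G : MvPolynomial σ ℝ) : dd h G = ∑ a, C (h a) * pderiv a G := by
  have : dd h = ∑ a, (h a) • pderiv (R := ℝ) a := by
    apply derivation_ext; intro i
    rw [dd_X, der_sum_apply]
    simp only [Derivation.smul_apply, pderiv_X]
    rw [Finset.sum_eq_single i]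
    · simp [smul_eq_C_mul]
    · intro b _ hb; simp [hb.symm]
    · simp
  rw [this, der_sum_apply]
  simp [smul_eq_C_mul]

lemma dd_comm (h k : σ → ℝ) (G : MvPolynomial σ ℝ) : dd h (dd k G) = dd k (dd h G) := by
  have : ⁅dd h, dd k⁆ = 0 := by
    apply derivation_ext; intro i
    simp [Derivation.commutator_apply, dd_X]
  have h2 := congrArg (fun D => D G) this
  simp only [Derivation.commutator_apply, Derivation.zero_apply] at h2
  exact sub_eq_zero.mp h2

lemma totalDegree_pderiv_le {R : Type*} [CommRing R] (G : MvPolynomial σ R) (a : σ) (k : ℕ) (hG : G.totalDegree ≤ k + 1) :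
    (pderiv a G).totalDegree ≤ k := by
  rw [totalDegree_eq]
  apply Finset.sup_le
  intro m hm
  rw [mem_support_iff, coeff_pderiv] at hm
  have h1 : coeff (m + Finsupp.single a 1) G ≠ 0 := left_ne_zero_of_mul hm
  have h2 := (le_totalDegree (mem_support_iff.mpr h1)).trans hG
  rw [Finsupp.sum_add_index' (by simp) (by simp)] at h2
  simp only [Finsupp.sum_single_index] at h2
  rw [Finsupp.card_toMultiset]
  change (m.sum fun _ e => e) ≤ k
  omega

lemma totalDegree_dd_le (G : MvPolynomial σ ℝ) (h : σ → ℝ) (k : ℕ) (hG : G.totalDegree ≤ k + 1) :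
    (dd h G).totalDegree ≤ k := by
  rw [dd_eq_sum]
  apply totalDegree_finsetSum_le
  intro a _
  refine (totalDegree_mul _ _).trans ?_
  simpa using totalDegree_pderiv_le G a k hG

lemma eq_C_of_pderiv (G : MvPolynomial σ ℝ) (h : ∀ a, pderiv a G = 0) : G = C (coeff 0 G) := by
  ext m
  rw [coeff_C]
  split_ifs with hm
  · rw [hm]
  · obtain ⟨a, ha⟩ : ∃ a, m a ≠ 0 := by
      by_contra hc; push Not at hc; exact hm (by ext a; simp [hc a])
    have h1 := coeff_pderiv (i := a) G (m - Finsupp.single a 1)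
    rw [h a] at h1
    have h2 : m - Finsupp.single a 1 + Finsupp.single a 1 = m := by
      ext b
      by_cases hb : b = a
      · subst hb; simp; omega
      · simp [Finsupp.single_apply, Ne.symm hb]
    rw [h2] at h1
    simp at h1
    rcases h1 with h1 | h1
    · exact h1
    · exfalso; norm_cast at h1

/-- restriction to line -/
noncomputable def linePoly (z h : σ → ℝ) : MvPolynomial σ ℝ →ₐ[ℝ] Polynomial ℝ :=
  aeval (fun a => Polynomial.C (z a) + Polynomial.C (h a) * Polynomial.X)

lemma eval_linePoly (z h : σ → ℝ) (G : MvPolynomial σ ℝ) (t : ℝ) :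
    (linePoly z h G).eval t = eval (z + t • h) G := by
  have : (Polynomial.evalRingHom t).comp (linePoly z h).toRingHom = eval (z + t • h) := by
    apply MvPolynomial.ringHom_ext
    · intro r; simp [linePoly]
    · intro i; simp [linePoly]; ring
  exact congrArg (fun f => f G) this

lemma derivative_linePoly (z h : σ → ℝ) (G : MvPolynomial σ ℝ) :
    Polynomial.derivative (linePoly z h G) = linePoly z h (dd h G) := by
  induction G using MvPolynomial.induction_on with
  | C a => simp [linePoly]
  | add p q hp hq => simp [hp, hq]
  | mul_X p i hp =>
    rw [map_mul, Polynomial.derivative_mul, hp, Derivation.leibniz, map_add, smul_eq_mul, smul_eq_mul,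
      map_mul, map_mul, dd_X]
    simp [linePoly]; ring

lemma iterate_derivative_linePoly (z h : σ → ℝ) (G : MvPolynomial σ ℝ) (k : ℕ) :
    Polynomial.derivative^[k] (linePoly z h G) = linePoly z h ((dd h)^[k] G) := by
  induction k generalizing G with
  | zero => rfl
  | succ k ih => rw [Function.iterate_succ_apply, derivative_linePoly, ih, Function.iterate_succ_apply]

end dd
end UPL


namespace UPL
set_option linter.all false

open MvPolynomial

/-- edges -/
abbrev Ed (n : ℕ) := {e : Sym2 (Fin n) // ¬ e.IsDiag}

/-- the edge ij -/
def mkE {n : ℕ} (i j : Fin n) (h : i ≠ j) : Ed n := ⟨s(i, j), by simpa using h⟩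

lemma mkE_comm {n : ℕ} (i j : Fin n) (h : i ≠ j) : mkE i j h = mkE j i h.symm :=
  Subtype.ext Sym2.eq_swap

lemma Ed_ind {n : ℕ} {P : Ed n → Prop} (H : ∀ i j (h : i ≠ j), P (mkE i j h)) (e : Ed n) : P e := by
  rcases e with ⟨e, he⟩
  induction e using Sym2.ind with
  | _ i j => exact H i j (by simpa using he)

lemma mkE_eq {n : ℕ} {i j k l : Fin n} (h : i ≠ j) (h' : k ≠ l) :
    mkE i j h = mkE k l h' ↔ (i = k ∧ j = l) ∨ (i = l ∧ j = k) := by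
  simp [mkE]

/-- squared lengths vector -/
noncomputable def zv {n d : ℕ} (q : Fin n → Fin d → ℝ) : Ed n → ℝ := fun e => sqLenR q e.1

lemma zv_mk {n d : ℕ} (q : Fin n → Fin d → ℝ) (i j : Fin n) (h : i ≠ j) :
    zv q (mkE i j h) = ∑ k, (q i k - q j k) ^ 2 := rfl

/-- bilinear direction -/
noncomputable def bl {n : ℕ} (x y : Fin n → ℝ) : Ed n → ℝ := fun e =>
  Sym2.lift ⟨fun i j => (x i - x j) * (y i - y j), fun i j => by ring⟩ e.1

lemma bl_mk {n : ℕ} (x y : Fin n → ℝ) (i j : Fin n) (h : i ≠ j) :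
    bl x y (mkE i j h) = (x i - x j) * (y i - y j) := rfl

lemma bl_add {n : ℕ} (x y : Fin n → ℝ) (c : ℝ) :
    bl (x + c • y) (x + c • y) = bl x x + (2 * c) • bl x y + (c ^ 2) • bl y y := by
  funext e; induction e using Ed_ind with
  | H i j h => simp [bl_mk]; ring

lemma zv_snoc {n d : ℕ} (q : Fin n → Fin d → ℝ) (x : Fin n → ℝ) (c : ℝ) :
    zv (fun i => (Fin.snoc (q i) (c * x i) : Fin (d+1) → ℝ)) = zv q + (c ^ 2) • bl x x := by
  funext e; induction e using Ed_ind with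
  | H i j h => simp [bl_mk, zv_mk, Fin.sum_univ_castSucc]; ring

lemma linePoly_zero {n d : ℕ} (G : MvPolynomial (Ed n) ℝ)
    (hV : ∀ q : Fin n → Fin (d+1) → ℝ, eval (zv q) G = 0) (q : Fin n → Fin d → ℝ) (x : Fin n → ℝ) :
    linePoly (zv q) (bl x x) G = 0 := by
  apply Polynomial.eq_zero_of_infinite_isRoot
  apply Set.Infinite.mono (s := Set.Ioi (0:ℝ)) _ (Set.Ioi_infinite 0)
  intro t ht
  have ht : 0 < t := ht
  simp only [Set.mem_setOf_eq, Polynomial.IsRoot.def]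
  rw [eval_linePoly]
  have := hV (fun i => (Fin.snoc (q i) (Real.sqrt t * x i) : Fin (d+1) → ℝ))
  rw [zv_snoc, Real.sq_sqrt ht.le] at this
  exact this

lemma bl_single {n : ℕ} (i j : Fin n) (h : i ≠ j) :
    bl (Pi.single i 1) (Pi.single j 1) = - Pi.single (mkE i j h) 1 := by
  funext e; induction e using Ed_ind with
  | H k l h' =>
    simp only [bl_mk, Pi.neg_apply, Pi.single_apply, mkE_eq]
    grind

theorem lowDeg {n : ℕ} (d : ℕ) (G : MvPolynomial (Ed n) ℝ) (hG : G.totalDegree ≤ d)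
    (hV : ∀ q : Fin n → Fin d → ℝ, eval (zv q) G = 0) : G = 0 := by
  induction d generalizing G with
  | zero =>
    have h1 := totalDegree_eq_zero_iff_eq_C.mp (Nat.le_zero.mp hG)
    have := hV (fun _ _ => 0)
    rw [h1] at this ⊢
    simpa using this
  | succ d ih =>
    have key : ∀ x : Fin n → ℝ, dd (bl x x) G = 0 := by
      intro x
      apply ih _ (totalDegree_dd_le _ _ _ hG)
      intro q
      have h1 := linePoly_zero G hV q x
      have h2 := derivative_linePoly (zv q) (bl x x) G
      rw [h1] at h2
      have h3 := congrArg (Polynomial.eval 0) h2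
      rw [eval_linePoly] at h3
      simpa using h3.symm
    have h0 : G = C (coeff 0 G) := by
      apply eq_C_of_pderiv
      intro e
      induction e using Ed_ind with
      | H i j h =>
        have := key (Pi.single i 1 + (1:ℝ) • Pi.single j 1)
        rw [bl_add, dd_add, dd_add, dd_smul, dd_smul, bl_single i j h, 
          ← neg_one_smul ℝ (Pi.single _ _), dd_smul, dd_single] at this
        simpa [key] using this
    have := hV (fun _ _ => 0)
    rw [h0] at this ⊢
    simpa using this

section R
variable {n d : ℕ} (G : MvPolynomial (Ed n) ℝ) (hG : G.totalDegree ≤ d + 2)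
    (hV : ∀ q : Fin n → Fin (d+1) → ℝ, eval (zv q) G = 0)
include hG hV

lemma R0 (x : Fin n → ℝ) : dd (bl x x) (dd (bl x x) G) = 0 := by
  apply lowDeg d _ (totalDegree_dd_le _ _ _ (totalDegree_dd_le _ _ _ hG))
  intro q
  have h1 := linePoly_zero G hV q x
  have h2 := iterate_derivative_linePoly (zv q) (bl x x) G 2
  rw [h1] at h2
  have h3 := congrArg (Polynomial.eval 0) h2
  rw [eval_linePoly] at h3
  simpa using h3.symm

lemma R1 (x y : Fin n → ℝ) : dd (bl x x) (dd (bl x y) G) = 0 ∧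
    (4:ℝ) • dd (bl x y) (dd (bl x y) G) + (2:ℝ) • dd (bl x x) (dd (bl y y) G) = 0 := by
  have key : ∀ c : ℝ, (4 * c) • dd (bl x x) (dd (bl x y) G) + 
      (c ^ 2) • ((4:ℝ) • dd (bl x y) (dd (bl x y) G) + (2:ℝ) • dd (bl x x) (dd (bl y y) G))
      + (4 * c ^ 3) • dd (bl y y) (dd (bl x y) G) = 0 := by
    intro c
    have h := R0 G hG hV (x + c • y)
    have hx := R0 G hG hV x
    have hy := R0 G hG hV y
    rw [bl_add, dd_add, dd_add, dd_smul, dd_smul] at h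
    simp only [Derivation.add_apply, Derivation.smul_apply, map_add, Derivation.map_smul, hx, hy,
      dd_comm (bl x y) (bl x x), dd_comm (bl y y) (bl x x), dd_comm (bl x y) (bl y y)] at h
    rw [← h]
    module
  have k1 := key 1
  have k2 := key (-1)
  have k3 := key 2
  set A := dd (bl x x) (dd (bl x y) G)
  set B := (4:ℝ) • dd (bl x y) (dd (bl x y) G) + (2:ℝ) • dd (bl x x) (dd (bl y y) G)
  set D := dd (bl y y) (dd (bl x y) G)
  have hB : B = 0 := by
    have : B = (1/2:ℝ) • (((4 * 1 : ℝ)) • A + ((1:ℝ) ^ 2) • B + (4 * (1:ℝ) ^ 3) • D) + 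
      (1/2:ℝ) • (((4 * (-1) : ℝ)) • A + ((-1:ℝ) ^ 2) • B + (4 * (-1:ℝ) ^ 3) • D) := by module
    rw [this, k1, k2]; simp
  refine ⟨?_, hB⟩
  have : A = (1/3:ℝ) • (((4 * 1 : ℝ)) • A + ((1:ℝ) ^ 2) • B + (4 * (1:ℝ) ^ 3) • D) - 
      (1/24:ℝ) • (((4 * 2 : ℝ)) • A + ((2:ℝ) ^ 2) • B + (4 * (2:ℝ) ^ 3) • D) - (1/6:ℝ) • B := by module
  rw [this, k1, k3, hB]; simp

lemma star_form (i : Fin n) (h : Ed n → ℝ) (hs : ∀ e : Ed n, i ∉ e.1 → h e = 0) :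
    ∃ y, h = bl (Pi.single i 1) y := by
  classical
  refine ⟨fun j => if hj : i = j then 0 else - h (mkE i j hj), ?_⟩
  funext e; induction e using Ed_ind with
  | H k l hkl =>
    rw [bl_mk]
    by_cases h1 : i = k
    · subst h1; simp [hkl, Pi.single_apply, hkl.symm]
    · by_cases h2 : i = l
      · subst h2; simp [Pi.single_apply, hkl, hkl.symm, mkE_comm k i]
      · rw [hs]
        · simp [Pi.single_apply, Ne.symm h1, Ne.symm h2]
        · simp [mkE, h1, h2]

lemma R3 (i : Fin n) (h : Ed n → ℝ) (hs : ∀ e : Ed n, i ∉ e.1 → h e = 0) :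
    dd h (dd h (dd h G)) = 0 := by
  obtain ⟨y, rfl⟩ := star_form G hG hV i h hs
  obtain ⟨h1, h2⟩ := R1 G hG hV (Pi.single i 1) y
  have h3 := congrArg (dd (bl (Pi.single i 1) y)) h2
  rw [map_add, Derivation.map_smul, Derivation.map_smul, map_zero,
    dd_comm (bl (Pi.single i 1) y) (bl (Pi.single i 1) (Pi.single i 1)),
    dd_comm (bl (Pi.single i 1) y) (bl y y),
    dd_comm (bl (Pi.single i 1) (Pi.single i 1)) (bl y y), h1] at h3
  simpa using h3

lemma R3' (i : Fin n) (h k : Ed n → ℝ) (hs : ∀ e : Ed n, i ∉ e.1 → h e = 0)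
    (ks : ∀ e : Ed n, i ∉ e.1 → k e = 0) :
    dd h (dd h (dd k G)) = 0 := by
  have e1 := R3 G hG hV i h hs
  have e2 := R3 G hG hV i k ks
  have e3 := R3 G hG hV i (h + k) (fun e he => by simp [hs e he, ks e he])
  have e4 := R3 G hG hV i (h + (-1:ℝ) • k) (fun e he => by simp [hs e he, ks e he])
  simp only [dd_add, dd_smul, Derivation.add_apply, Derivation.smul_apply, map_add, Derivation.map_smul, e1, e2,
    dd_comm k h] at e3 e4
  have : dd h (dd h (dd k G)) = (1/6:ℝ) • ((3:ℝ) • dd h (dd h (dd k G)) + (3:ℝ) • dd h (dd k (dd k G)))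
    - (1/6:ℝ) • ((-3:ℝ) • dd h (dd h (dd k G)) + (3:ℝ) • dd h (dd k (dd k G))) := by module
  rw [this, sub_eq_zero]
  trans 0
  · rw [← smul_zero (1/6:ℝ), ← e3]; module
  · rw [← smul_zero (1/6:ℝ), ← e4]; module

/-- the full-star direction -/
lemma Rstar (i : Fin n) (h : Ed n → ℝ) (hs : ∀ e : Ed n, h e = if i ∈ e.1 then 1 else 0) :
    dd h (dd h G) = 0 := by
  have : h = bl (Pi.single i 1) (Pi.single i 1) := by
    funext e; rw [hs]; induction e using Ed_ind with
    | H k l hkl =>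
      rw [bl_mk]; simp only [mkE, Sym2.mem_iff, Pi.single_apply]; grind
  rw [this]; exact R0 G hG hV _
end R
end UPL


namespace UPL
set_option linter.all false

open MvPolynomial Matrix

/-- Cayley-Menger matrix -/
def cm {N : ℕ} {R : Type*} [CommRing R] (z : Ed N → R) :
    Matrix (Option (Fin N)) (Option (Fin N)) R :=
  fun a b => match a, b with
  | none, none => 0
  | none, some _ => 1
  | some _, none => 1
  | some i, some j => if h : i = j then 0 else z (mkE i j h)

section
variable {N : ℕ} {R : Type*} [CommRing R] (z : Ed N → R)
@[simp] lemma cm_nn : cm z none none = 0 := rfl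
@[simp] lemma cm_ns (i : Fin N) : cm z none (some i) = 1 := rfl
@[simp] lemma cm_sn (i : Fin N) : cm z (some i) none = 1 := rfl
lemma cm_ss (i j : Fin N) : cm z (some i) (some j) = if h : i = j then 0 else z (mkE i j h) := rfl
@[simp] lemma cm_d (i : Fin N) : cm z (some i) (some i) = 0 := by simp [cm_ss]
lemma cm_o (i j : Fin N) (h : i ≠ j) : cm z (some i) (some j) = z (mkE i j h) := by simp [cm_ss, h]
lemma cm_symm (a b) : cm z a b = cm z b a := by
  rcases a with _ | i <;> rcases b with _ | j <;> try rfl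
  by_cases h : i = j
  · subst h; rfl
  · rw [cm_o _ _ _ h, cm_o _ _ _ (Ne.symm h), mkE_comm]
end

/-- Cayley-Menger determinant -/
noncomputable def F {N : ℕ} (z : Ed N → ℝ) : ℝ := (cm z).det

/-- CM polynomial -/
noncomputable def FP (N : ℕ) (K : Type*) [CommRing K] : MvPolynomial (Ed N) K := (cm (fun e => X e)).det

lemma cm_map {N : ℕ} {R S : Type*} [CommRing R] [CommRing S] (f : R →+* S) (z : Ed N → R) :
    f.mapMatrix (cm z) = cm (fun e => f (z e)) := by
  ext a b
  rcases a with _ | i <;> rcases b with _ | j <;> simp [cm_ss]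
  split_ifs <;> simp

lemma eval_FP {N : ℕ} (z : Ed N → ℝ) : eval z (FP N ℝ) = F z := by
  rw [FP, RingHom.map_det, cm_map]; simp [F]

lemma map_FP {N : ℕ} : MvPolynomial.map (algebraMap ℚ ℝ) (FP N ℚ) = FP N ℝ := by
  rw [FP, RingHom.map_det, cm_map]; simp [FP]

lemma aeval_FP {N : ℕ} {σ : Type*} (g : Ed N → MvPolynomial σ ℚ) :
    aeval g (FP N ℚ) = (cm g).det := by
  have := RingHom.map_det (aeval g : MvPolynomial (Ed N) ℚ →ₐ[ℚ] _).toRingHom (cm (fun e => X e))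
  rw [cm_map] at this
  simpa [FP] using this

lemma totalDegree_det_cm {N D : ℕ} {σ K : Type*} [Field K] (g : Ed N → MvPolynomial σ K)
    (hg : ∀ e, (g e).totalDegree ≤ D) : ((cm g).det).totalDegree ≤ D * (N - 1) := by
  rw [det_apply']
  apply totalDegree_finsetSum_le
  intro π _
  by_cases hπ : π none = none
  · have : ∏ i, cm g (π i) i = 0 := Finset.prod_eq_zero (Finset.mem_univ none) (by rw [hπ]; rfl)
    rw [this]; simp
  · refine (totalDegree_mul _ _).trans ?_
    have h1 : ((((Equiv.Perm.sign π : ℤˣ) : ℤ) : MvPolynomial σ K)).totalDegree = 0 := by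
      rw [← map_intCast (C : K →+* MvPolynomial σ K)]; exact totalDegree_C _
    rw [h1, zero_add]
    refine (totalDegree_finsetProd _ _).trans ?_
    calc ∑ i, (cm g (π i) i).totalDegree ≤ ∑ i : Option (Fin N), if i = none ∨ i = π.symm none then 0 else D := by
          apply Finset.sum_le_sum
          intro i _
          split_ifs with h
          · rcases h with h | h
            · subst h
              cases h3 : π none with
              | none => exact absurd h3 hπ
              | some j => simp
            · subst h
              simp only [Equiv.apply_symm_apply]
              cases h3 : π.symm none with
              | none => simp
              | some j => simp
          · rcases i with _ | i
            · simp at h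
            · cases h3 : π (some i) with
              | none => simp
              | some j =>
                rw [cm_ss]; split_ifs
                · simp
                · exact hg _
      _ ≤ D * (N - 1) := by
          rw [Finset.sum_ite, Finset.sum_const_zero, zero_add, Finset.sum_const, smul_eq_mul, mul_comm]
          apply Nat.mul_le_mul_left
          have h5 : (Finset.univ.filter fun i : Option (Fin N) => ¬(i = none ∨ i = π.symm none)) 
            = Finset.univ \ {none, π.symm none} := by ext; simp
          rw [h5, Finset.card_sdiff_of_subset (Finset.subset_univ _), Finset.card_pair]
          · simp
          · intro h; apply hπ; rw [Equiv.eq_symm_apply] at h; exact h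

lemma F_scale {N : ℕ} (hN : 1 ≤ N) (t : ℝ) (ht : t ≠ 0) (z : Ed N → ℝ) : F (t • z) = t ^ (N - 1) * F z := by
  have h1 := det_mul_row (fun b : Option (Fin N) => match b with | none => t⁻¹ | some _ => 1)
    (of fun a b => (match a with | none => 1 | some _ => t) * cm z a b)
  have h2 := det_mul_column (fun a : Option (Fin N) => match a with | none => 1 | some _ => t) (cm z)
  rw [h2] at h1
  simp only [Fintype.prod_option] at h1
  have h3 : cm (t • z) = (of fun i j => (match j with | none => t⁻¹ | some _ => 1) * 
    ((match i with | none => 1 | some _ => t) * cm z i j)) := by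
    ext a b
    rcases a with _ | i <;> rcases b with _ | j <;> simp [cm_ss, ht]
  rw [F, h3]
  refine h1.trans ?_
  simp [F]
  obtain ⟨M, rfl⟩ : ∃ M, N = M + 1 := ⟨N - 1, by omega⟩
  simp [pow_succ]; field_simp

lemma F_config {d : ℕ} (q : Fin (d+2) → Fin d → ℝ) : F (zv q) = 0 := by
  let L : (Fin (d+2) → ℝ) →ₗ[ℝ] (Fin d → ℝ) × ℝ :=
    { toFun := fun c => (fun k => ∑ j, c j * q j k, ∑ j, c j)
      map_add' := by intro x y; ext <;> simp [add_mul, Finset.sum_add_distrib]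
      map_smul' := by intro x y; ext <;> simp [Finset.mul_sum, mul_assoc] }
  have hk : LinearMap.ker L ≠ ⊥ := LinearMap.ker_ne_bot_of_finrank_lt (by simp)
  obtain ⟨c, hc, hc0⟩ := (Submodule.ne_bot_iff _).mp hk
  have hc1 : (fun k => ∑ j, c j * q j k, ∑ j, c j) = ((0, 0) : (Fin d → ℝ) × ℝ) := hc
  rw [Prod.mk.injEq] at hc1
  obtain ⟨ha, hb⟩ := hc1
  have ha : ∀ k, ∑ j, c j * q j k = 0 := fun k => congrFun ha k
  rw [F, ← exists_mulVec_eq_zero_iff]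
  refine ⟨fun a => match a with | none => - ∑ j, c j * ∑ k, q j k ^ 2 | some j => c j, ?_, ?_⟩
  · intro h; apply hc0; funext j; exact congrFun h (some j)
  · funext a
    rcases a with _ | i
    · simp [mulVec, dotProduct, Fintype.sum_option, hb]
    · simp only [mulVec, dotProduct, Fintype.sum_option, cm_sn, Pi.zero_apply, one_mul]
      have : ∀ j, cm (zv q) (some i) (some j) * c j = c j * (∑ k, q i k ^ 2) + c j * (∑ k, q j k ^ 2) 
          - 2 * ∑ k, q i k * (c j * q j k) := by
        intro j
        rw [cm_ss]
        split_ifs with h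
        · subst h
          rw [zero_mul, Finset.mul_sum, Finset.mul_sum, ← Finset.sum_add_distrib, 
            ← Finset.sum_sub_distrib]
          symm; apply Finset.sum_eq_zero; intros; ring
        · rw [zv_mk, Finset.sum_mul, Finset.mul_sum, Finset.mul_sum, Finset.mul_sum, 
            ← Finset.sum_add_distrib, ← Finset.sum_sub_distrib]
          apply Finset.sum_congr rfl; intros; ring
      simp only [this, Finset.sum_sub_distrib, Finset.sum_add_distrib, ← Finset.sum_mul, hb, ← Finset.mul_sum]
      rw [Finset.sum_comm]
      simp only [← Finset.mul_sum, ha]; simp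
end UPL


namespace UPL
set_option linter.all false

open MvPolynomial Matrix Filter Topology

lemma det_lim {ι : Type*} [Fintype ι] [DecidableEq ι] (M : ℝ → Matrix ι ι ℝ) (M' : Matrix ι ι ℝ)
    (ρ κ : ι → ℕ) (h : ∀ i j, Tendsto (fun t => (t⁻¹) ^ κ j * ((t⁻¹) ^ ρ i * M t i j)) atTop (𝓝 (M' i j))) :
    Tendsto (fun t => (M t).det / t ^ (∑ i, ρ i + ∑ i, κ i)) atTop (𝓝 M'.det) := by
  have h1 : Tendsto (fun t => (of fun i j => (t⁻¹) ^ κ j * ((t⁻¹) ^ ρ i * M t i j) : Matrix ι ι ℝ)) atTop (𝓝 M') := by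
    exact tendsto_pi_nhds.mpr fun i => tendsto_pi_nhds.mpr fun j => h i j
  have h2 : Continuous (fun A : Matrix ι ι ℝ => A.det) := Continuous.matrix_det continuous_id
  have h3 := (h2.tendsto M').comp h1
  refine h3.congr ?_
  intro t
  have e1 := det_mul_row (fun j => (t⁻¹) ^ κ j) (of fun i j => (t⁻¹) ^ ρ i * M t i j)
  have e2 := det_mul_column (fun j => (t⁻¹) ^ ρ j) (M t)
  rw [e2] at e1
  refine e1.trans ?_
  rw [Finset.prod_pow_eq_pow_sum, Finset.prod_pow_eq_pow_sum, ← mul_assoc, ← pow_add, div_eq_mul_inv, inv_pow,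
    mul_comm, add_comm]

lemma tinv : Tendsto (fun t : ℝ => t⁻¹) atTop (𝓝 0) := tendsto_inv_atTop_zero

lemma tlin (c h : ℝ) : Tendsto (fun t : ℝ => t⁻¹ * (c + t * h)) atTop (𝓝 h) := by
  have : Tendsto (fun t : ℝ => t⁻¹ * c + h) atTop (𝓝 (0 * c + h)) := (tinv.mul_const c).add_const h
  simp only [zero_mul, zero_add] at this
  refine this.congr' ?_
  filter_upwards [eventually_gt_atTop 0] with t ht
  field_simp

lemma tinvc (c : ℝ) : Tendsto (fun t : ℝ => t⁻¹ * c) atTop (𝓝 0) := by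
  simpa using tinv.mul_const c

lemma one_row {N : ℕ} (x : Option (Fin N) → ℝ) (i : Fin N) : 
    (∑ j, cm (fun _ => (1:ℝ)) (some i) (some j) * x (some j)) = ∑ j, x (some j) - x (some i) := by
  have : ∀ j, cm (fun _ => (1:ℝ)) (some i) (some j) * x (some j) = x (some j) - if j = i then x (some j) else 0 := by
    intro j; rw [cm_ss]; by_cases h1 : i = j
    · subst h1; simp
    · simp [h1, Ne.symm h1]
  simp only [this, Finset.sum_sub_distrib]; simp

lemma F_ones {N : ℕ} (hN : 1 ≤ N) : F (fun _ : Ed N => (1:ℝ)) ≠ 0 := by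
  rw [F]; intro hdet
  obtain ⟨x, hx, h⟩ := exists_mulVec_eq_zero_iff.mpr hdet
  have h0 := congrFun h none
  have hs := fun i => congrFun h (some i)
  simp only [mulVec, dotProduct, Fintype.sum_option, cm_nn, cm_ns, cm_sn, Pi.zero_apply, one_mul, zero_mul, zero_add] at h0 hs
  have hs' : ∀ i, x (some i) = x none := by
    intro i
    have h1 := hs i
    rw [one_row, h0] at h1
    linarith
  simp only [hs'] at h0
  simp at h0
  have h00 : x none = 0 := by rcases h0 with h0 | h0; omega; exact h0
  apply hx; funext a; rcases a with _ | i
  · exact h00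
  · rw [hs', h00]; rfl

lemma F_ones_g {N : ℕ} (g : Ed N) : F (Function.update (fun _ : Ed N => (1:ℝ)) g 0) = 0 := by
  induction g using Ed_ind with
  | H a b h =>
  rw [F]
  apply det_zero_of_row_eq (i := some a) (j := some b) (by simpa using h)
  funext c
  rcases c with _ | c
  · simp
  · simp only [cm_ss, Function.update_apply, mkE_eq]; grind

/-- leading coefficient matrix -/
noncomputable def Dl {N : ℕ} (i j : Fin N) (z : Ed N → ℝ) : ℝ :=
  (((cm z).updateRow (some i) (Pi.single (some j) 1)).updateRow (some j) (Pi.single (some i) 1)).det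

lemma Dl_lim {N : ℕ} (i j : Fin N) (hij : i ≠ j) (z : Ed N → ℝ) :
    Tendsto (fun t : ℝ => F (z + t • Pi.single (mkE i j hij) 1) / t ^ 2) atTop (𝓝 (Dl i j z)) := by
  have h := det_lim (fun t => cm (z + t • Pi.single (mkE i j hij) 1)) 
    (((cm z).updateRow (some i) (Pi.single (some j) 1)).updateRow (some j) (Pi.single (some i) 1))
    (fun a => if a = some i ∨ a = some j then 1 else 0) (fun _ => 0) ?_
  · have e1 : (∑ a : Option (Fin N), if a = some i ∨ a = some j then 1 else 0) = 2 := by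
      rw [Finset.sum_boole]
      have : (Finset.univ.filter fun a : Option (Fin N) => a = some i ∨ a = some j) = {some i, some j} := by
        ext; simp
      rw [this, Finset.card_pair (by simpa using hij)]; rfl
    rw [e1] at h
    simpa [F, Dl] using h
  · intro a b
    simp only [pow_zero, one_mul]
    by_cases ha : a = some j
    · subst ha
      simp only [updateRow_self, or_true, if_true, pow_one]
      rcases b with _ | b
      · simpa using tinv
      · simp only [cm_ss]
        by_cases hb : j = b
        · subst hb; simp [hij.symm]
        · simp only [hb, dite_false, Pi.add_apply, Pi.smul_apply, smul_eq_mul]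
          convert tlin _ _ using 2
          simp only [Pi.single_apply, mkE_eq, Option.some.injEq]; grind
    · rw [updateRow_ne ha]
      by_cases ha' : a = some i
      · subst ha'
        simp only [updateRow_self, true_or, if_true, pow_one]
        rcases b with _ | b
        · simpa using tinv
        · simp only [cm_ss]
          by_cases hb : i = b
          · subst hb; simp [hij]
          · simp only [hb, dite_false, Pi.add_apply, Pi.smul_apply, smul_eq_mul]
            convert tlin _ _ using 2
            simp only [Pi.single_apply, mkE_eq, Option.some.injEq]; grind
      · rw [updateRow_ne ha']
        simp only [ha, ha', or_false, if_false, pow_zero, one_mul]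
        refine Tendsto.congr ?_ tendsto_const_nhds
        intro t
        rcases a with _ | a <;> rcases b with _ | b <;> try rfl
        simp only [cm_ss]
        split_ifs with hab
        · rfl
        · simp only [Pi.add_apply, Pi.smul_apply, Pi.single_apply, mkE_eq]
          simp only [Option.some.injEq] at ha ha'
          simp [ha, ha']

lemma sum_others {N : ℕ} (s : Finset (Fin N)) (x : Fin N → ℝ) (c : ℝ) (h0 : ∀ i ∈ s, x i = 0) 
    (h1 : ∀ i ∉ s, x i = c) : ∑ i, x i = (N - s.card : ℝ) * c := by
  rw [← Finset.sum_add_sum_compl s, Finset.sum_eq_zero h0, zero_add,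
    Finset.sum_congr rfl (fun i hi => h1 i (by simpa using hi)), Finset.sum_const, Finset.card_compl, nsmul_eq_mul,
    Nat.cast_sub (by simpa using Finset.card_le_univ s)]
  simp

lemma Dl_ones {N : ℕ} (hN : 3 ≤ N) (i j : Fin N) (hij : i ≠ j) : Dl i j (fun _ => (1:ℝ)) ≠ 0 := by
  rw [Dl]; intro hdet
  obtain ⟨x, hx, h⟩ := exists_mulVec_eq_zero_iff.mpr hdet
  have hj := congrFun h (some j)
  have hi := congrFun h (some i)
  have h0 := congrFun h none
  simp only [mulVec, updateRow_self, updateRow_ne (show some i ≠ some j by simpa using hij), single_dotProduct,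
    updateRow_ne (show none ≠ some j by simp), updateRow_ne (show none ≠ some i by simp), one_mul, Pi.zero_apply] at hi hj h0
  simp only [dotProduct, Fintype.sum_option, cm_nn, cm_ns, one_mul, zero_mul, zero_add] at h0
  have hk : ∀ k ∉ ({i, j} : Finset (Fin N)), x (some k) = x none := by
    intro k hk
    simp at hk
    have h1 := congrFun h (some k)
    simp only [mulVec, updateRow_ne (show some k ≠ some j by simpa using hk.2), 
      updateRow_ne (show some k ≠ some i by simpa using hk.1), Pi.zero_apply] at h1
    simp only [dotProduct, Fintype.sum_option, one_row, h0, cm_sn] at h1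
    linarith
  have h2 := sum_others {i, j} (fun k => x (some k)) (x none) (by simp [hi, hj]) hk
  rw [h0, Finset.card_pair hij] at h2
  have h3 : x none = 0 := by
    rcases mul_eq_zero.mp h2.symm with h | h
    · exfalso; have : (3:ℝ) ≤ N := by exact_mod_cast hN
      push_cast at h; linarith
    · exact h
  apply hx; funext a; rcases a with _ | k
  · exact h3
  · by_cases h5 : k ∈ ({i, j} : Finset (Fin N))
    · simp at h5; rcases h5 with rfl | rfl <;> assumption
    · rw [hk k h5, h3]; rfl

lemma Dl_ones_g {N : ℕ} (i j a b : Fin N) (hab : a ≠ b) (hai : a ≠ i) (haj : a ≠ j) (hbi : b ≠ i) (hbj : b ≠ j) :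
    Dl i j (Function.update (fun _ : Ed N => (1:ℝ)) (mkE a b hab) 0) = 0 := by
  rw [Dl]
  apply det_zero_of_row_eq (i := some a) (j := some b) (by simpa using hab)
  rw [updateRow_ne (by simpa using haj), updateRow_ne (by simpa using hai),
    updateRow_ne (by simpa using hbj), updateRow_ne (by simpa using hbi)]
  funext c
  rcases c with _ | c
  · simp
  · simp only [cm_ss, Function.update_apply, mkE_eq]; grind

lemma Dl_indep {N : ℕ} (i j a : Fin N) (hij : i ≠ j) (hia : i ≠ a) (haj : a ≠ j) (z : Ed N → ℝ) (c : ℝ) :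
    Dl i j (z + c • Pi.single (mkE i a hia) 1) = Dl i j z := by
  rw [Dl, Dl, ← det_updateRow_add_smul_self (((cm z).updateRow (some i) (Pi.single (some j) 1)).updateRow (some j) (Pi.single (some i) 1)) 
    (i := some a) (j := some j) (by simpa using haj) c]
  congr 1
  ext k l
  by_cases hkj : k = some j
  · subst hkj; simp [updateRow_ne, haj.symm]
  · by_cases hka : k = some a
    · subst hka
      have q1 : some a ≠ some j := by simpa using haj
      have q2 : some a ≠ some i := by simpa using hia.symm
      simp only [updateRow_self, updateRow_ne q1, updateRow_ne q2]
      rcases l with _ | l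
      · simp
      · simp only [cm_ss, Pi.add_apply, Pi.smul_apply, Pi.single_apply, mkE_eq, Option.some.injEq]
        by_cases h1 : a = l
        · subst h1; simp [hia.symm]
        · by_cases h2 : l = i <;> simp [h1, h2, hia, hia.symm]
    · rw [updateRow_ne hkj, updateRow_ne hka, updateRow_ne hkj]
      by_cases hki : k = some i
      · subst hki; simp
      · rw [updateRow_ne hki, updateRow_ne hki]
        rcases k with _ | k <;> rcases l with _ | l <;> try rfl
        simp only [Option.some.injEq] at hki hka
        simp [cm_ss, Pi.add_apply, Pi.smul_apply, Pi.single_apply, mkE_eq, hki, hka]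

lemma tri_lim {N : ℕ} (hN : 4 ≤ N) (i j k : Fin N) (hij : i ≠ j) (hik : i ≠ k) (hjk : j ≠ k) (h : Ed N → ℝ)
    (hh : ∀ a b (hab : a ≠ b), h (mkE a b hab) = 
      if a ∈ ({i, j, k} : Finset (Fin N)) ∧ b ∈ ({i, j, k} : Finset (Fin N)) then 1 else 0) :
    ∃ c ≠ 0, Tendsto (fun t : ℝ => F ((fun _ => 1) + t • h) / t ^ 3) atTop (𝓝 c) := by
  set S : Finset (Fin N) := {i, j, k} with hS
  have hc : S.card = 3 := by rw [hS, Finset.card_eq_three]; exact ⟨i, j, k, hij, hik, hjk, rfl⟩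
  let M' : Matrix (Option (Fin N)) (Option (Fin N)) ℝ := fun a b => match a, b with
    | none, b => cm (fun _ => 1) none b
    | some a, none => if a ∈ S then 0 else 1
    | some a, some b => if a ∈ S then (if b ∈ S ∧ a ≠ b then 1 else 0) else cm (fun _ => 1) (some a) (some b)
  refine ⟨M'.det, ?_, ?_⟩
  · intro hdet
    obtain ⟨x, hx, h⟩ := exists_mulVec_eq_zero_iff.mpr hdet
    have h0 := congrFun h none
    simp only [mulVec, dotProduct, M', Fintype.sum_option, cm_nn, cm_ns, one_mul, zero_mul, zero_add, Pi.zero_apply] at h0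
    have h1 : ∀ a ∈ S, ∑ b ∈ S, x (some b) - x (some a) = 0 := by
      intro a ha
      have h1 := congrFun h (some a)
      simp only [mulVec, dotProduct, M', Fintype.sum_option, ha, if_true, zero_mul, zero_add, Pi.zero_apply] at h1
      rw [← h1, ← Finset.sum_erase_add S _ ha, add_sub_cancel_right]
      simp only [ite_mul, one_mul, zero_mul, ← Finset.sum_filter]
      apply Finset.sum_congr _ (fun _ _ => rfl)
      ext b; simp; tauto
    have h2 : ∑ b ∈ S, x (some b) = 0 := by
      have := Finset.sum_eq_zero h1
      rw [Finset.sum_sub_distrib, Finset.sum_const, hc] at this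
      simp at this; linarith
    have h3 : ∀ a ∈ S, x (some a) = 0 := by
      intro a ha; have := h1 a ha; linarith
    have h4 : ∀ a ∉ S, x (some a) = x none := by
      intro a ha
      have h1 := congrFun h (some a)
      simp only [mulVec, dotProduct, M', Fintype.sum_option, ha, if_false, one_mul, Pi.zero_apply, one_row, h0] at h1
      linarith
    have h5 := sum_others S (fun k => x (some k)) (x none) h3 h4
    rw [h0, hc] at h5
    have h6 : x none = 0 := by
      rcases mul_eq_zero.mp h5.symm with h | h
      · exfalso; have : (4:ℝ) ≤ N := by exact_mod_cast hN
        push_cast at h; linarith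
      · exact h
    apply hx; funext a; rcases a with _ | k
    · exact h6
    · by_cases h7 : k ∈ S
      · exact h3 _ h7
      · rw [h4 k h7, h6]; rfl
  · have h := det_lim (fun t => cm ((fun _ => 1) + t • h)) M'
      (fun a => a.elim 0 (fun a => if a ∈ S then 1 else 0)) (fun _ => 0) ?_
    · simpa [F, Fintype.sum_option, hc] using h
    · intro a b
      simp only [pow_zero, one_mul]
      rcases a with _ | a
      · rcases b with _ | b <;> simp [M']
      · by_cases ha : a ∈ S
        · simp only [Option.elim, ha, if_true, pow_one, M']
          rcases b with _ | b
          · simpa [ha] using tinv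
          · simp only [cm_ss]
            by_cases hb : a = b
            · simp [hb]
            · simp only [hb, dite_false, Pi.add_apply, Pi.smul_apply, smul_eq_mul]
              convert tlin _ _ using 2
              rw [hh]; simp [ha, hb]
        · simp only [Option.elim, ha, if_false, pow_zero, M', one_mul]
          rcases b with _ | b
          · simp [ha]
          · simp only [cm_ss]
            by_cases hb : a = b
            · simp [hb]
            · simp [hb, hh, ha]

lemma star_lim {N : ℕ} (o : Fin N) (h : Ed N → ℝ) (hs : ∀ e : Ed N, o ∉ e.1 → h e = 0)
    (a b : Fin N) (ha : o ≠ a) (hb : o ≠ b) (hab : h (mkE o a ha) ≠ h (mkE o b hb)) :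
    ∃ c ≠ 0, Tendsto (fun t : ℝ => F ((fun _ => 1) + t • h) / t ^ 2) atTop (𝓝 c) := by
  let g : Fin N → ℝ := fun b => if hb : o = b then 0 else h (mkE o b hb)
  let M' : Matrix (Option (Fin N)) (Option (Fin N)) ℝ := fun a b => match a, b with
    | none, none => 0
    | none, some b => if b = o then 0 else 1
    | some a, none => if a = o then 0 else 1
    | some a, some b => if a = o then g b else if b = o then g a else if a = b then 0 else 1
  refine ⟨M'.det, ?_, ?_⟩
  · intro hdet
    obtain ⟨x, hx, hk⟩ := exists_mulVec_eq_zero_iff.mpr hdet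
    have h0 := congrFun hk none
    simp only [mulVec, dotProduct, M', Fintype.sum_option, zero_mul, zero_add, Pi.zero_apply] at h0
    have ho := congrFun hk (some o)
    simp only [mulVec, dotProduct, M', Fintype.sum_option, zero_mul, zero_add, Pi.zero_apply, if_true] at ho
    have hb : ∀ b, b ≠ o → x (some b) = x none + g b * x (some o) := by
      intro b hb
      have h1 := congrFun hk (some b)
      simp only [mulVec, dotProduct, M', Fintype.sum_option, hb, if_false, one_mul, Pi.zero_apply] at h1
      have h2 : ∀ c, (if c = o then g b else if b = c then 0 else 1) * x (some c) = 
          (if c = o then 0 else 1) * x (some c) + (if c = o then g b * x (some o) else 0) - if c = b then x (some b) else 0 := by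
        intro c
        by_cases h3 : c = o
        · subst h3; simp [hb.symm]
        · by_cases h4 : c = b
          · subst h4; simp [h3]
          · simp [h3, h4, Ne.symm h4]
      rw [Finset.sum_congr rfl (fun c _ => h2 c), Finset.sum_sub_distrib, Finset.sum_add_distrib, h0] at h1
      simp at h1; linarith
    have hsq : ∑ b, (if b = o then 0 else x (some b) ^ 2) = 0 := by
      have : ∀ b, (if b = o then 0 else x (some b) ^ 2) = x none * ((if b = o then 0 else 1) * x (some b)) + 
          x (some o) * (g b * x (some b)) := by
        intro b
        by_cases h3 : b = o
        · subst h3; simp [g]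
        · simp only [h3, if_false, one_mul]; rw [pow_two]; nth_rewrite 1 [hb b h3]; ring
      rw [Finset.sum_congr rfl (fun c _ => this c), Finset.sum_add_distrib, ← Finset.mul_sum, ← Finset.mul_sum, h0, ho]
      simp
    have hz : ∀ b, b ≠ o → x (some b) = 0 := by
      intro b hb
      have := (Finset.sum_eq_zero_iff_of_nonneg (fun b _ => by split_ifs <;> positivity)).mp hsq b (Finset.mem_univ _)
      simpa [hb] using this
    have e1 := hb a ha.symm
    have e2 := hb b (Ne.symm ‹o ≠ b›)
    rw [hz a ha.symm] at e1
    rw [hz b (Ne.symm ‹o ≠ b›)] at e2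
    simp only [g, ha, dite_false, ‹o ≠ b›] at e1 e2
    have e3 : x (some o) = 0 := by
      by_contra hne
      apply hab
      have : (h (mkE o a ha) - h (mkE o b ‹_›)) * x (some o) = 0 := by linarith
      rcases mul_eq_zero.mp this with h | h
      · linarith
      · exact absurd h hne
    rw [e3] at e1
    apply hx; funext c; rcases c with _ | c
    · simp at e1; exact e1.symm
    · by_cases hc : c = o
      · rw [hc]; exact e3
      · exact hz c hc
  · have h := det_lim (fun t => cm ((fun _ => 1) + t • h)) M'
      (fun a => if a = some o then 1 else 0) (fun a => if a = some o then 1 else 0) ?_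
    · simpa [F] using h
    · intro a b
      rcases a with _ | a
      · rcases b with _ | b
        · simp [M']
        · by_cases hbo : b = o
          · simpa [M', hbo] using tinv
          · simp [M', hbo]
      · rcases b with _ | b
        · by_cases hbo : a = o
          · simpa [M', hbo] using tinv
          · simp [M', hbo]
        · by_cases hao : a = o
          · subst hao
            by_cases hbo : b = a
            · subst hbo; simp [M', g]
            · simp only [M', hbo, cm_ss, Ne.symm hbo, g, if_true, dite_false, Option.some.injEq, if_false, pow_zero, pow_one, one_mul, Pi.add_apply, Pi.smul_apply, smul_eq_mul]
              exact tlin _ _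
          · by_cases hbo : b = o
            · subst hbo
              simp only [M', hao, cm_ss, Ne.symm hao, g, if_true, dite_false, Option.some.injEq, if_false, pow_zero, pow_one, one_mul, Pi.add_apply, Pi.smul_apply, smul_eq_mul]
              rw [mkE_comm b a]
              exact tlin _ _
            · simp only [M', hao, hbo, cm_ss, Option.some.injEq, if_false, pow_zero, one_mul]
              by_cases hab : a = b
              · simp [hab]
              · simp only [hab, dite_false, Pi.add_apply, Pi.smul_apply]
                rw [hs]
                · simp
                · simp [mkE, Ne.symm hao, Ne.symm hbo]
end UPL


namespace UPL
set_option linter.all false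

open MvPolynomial Matrix Filter Topology

lemma deriv_of_eq_mul (P : Polynomial ℝ) (m : ℝ → ℝ) (hm : Continuous m) (h : ∀ t, P.eval t = t * m t) :
    P.derivative.eval 0 = m 0 := by
  have h1 := P.hasDerivAt 0
  have h2 : HasDerivAt (fun t => P.eval t) (m 0) 0 := by
    rw [hasDerivAt_iff_tendsto_slope_zero]
    have : Tendsto m (𝓝[≠] 0) (𝓝 (m 0)) := (hm.tendsto 0).mono_left nhdsWithin_le_nhds
    refine this.congr' ?_
    filter_upwards [self_mem_nhdsWithin] with t ht
    have ht : t ≠ 0 := ht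
    simp [h]; field_simp
  exact h1.unique h2

lemma natDegree_of_iter (m : ℕ) (P : Polynomial ℝ) (h : Polynomial.derivative^[m] P = 0) :
    P.degree < m := by
  induction m generalizing P with
  | zero => simp at h; simp [h]
  | succ m ih =>
    rw [Function.iterate_succ_apply] at h
    have h1 := ih _ h
    rcases Nat.eq_zero_or_pos P.natDegree with h0 | h0
    · rw [Polynomial.eq_C_of_natDegree_eq_zero h0]
      exact lt_of_le_of_lt Polynomial.degree_C_le (by exact_mod_cast Nat.succ_pos m)
    · have hne : P.degree = P.natDegree := Polynomial.degree_eq_natDegree (by rintro rfl; simp at h0)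
      have := Polynomial.degree_derivative_eq P h0
      rw [this] at h1
      rw [hne]
      norm_cast at h1 ⊢
      omega

lemma lim_zero_of_iter (m : ℕ) (P : Polynomial ℝ) (h : Polynomial.derivative^[m] P = 0) :
    Tendsto (fun t => P.eval t / t ^ m) atTop (𝓝 0) := by
  have := Polynomial.div_tendsto_atTop_zero_of_degree_lt P (Polynomial.X ^ m)
    (by simpa using natDegree_of_iter m P h)
  simpa using this

/-- special point -/
noncomputable def z0 {N : ℕ} (k k' : Fin N) : Ed N → ℝ := by
  classical exact fun e => if k ∈ e.1 ∨ k' ∈ e.1 then 0 else 1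

lemma z0_mk {N : ℕ} (k k' a b : Fin N) (hab : a ≠ b) : 
    z0 k k' (mkE a b hab) = if (k = a ∨ k = b) ∨ (k' = a ∨ k' = b) then 0 else 1 := by
  simp [z0, mkE]

lemma pd_eval {N : ℕ} (z : Ed N → ℝ) (e : Ed N) :
    eval z (pderiv e (FP N ℝ)) = (linePoly z (Pi.single e 1) (FP N ℝ)).derivative.eval 0 := by
  rw [derivative_linePoly, eval_linePoly, dd_single]; simp

lemma cm_cont {N : ℕ} (z h : Ed N → ℝ) : Continuous (fun t : ℝ => cm (z + t • h)) := by
  refine continuous_pi fun a => continuous_pi fun b => ?_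
  rcases a with _ | a <;> rcases b with _ | b <;> simp only [cm_nn, cm_ns, cm_sn, cm_ss] <;> try fun_prop
  split_ifs
  · fun_prop
  · simp only [Pi.add_apply, Pi.smul_apply]; fun_prop

lemma pd_z0 {N : ℕ} (k k' : Fin N) (hk : k ≠ k') (e : Ed N) (v : Option (Fin N) → ℝ)
    (hv : ∀ t : ℝ, cm (z0 k k' + t • Pi.single e 1) (some k) = cm (z0 k k' + t • Pi.single e 1) (some k') + t • v) :
    eval (z0 k k') (pderiv e (FP N ℝ)) = ((cm (z0 k k')).updateRow (some k) v).det := by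
  rw [pd_eval, deriv_of_eq_mul _ (fun t => ((cm (z0 k k' + t • Pi.single e 1)).updateRow (some k) v).det)]
  · simp
  · apply Continuous.matrix_det
    exact (cm_cont _ _).matrix_updateRow _ continuous_const
  · intro t
    rw [eval_linePoly, eval_FP, F, ← det_updateRow_smul]
    conv_lhs => rw [← updateRow_eq_self (cm (z0 k k' + t • Pi.single e 1)) (some k), hv t, det_updateRow_add]
    rw [add_eq_right]
    apply det_zero_of_row_eq (i := some k) (j := some k') (by simpa using hk)
    rw [updateRow_self, updateRow_ne (by simpa using hk.symm)]

lemma pd_z0_self {N : ℕ} (hN : 4 ≤ N) (k k' : Fin N) (hk : k ≠ k') :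
    eval (z0 k k') (pderiv (mkE k k' hk) (FP N ℝ)) ≠ 0 := by
  rw [pd_z0 k k' hk _ (Pi.single (some k') 1 - Pi.single (some k) 1)]
  · intro hdet
    obtain ⟨x, hx, h⟩ := exists_mulVec_eq_zero_iff.mpr hdet
    have h0 := congrFun h none
    have h1 := congrFun h (some k)
    have h2 := congrFun h (some k')
    have q2 : some k' ≠ some k := by simpa using hk.symm
    simp only [mulVec, updateRow_self, sub_dotProduct, single_dotProduct, Pi.zero_apply, one_mul,
      updateRow_ne (show none ≠ some k by simp), updateRow_ne q2] at h0 h1 h2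
    simp only [dotProduct, Fintype.sum_option, cm_nn, cm_ns, cm_sn, one_mul, zero_mul, zero_add] at h0 h2
    have h3 : ∀ j, cm (z0 k k') (some k') (some j) = 0 := by
      intro j; rw [cm_ss]; split_ifs
      · rfl
      · rw [z0_mk]; simp
    simp only [h3, zero_mul, Finset.sum_const_zero, add_zero] at h2
    set S : Finset (Fin N) := {k, k'} with hS
    set T := ∑ b ∈ Sᶜ, x (some b) with hT
    have hrow : ∀ b ∈ Sᶜ, x (some b) = T := by
      intro b hb
      simp [hS] at hb
      have h4 := congrFun h (some b)
      have q3 : some b ≠ some k := by simpa using hb.1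
      simp only [mulVec, updateRow_ne q3, Pi.zero_apply] at h4
      simp only [dotProduct, Fintype.sum_option, cm_sn, h2, mul_zero, zero_add] at h4
      have h5 : ∀ c, cm (z0 k k') (some b) (some c) * x (some c) = 
          (if c ∈ Sᶜ then x (some c) else 0) - (if c = b then x (some c) else 0) := by
        intro c; rw [cm_ss]
        by_cases h6 : b = c
        · subst h6; simp [hS, hb]
        · simp only [h6, dite_false, z0_mk, Ne.symm h6, if_false, sub_zero, hS]
          simp [Ne.symm hb.1, Ne.symm hb.2, eq_comm, ite_and]
          grind
      simp only [h5, Finset.sum_sub_distrib, Finset.sum_ite_mem, Finset.univ_inter, ← hT] at h4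
      simp at h4; linarith
    have hT0 : T = 0 := by
      have h6 := Finset.sum_congr rfl hrow
      rw [← hT, Finset.sum_const, Finset.card_compl, hS, Finset.card_pair hk, nsmul_eq_mul, Fintype.card_fin, 
        Nat.cast_sub (by omega)] at h6
      have : ((N:ℝ) - 3) * T = 0 := by push_cast at h6; linarith
      rcases mul_eq_zero.mp this with h | h
      · exfalso; have : (4:ℝ) ≤ N := by exact_mod_cast hN
        linarith
      · exact h
    rw [← Finset.sum_add_sum_compl S, ← hT, hT0, hS, Finset.sum_pair hk] at h0
    apply hx; funext a; rcases a with _ | b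
    · exact h2
    · by_cases hb : b ∈ Sᶜ
      · rw [hrow b hb, hT0]; rfl
      · simp [hS] at hb
        by_cases hbk : b = k
        · subst hbk; simp; linarith
        · obtain rfl := hb hbk; simp; linarith
  · intro t
    funext c
    rcases c with _ | c
    · simp
    · simp only [Pi.add_apply, Pi.smul_apply, cm_ss, z0_mk, Pi.single_apply, Pi.sub_apply, smul_eq_mul, mkE_eq, Option.some.injEq]
      by_cases h1 : k = c
      · subst h1; simp [hk.symm, hk]
      · by_cases h2 : k' = c
        · subst h2; simp [hk.symm, hk]
        · simp [h1, h2, Ne.symm h1, Ne.symm h2]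

lemma pd_z0_ne {N : ℕ} (k k' : Fin N) (hk : k ≠ k') (e : Ed N) (he : e ≠ mkE k k' hk) :
    eval (z0 k k') (pderiv e (FP N ℝ)) = 0 := by
  -- the difference row
  have key : ∀ (a : Fin N) (s : ℝ), a ≠ k → a ≠ k' →
      ((cm (z0 k k')).updateRow (some k) (Pi.single (some a) s)).det = 0 := by
    intro a s h1 h2
    apply det_zero_of_column_eq (i := some k) (j := some k') (by simpa using hk)
    intro c
    by_cases hc : c = some k
    · subst hc; simp [Ne.symm h1, Ne.symm h2]
    · rw [updateRow_ne hc]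
      rcases c with _ | c
      · simp
      · simp only [cm_ss, z0_mk]; grind
  induction e using Ed_ind with
  | H a b hab =>
  rw [Ne, mkE_eq] at he
  have main : ∀ (v : Option (Fin N) → ℝ), (∀ c : Fin N, v (some c) = if h : k = c then (if h' : k' = c then 0 else -(Pi.single (mkE a b hab) 1 : Ed N → ℝ) (mkE k' c h'))
      else (Pi.single (mkE a b hab) 1 : Ed N → ℝ) (mkE k c h) - if h' : k' = c then 0 else (Pi.single (mkE a b hab) 1 : Ed N → ℝ) (mkE k' c h')) → v none = 0 → 
      eval (z0 k k') (pderiv (mkE a b hab) (FP N ℝ)) = ((cm (z0 k k')).updateRow (some k) v).det := by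
    intro v hv hv0
    apply pd_z0 k k' hk
    intro t; funext c; rcases c with _ | c
    · simp [hv0]
    · simp only [Pi.add_apply, Pi.smul_apply, cm_ss, z0_mk, hv, smul_eq_mul]
      by_cases h1 : k = c
      · subst h1; simp [hk.symm]
      · by_cases h2 : k' = c
        · subst h2; simp [hk]
        · simp [h1, h2]; ring
  have zero : ((cm (z0 k k')).updateRow (some k) 0).det = 0 := 
    det_eq_zero_of_row_eq_zero (some k) (by simp)
  have fin : ∀ (x : Fin N) (s : ℝ), x ≠ k → x ≠ k' → (∀ c : Fin N, (if c = x then s else 0) = if h : k = c then (if h' : k' = c then 0 else -(Pi.single (mkE a b hab) 1 : Ed N → ℝ) (mkE k' c h'))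
      else (Pi.single (mkE a b hab) 1 : Ed N → ℝ) (mkE k c h) - if h' : k' = c then 0 else (Pi.single (mkE a b hab) 1 : Ed N → ℝ) (mkE k' c h')) →
      eval (z0 k k') (pderiv (mkE a b hab) (FP N ℝ)) = 0 := by
    intro x s h1 h2 h3
    rw [main (Pi.single (some x) s) (by intro c; rw [← h3]; simp [Pi.single_apply]) (by simp), key x s h1 h2]
  by_cases hak : a = k
  · subst hak
    refine fin b 1 hab.symm (by grind) ?_
    intro c; simp only [Pi.single_apply, mkE_eq]; grind
  by_cases hbk : b = k
  · subst hbk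
    refine fin a 1 hab (by grind) ?_
    intro c; simp only [Pi.single_apply, mkE_eq]; grind
  by_cases hak' : a = k'
  · subst hak'
    refine fin b (-1) (by grind) hab.symm ?_
    intro c; simp only [Pi.single_apply, mkE_eq]; grind
  by_cases hbk' : b = k'
  · subst hbk'
    refine fin a (-1) (by grind) hab ?_
    intro c; simp only [Pi.single_apply, mkE_eq]; grind
  rw [main 0 ?_ rfl, zero]
  intro c; simp only [Pi.single_apply, mkE_eq, Pi.zero_apply]; grind
end UPL


namespace UPL
set_option linter.all false

open MvPolynomial Filter Topology

/-- f(v)=F(v^2) -/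
noncomputable def ff {N : ℕ} (v : Ed N → ℝ) : ℝ := F (fun e => v e ^ 2)

/-- polynomial -/
noncomputable def fP (N : ℕ) : MvPolynomial (Ed N) ℝ := aeval (fun e => (X e : MvPolynomial (Ed N) ℝ) ^ 2) (FP N ℝ)

lemma eval_sqsub {σ : Type*} (v : σ → ℝ) (G : MvPolynomial σ ℝ) :
    eval v (aeval (fun e => (X e : MvPolynomial σ ℝ) ^ 2) G) = eval (fun e => v e ^ 2) G := by
  have : (eval v).comp (aeval (fun e => (X e : MvPolynomial σ ℝ) ^ 2) : MvPolynomial σ ℝ →ₐ[ℝ] MvPolynomial σ ℝ).toRingHom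
      = eval (fun e => v e ^ 2) := by
    apply MvPolynomial.ringHom_ext <;> intros <;> simp
  exact congrArg (fun f => f G) this

lemma eval_fP {N : ℕ} (v : Ed N → ℝ) : eval v (fP N) = ff v := by
  rw [fP, eval_sqsub, eval_FP, ff]

lemma pderiv_sqsub {σ : Type*} [DecidableEq σ] (a : σ) (G : MvPolynomial σ ℝ) :
    pderiv a (aeval (fun e => (X e : MvPolynomial σ ℝ) ^ 2) G) = 
      2 * X a * aeval (fun e => (X e : MvPolynomial σ ℝ) ^ 2) (pderiv a G) := by
  induction G using MvPolynomial.induction_on with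
  | C r => rw [aeval_C]; simp [algebraMap_eq]
  | add p q hp hq => rw [map_add, map_add, hp, hq, map_add, map_add]; ring
  | mul_X p i hp =>
    rw [map_mul, pderiv_mul, hp, pderiv_mul, aeval_X, pderiv_pow, pderiv_X]
    by_cases h : i = a
    · subst h; simp; ring
    · simp [h]; ring

lemma eval_dd_fP {N : ℕ} (v h : Ed N → ℝ) : eval v (dd h (fP N)) =
    ∑ a, h a * (2 * v a * eval (fun e => v e ^ 2) (pderiv a (FP N ℝ))) := by
  rw [dd_eq_sum, map_sum]
  apply Finset.sum_congr rfl
  intro a _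
  rw [map_mul, fP, pderiv_sqsub, map_mul, eval_sqsub]; simp

lemma ff_per {N : ℕ} (v w : Ed N → ℝ) (h : ∀ k : ℕ, ff (v + (k:ℝ) • w) = ff v) (t : ℝ) : ff (v + t • w) = ff v := by
  have : linePoly v w (fP N) - Polynomial.C (ff v) = 0 := by
    apply Polynomial.eq_zero_of_infinite_isRoot
    apply Set.Infinite.mono (s := Set.range (fun k : ℕ => (k:ℝ))) _ (Set.infinite_range_of_injective Nat.cast_injective)
    rintro _ ⟨k, rfl⟩
    simp [eval_linePoly, eval_fP, h]
  have h2 := congrArg (Polynomial.eval t) this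
  simp [eval_linePoly, eval_fP] at h2
  linarith

/-- flip -/
noncomputable def flp {σ : Type*} [DecidableEq σ] (g : σ) (v : σ → ℝ) : σ → ℝ := v - (2 * v g) • Pi.single g 1

lemma flp_sq {σ : Type*} [DecidableEq σ] (g : σ) (v : σ → ℝ) : (fun e => flp g v e ^ 2) = fun e => v e ^ 2 := by
  funext e
  by_cases h : e = g
  · subst h; simp [flp]; ring
  · simp [flp, h]

lemma ff_flp {N : ℕ} (g : Ed N) (v : Ed N → ℝ) : ff (flp g v) = ff v := by rw [ff, flp_sq, ff]

lemma NT {σ : Type*} [DecidableEq σ] (f : (σ → ℝ) → ℝ) (hf : ∀ g v, f (flp g v) = f v) (Q : (σ → ℝ) → Prop) (u : σ → ℝ) (g : σ)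
    (hu : u g ≠ 0) (hQ : ∀ v, Q v → ∀ t : ℝ, f (v + t • u) = f v) (hQ1 : ∀ v, Q v → Q (flp g v)) 
    (hQ2 : ∀ v (t : ℝ), Q v → Q (v + t • u)) (v : σ → ℝ) (hv : Q v) (s : ℝ) : f (v + s • Pi.single g 1) = f v := by
  set t := s / (2 * u g) with ht
  have h1 := hQ v hv t
  have h2 := hQ _ (hQ1 _ (hQ2 v t hv)) (-t)
  rw [hf, h1] at h2
  rw [← h2, ← hf g (v + s • Pi.single g 1)]
  congr 1
  funext e
  by_cases h : e = g
  · subst h; simp [flp]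
    have : s = 2 * t * u e := by rw [ht]; field_simp
    rw [this]; ring
  · simp [flp, h]

lemma ff_ones {N : ℕ} (hN : 1 ≤ N) (v : Ed N → ℝ) (hv : ∀ e, v e ^ 2 = 1) : ff v ≠ 0 := by
  rw [ff]; simp only [hv]; exact F_ones hN

lemma ff_ones_g {N : ℕ} (v : Ed N → ℝ) (g : Ed N) (hv : ∀ e ≠ g, v e ^ 2 = 1) (hg : v g = 0) : ff v = 0 := by
  rw [ff, ← F_ones_g g]; congr 1; funext e
  by_cases h : e = g
  · subst h; simp [hg]
  · simp [h, hv e h]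

lemma ff_not_inv {N : ℕ} (hN : 1 ≤ N) (v : Ed N → ℝ) (g : Ed N) (hv : ∀ e, v e ^ 2 = 1)
    (h : ∀ s : ℝ, ff (v + s • Pi.single g 1) = ff v) : False := by
  apply ff_ones hN v hv
  rw [← h (- v g)]
  apply ff_ones_g _ g
  · intro e he; simp [he, hv]
  · simp

section refl
variable {N : ℕ} (hN : 4 ≤ N) (u : Ed N → ℝ) (φ : (Ed N → ℝ) →ₗ[ℝ] ℝ) (hφu : φ u = 1)
  (hR : ∀ v, ff (v - (2 * φ v) • u) = ff v) (e : Ed N)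
include hN hφu hR

lemma refl_case1 (hα : u e = 0) (hβ : φ (Pi.single e 1) ≠ 0) : False := by
  set β := φ (Pi.single e 1) with hβd
  have h1 : ∀ v, ff (v - (4 * β * v e) • u) = ff v := by
    intro v
    have h0 : ff _ = ff v := (hR (flp e (flp e v - (2 * φ (flp e v)) • u))).trans ((ff_flp e _).trans ((hR (flp e v)).trans (ff_flp e v)))
    rw [← h0]
    congr 1
    simp only [flp, map_sub, map_smul, hφu, ← hβd, Pi.sub_apply, Pi.smul_apply, hα, smul_eq_mul, Pi.single_eq_same]
    module
  have h2 : ∀ v, v e ≠ 0 → ∀ t : ℝ, ff (v + t • u) = ff v := by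
    intro v hv t
    have h3 : ∀ k : ℕ, ff (v + (k:ℝ) • ((-4 * β * v e) • u)) = ff v := by
      intro k
      induction k with
      | zero => simp
      | succ k ih =>
        rw [← ih, ← h1 (v + (k:ℝ) • ((-4 * β * v e) • u))]
        congr 1
        simp only [Pi.add_apply, Pi.smul_apply, hα, smul_eq_mul]
        push_cast
        module
    have h4 := ff_per _ _ h3 (t / (-4 * β * v e))
    rw [← h4, smul_smul]; congr 3; field_simp
  obtain ⟨g, hg⟩ : ∃ g, u g ≠ 0 := by
    by_contra hc; push Not at hc
    have : u = 0 := funext hc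
    rw [this] at hφu; simp at hφu
  have hge : g ≠ e := by rintro rfl; exact hg hα
  refine ff_not_inv (by omega) (fun _ => 1) g (by simp) (NT ff ff_flp (fun v => v e ≠ 0) u g hg h2 ?_ ?_ _ (by simp))
  · intro v hv; simpa [flp, hge.symm] using hv
  · intro v t hv; simpa [hα] using hv

lemma refl_case2 (hα : u e ≠ 0) (hβ : φ (Pi.single e 1) = 0) : False := by
  have h1 : ∀ v, ff (v + (4 * φ v * u e) • Pi.single e 1) = ff v := by
    intro v
    rw [← ff_flp e v, ← hR (flp e v), ← ff_flp e (_ - _), ← hR (flp e (_ - _))]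
    congr 1
    simp only [flp, map_sub, map_smul, hφu, hβ, Pi.sub_apply, Pi.smul_apply, smul_eq_mul, Pi.single_eq_same]
    module
  have h2 : ∀ v, φ v ≠ 0 → ∀ t : ℝ, ff (v + t • Pi.single e 1) = ff v := by
    intro v hv t
    have h3 : ∀ k : ℕ, ff (v + (k:ℝ) • ((4 * φ v * u e) • Pi.single e 1)) = ff v := by
      intro k
      induction k with
      | zero => simp
      | succ k ih =>
        rw [← ih, ← h1 (v + (k:ℝ) • ((4 * φ v * u e) • Pi.single e 1))]
        congr 1
        simp only [map_add, map_smul, hβ, smul_eq_mul]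
        push_cast
        module
    have h4 := ff_per _ _ h3 (t / (4 * φ v * u e))
    rw [← h4, smul_smul]; congr 3; field_simp
  let v : Ed N → ℝ := fun g => if 0 ≤ φ (Pi.single g 1) then 1 else -1
  have hv : φ v = ∑ g, |φ (Pi.single g 1)| := by
    conv_lhs => rw [pi_eq_sum_univ' v]
    rw [map_sum]
    apply Finset.sum_congr rfl
    intro g _
    have : (fun j => if g = j then (1:ℝ) else 0) = Pi.single g 1 := by funext j; simp [Pi.single_apply, eq_comm]
    rw [map_smul]
    simp only [this, v, smul_eq_mul]
    split_ifs with h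
    · rw [abs_of_nonneg h]; ring
    · rw [abs_of_neg (by linarith)]; ring
  refine ff_not_inv (by omega) v e ?_ (h2 v ?_)
  · intro g; simp only [v]; split_ifs <;> norm_num
  · rw [hv]; intro h0
    have h5 : ∀ g, φ (Pi.single g 1) = 0 := by
      intro g
      have := (Finset.sum_eq_zero_iff_of_nonneg (fun g _ => abs_nonneg _)).mp h0 g (Finset.mem_univ _)
      simpa using this
    have : φ u = 0 := by
      rw [pi_eq_sum_univ' u, map_sum]
      apply Finset.sum_eq_zero
      intro g _
      rw [map_smul, h5]; simp
    rw [hφu] at this; norm_num at this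

end refl
end UPL


namespace UPL
set_option linter.all false

open MvPolynomial Filter Topology

lemma deriv_aeval {σ : Type*} [Fintype σ] [DecidableEq σ] (γ : σ → Polynomial ℝ) (G : MvPolynomial σ ℝ) :
    Polynomial.derivative (aeval γ G) = ∑ a, Polynomial.derivative (γ a) * aeval γ (pderiv a G) := by
  induction G using MvPolynomial.induction_on with
  | C r => rw [aeval_C]; simp [Polynomial.algebraMap_eq]
  | add p q hp hq => simp only [map_add, hp, hq, mul_add, Finset.sum_add_distrib]
  | mul_X p i hp =>
    rw [map_mul, Polynomial.derivative_mul, hp, aeval_X]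
    simp only [pderiv_mul, map_add, map_mul, mul_add, Finset.sum_add_distrib, aeval_X, pderiv_X]
    congr 1
    · rw [Finset.sum_mul]; apply Finset.sum_congr rfl; intros; ring
    · rw [Finset.sum_eq_single i]
      · simp; ring
      · intro b _ hb; simp [Ne.symm hb]
      · simp

lemma eval_aeval_poly {σ : Type*} (γ : σ → Polynomial ℝ) (G : MvPolynomial σ ℝ) (t : ℝ) :
    (aeval γ G).eval t = eval (fun a => (γ a).eval t) G := by
  have : (Polynomial.evalRingHom t).comp (aeval γ : MvPolynomial σ ℝ →ₐ[ℝ] Polynomial ℝ).toRingHom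
      = eval (fun e => (γ e).eval t) := by
    apply MvPolynomial.ringHom_ext <;> intros <;> simp [Polynomial.algebraMap_eq]
  exact congrArg (fun f => f G) this

lemma ff_scale {N : ℕ} (hN : 1 ≤ N) (t : ℝ) (ht : t ≠ 0) (v : Ed N → ℝ) : ff (t • v) = t ^ (2 * (N - 1)) * ff v := by
  rw [ff, ff, pow_mul, ← F_scale hN _ (pow_ne_zero 2 ht)]
  congr 1; funext e; simp [mul_pow]

lemma curve {N : ℕ} (w a b : Ed N → ℝ) (m : ℕ) (T : Set ℝ) (hT : T.Infinite)
    (h : ∀ τ ∈ T, ff (τ • w + τ ^ 2 • a + b) = τ ^ m * ff (w + a + b)) :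
    eval (w + a + b) (dd (w + (2:ℝ) • a) (fP N)) = m * ff (w + a + b) := by
  let γ : Ed N → Polynomial ℝ := fun e => Polynomial.C (w e) * Polynomial.X + Polynomial.C (a e) * Polynomial.X ^ 2 + Polynomial.C (b e)
  have hγ : ∀ τ : ℝ, (fun e => (γ e).eval τ) = τ • w + τ ^ 2 • a + b := by
    intro τ; funext e; simp [γ]; ring
  have h0 : aeval γ (fP N) - Polynomial.C (ff (w + a + b)) * Polynomial.X ^ m = 0 := by
    apply Polynomial.eq_zero_of_infinite_isRoot
    apply hT.mono
    intro τ hτ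
    simp only [Set.mem_setOf_eq, Polynomial.IsRoot, Polynomial.eval_sub, eval_aeval_poly, hγ, eval_fP, h τ hτ]
    simp; ring
  have h1 := congrArg (fun P => (Polynomial.derivative P).eval 1) h0
  simp only [Polynomial.derivative_sub, deriv_aeval, Polynomial.eval_sub, Polynomial.eval_finset_sum, Polynomial.eval_mul, eval_aeval_poly, hγ] at h1
  rw [dd_eq_sum, map_sum]
  have h2 : ∀ x, eval (w + a + b) (C ((w + (2:ℝ) • a) x) * pderiv x (fP N)) = 
    Polynomial.eval 1 (Polynomial.derivative (γ x)) * (eval ((1:ℝ) • w + (1:ℝ)^2 • a + b)) (pderiv x (fP N)) := by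
    intro x; simp [γ]; left; ring
  rw [Finset.sum_congr rfl (fun x _ => h2 x)]
  simp [Polynomial.derivative_X_pow] at h1 ⊢
  linarith

lemma z0_sq {N : ℕ} (k k' : Fin N) : (fun e => z0 k k' e ^ 2) = z0 k k' := by
  funext e; simp only [z0]; split_ifs <;> simp

section refl
variable {N : ℕ} (hN : 4 ≤ N) (u : Ed N → ℝ) (φ : (Ed N → ℝ) →ₗ[ℝ] ℝ) (hφu : φ u = 1)
  (hR : ∀ v, ff (v - (2 * φ v) • u) = ff v) (e : Ed N)
include hN hφu hR

lemma refl_case3 (hx : u e * φ (Pi.single e 1) < 0) : False := by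
  set α := u e with hα
  set β := φ (Pi.single e 1) with hβ
  have hα0 : α ≠ 0 := by rintro h; rw [h] at hx; simp at hx
  have hβ0 : β ≠ 0 := by rintro h; rw [h] at hx; simp at hx
  set c := 1 - α * β with hc
  have hc0 : 0 < c := by rw [hc]; linarith
  set κ := Real.sqrt (-(c * α / β)) with hκ
  have hq : 0 < -(c * α / β) := by
    have : -(c * α / β) = c * (-(α * β)) / β ^ 2 := by field_simp
    rw [this]; have := sq_pos_of_ne_zero hβ0
    have : 0 < -(α * β) := by linarith
    positivity
  have hκ0 : 0 < κ := Real.sqrt_pos.mpr hq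
  have hκ2 : β * κ ^ 2 = - (c * α) := by
    rw [hκ, Real.sq_sqrt hq.le]; field_simp
  set E : Ed N → ℝ := Pi.single e 1 with hE
  have hEe : E e = 1 := by simp [hE]
  set u' := u - α • E with hu'
  have hu'e : u' e = 0 := by simp [hu', hEe, hα]
  have hφu' : φ u' = c := by rw [hu', map_sub, map_smul, hφu, ← hβ, hc]; simp
  have huu : u = u' + α • E := by rw [hu']; module
  let T : (Ed N → ℝ) → (Ed N → ℝ) := fun v => flp e v - (2 * φ (flp e v)) • u
  have hT : ∀ v, ff (T v) = ff v := fun v => by simp only [T]; rw [hR, ff_flp]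
  have hTc : ∀ (w : Ed N → ℝ) (x y : ℝ), w e = 0 → φ w = 0 → 
      T (w + x • E + y • u') = w + (-x - 2 * α * (c * y - β * x)) • E + (y - 2 * (c * y - β * x)) • u' := by
    intro w x y hw hw'
    simp only [T, flp, map_sub, map_add, map_smul, hw', hφu', ← hβ, Pi.add_apply, Pi.smul_apply, hw, hEe, hu'e, smul_eq_mul]
    rw [← hE, ← hβ, huu]
    module
  set l := 1 - 2 * c + 2 * β * κ with hl
  set l' := 1 - 2 * c - 2 * β * κ with hl'
  have hll : l * l' = 1 := by
    have : l * l' = (1 - 2 * c)^2 - 4 * β * (β * κ ^ 2) := by rw [hl, hl']; ring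
    rw [this, hκ2]
    have : α * β = 1 - c := by rw [hc]; ring
    linear_combination 4 * c * this
  have hsum : l + l' < -2 := by rw [hl, hl', hc]; linarith
  have hαβ : α * β = 1 - c := by rw [hc]; ring
  let ξ := κ • E + u'
  let η := (-κ) • E + u'
  have hTk : ∀ (w : Ed N → ℝ) (s t : ℝ), w e = 0 → φ w = 0 → ∀ k : ℕ, 
      ff (w + (l ^ k * s) • ξ + (l' ^ k * t) • η) = ff (w + s • ξ + t • η) := by
    intro w s t hw hw' k
    induction k with
    | zero => simp
    | succ k ih =>
      rw [← ih, ← hT (w + (l ^ k * s) • ξ + (l' ^ k * t) • η)]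
      have : w + (l ^ k * s) • ξ + (l' ^ k * t) • η = w + (κ * (l ^ k * s) - κ * (l' ^ k * t)) • E + ((l ^ k * s) + (l' ^ k * t)) • u' := by
        simp only [ξ, η]; module
      rw [this, hTc w _ _ hw hw']
      have : w + (l ^ (k+1) * s) • ξ + (l' ^ (k+1) * t) • η = w + (κ * (l ^ (k+1) * s) - κ * (l' ^ (k+1) * t)) • E + ((l ^ (k+1) * s) + (l' ^ (k+1) * t)) • u' := by
        simp only [ξ, η]; module
      rw [this]
      congr 1
      congr 1
      · congr 2
        rw [pow_succ, pow_succ]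
        have h1 : l ^ k * l * s = (l ^ k * s) * l := by ring
        have h2 : l' ^ k * l' * t = (l' ^ k * t) * l' := by ring
        rw [h1, h2]
        generalize l ^ k * s = A
        generalize l' ^ k * t = B
        rw [hl, hl']
        linear_combination (2 * A + 2 * B) * hκ2 - (2*κ*A-2*κ*B) * hαβ
      · congr 1
        rw [pow_succ, pow_succ, hl, hl']; ring
  have hinf : (Set.range (fun k : ℕ => l ^ k)).Infinite := by
    apply Set.infinite_range_of_injective
    have hl0 : l ≠ 0 := by rintro h; rw [h] at hll; simp at hll
    have hl1 : l ^ 2 ≠ 1 := by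
      intro h
      have : l = l' := by
        have : l * (l - l') = 0 := by linear_combination h - hll
        rcases mul_eq_zero.mp this with h | h
        · exact absurd h hl0
        · linarith
      have : (l + 1) * (l - 1) = 0 := by linear_combination h
      rcases mul_eq_zero.mp this with h | h <;> linarith
    intro a b hab
    have : (l ^ 2) ^ a = (l ^ 2) ^ b := by
      simp only at hab
      rw [← pow_mul, ← pow_mul, mul_comm 2 a, mul_comm 2 b, pow_mul, pow_mul, hab]
    exact pow_right_injective₀ (by positivity) hl1 this
  have key : ∀ v, eval v (dd ((κ * ((φ v - β * v e) / c)) • E + (v e / κ) • u') (fP N)) = 0 := by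
    intro v
    set s := ((φ v - β * v e) / c + v e / κ) / 2 with hs
    set t := ((φ v - β * v e) / c - v e / κ) / 2 with ht
    set w := v - s • ξ - t • η with hw
    have hwe : w e = 0 := by
      simp only [hw, ξ, η, Pi.sub_apply, Pi.add_apply, Pi.smul_apply, hEe, hu'e, smul_eq_mul, hs, ht]; field_simp; ring
    have hwφ : φ w = 0 := by
      simp only [hw, ξ, η, map_sub, map_add, map_smul, hφu', ← hβ, smul_eq_mul, hs, ht]; field_simp; ring
    have hv : w + s • ξ + t • η = v := by rw [hw]; module
    have hl0 : l ≠ 0 := by rintro h; rw [h] at hll; simp at hll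
    have h1 := curve w (s • ξ) (t • η) (2 * (N - 1)) _ hinf (by
      rintro _ ⟨k, rfl⟩
      have h3 := hTk w s t hwe hwφ k
      rw [← h3, ← ff_scale (by omega) _ (pow_ne_zero k hl0)]
      congr 1
      have : l ^ k * l' ^ k = 1 := by rw [← mul_pow, hll, one_pow]
      simp only [smul_add, smul_smul]
      congr 1
      · congr 2; ring
      · congr 1; rw [← mul_assoc, this, one_mul])
    have h2 := curve v 0 0 (2 * (N - 1)) _ hinf (by
      rintro _ ⟨k, rfl⟩
      simp [ff_scale (by omega : 1 ≤ N) _ (pow_ne_zero k hl0)])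
    rw [hv] at h1
    simp only [add_zero, smul_zero] at h2
    have h3 : (κ * ((φ v - β * v e) / c)) • E + (v e / κ) • u' = (w + (2:ℝ) • s • ξ) + (-1:ℝ) • v := by
      rw [← hv]
      have e1 : κ * ((φ v - β * v e) / c) = κ * (s + t) := by rw [hs, ht]; ring
      have e2 : v e / κ = s - t := by rw [hs, ht]; ring
      rw [hv, e1, e2, ← hv]
      simp only [ξ, η]
      module
    rw [h3, dd_add, dd_smul]
    simp [h1, h2]
  have hsum : ∀ v, κ * ((φ v - β * v e) / c) * (2 * v e * eval (fun x => v x ^ 2) (pderiv e (FP N ℝ))) + 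
      (v e / κ) * ∑ g, u' g * (2 * v g * eval (fun x => v x ^ 2) (pderiv g (FP N ℝ))) = 0 := by
    intro v
    rw [← key v, dd_add, dd_smul, dd_smul, hE, Derivation.add_apply, Derivation.smul_apply, Derivation.smul_apply, map_add, smul_eval, smul_eval, eval_dd_fP, eval_dd_fP]
    simp [Pi.single_apply]
  have hflip : ∀ g ≠ e, ∀ v : Ed N → ℝ, v g * v e * (κ * φ (Pi.single g 1) / c * eval (fun x => v x ^ 2) (pderiv e (FP N ℝ)) + u g / κ * eval (fun x => v x ^ 2) (pderiv g (FP N ℝ))) = 0 := by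
    intro g hg v
    have h1 := hsum v
    have h2 := hsum (flp g v)
    rw [flp_sq] at h2
    have h3 : flp g v e = v e := by simp [flp, hg.symm]
    have h4 : φ (flp g v) = φ v - 2 * v g * φ (Pi.single g 1) := by simp [flp]
    have h5 : ∑ x, u' x * (2 * v x * eval (fun x => v x ^ 2) (pderiv x (FP N ℝ))) - 
        ∑ x, u' x * (2 * flp g v x * eval (fun x => v x ^ 2) (pderiv x (FP N ℝ))) = u g * (4 * v g * eval (fun x => v x ^ 2) (pderiv g (FP N ℝ))) := by
      rw [← Finset.sum_sub_distrib, Finset.sum_eq_single g]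
      · have : u' g = u g := by simp [hu', hE, hg]
        rw [this]; simp [flp]; ring
      · intro b _ hb; simp [flp, hb]
      · simp
    rw [h3, h4] at h2
    have h6 : ∑ x, u' x * (2 * flp g v x * eval (fun x => v x ^ 2) (pderiv x (FP N ℝ))) = ∑ x, u' x * (2 * v x * eval (fun x => v x ^ 2) (pderiv x (FP N ℝ))) - u g * (4 * v g * eval (fun x => v x ^ 2) (pderiv g (FP N ℝ))) := by linarith
    rw [h6] at h2
    linear_combination (h1 - h2) / 4
  have hug : ∀ g ≠ e, u g = 0 := by
    intro g hg
    let S : MvPolynomial (Ed N) ℝ := C (κ * φ (Pi.single g 1) / c) * pderiv e (FP N ℝ) + C (u g / κ) * pderiv g (FP N ℝ)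
    have h1 : X g * X e * aeval (fun e => (X e : MvPolynomial (Ed N) ℝ) ^ 2) S = 0 := by
      apply MvPolynomial.funext
      intro v
      rw [map_mul, eval_sqsub]
      simpa [S] using hflip g hg v
    have h2 : aeval (fun e => (X e : MvPolynomial (Ed N) ℝ) ^ 2) S = 0 := by
      rcases mul_eq_zero.mp h1 with h | h
      · rcases mul_eq_zero.mp h with h | h <;> exact absurd h (X_ne_zero _)
      · exact h
    induction g using Ed_ind with
    | H k k' hk =>
      have h3 := congrArg (eval (z0 k k')) h2
      rw [eval_sqsub, z0_sq] at h3
      simp only [S, map_add, map_mul, eval_C, pd_z0_ne k k' hk e hg.symm, map_zero, mul_zero, zero_add] at h3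
      rcases mul_eq_zero.mp h3 with h | h
      · rcases div_eq_zero_iff.mp h with h | h
        · exact h
        · exact absurd h hκ0.ne'
      · exact absurd h (pd_z0_self hN k k' hk)
  have : u' = 0 := by
    funext g
    by_cases hg : g = e
    · rw [hg, hu'e]; rfl
    · simp [hu', hE, hg, hug g hg]
  rw [this] at hφu'
  simp at hφu'
  exact hc0.ne hφu'

lemma refl_concl : (u e = 0 ∧ φ (Pi.single e 1) = 0) ∨ 0 < u e * φ (Pi.single e 1) := by
  by_cases h1 : u e = 0
  · by_cases h2 : φ (Pi.single e 1) = 0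
    · exact Or.inl ⟨h1, h2⟩
    · exact (refl_case1 hN u φ hφu hR e h1 h2).elim
  · by_cases h2 : φ (Pi.single e 1) = 0
    · exact (refl_case2 hN u φ hφu hR e h1 h2).elim
    · rcases lt_trichotomy (u e * φ (Pi.single e 1)) 0 with h | h | h
      · exact (refl_case3 hN u φ hφu hR e h).elim
      · rcases mul_eq_zero.mp h with h | h <;> contradiction
      · exact Or.inr h
end refl
end UPL


namespace UPL
set_option linter.all false

open MvPolynomial Matrix Filter Topology

lemma Dl_self {N : ℕ} (i j : Fin N) (hij : i ≠ j) (z : Ed N → ℝ) (c : ℝ) :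
    Dl i j (z + c • Pi.single (mkE i j hij) 1) = Dl i j z := by
  rw [Dl, Dl]
  congr 1
  ext k l
  by_cases hkj : k = some j
  · subst hkj; simp
  · rw [updateRow_ne hkj, updateRow_ne hkj]
    by_cases hki : k = some i
    · subst hki; simp
    · rw [updateRow_ne hki, updateRow_ne hki]
      rcases k with _ | k
      · rcases l with _ | l <;> simp [cm_nn, cm_ns]
      · rcases l with _ | l
        · simp [cm_sn]
        · simp only [cm_ss, Pi.add_apply, Pi.smul_apply, Pi.single_apply, mkE_eq]
          simp at hki hkj
          split_ifs <;> simp_all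

/-- the linear map of a coefficient family -/
noncomputable def LM {N : ℕ} {A : Type*} [Fintype A] (E : Ed N → A → ℝ) : (A → ℝ) →ₗ[ℝ] (Ed N → ℝ) where
  toFun l e := ∑ a, E e a * l a
  map_add' x y := by funext e; simp [mul_add, Finset.sum_add_distrib]
  map_smul' c x := by funext e; simp [Finset.mul_sum]; apply Finset.sum_congr rfl; intros; ring

section step
variable {N : ℕ} {A : Type*} [Fintype A] [DecidableEq A] (hN : 4 ≤ N) (E : Ed N → A → ℝ)
  (H1 : ∀ a l, ff (LM E (flp a l)) = ff (LM E l)) (H2 : Function.Surjective (LM E))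

lemma LM_single (a : A) : LM E (Pi.single a 1) = fun e => E e a := by
  funext e; simp [LM, Pi.single_apply]

lemma LM_flp (a : A) (l : A → ℝ) : LM E (flp a l) = LM E l - (2 * l a) • (fun e => E e a) := by
  rw [flp, map_sub, map_smul, LM_single]

include hN H1 H2
lemma step1 (l : A → ℝ) (hl : LM E l = 0) (a : A) (hu : ∃ e, E e a ≠ 0) : l a = 0 := by
  by_contra hla
  obtain ⟨g, hg⟩ := hu
  have h : ∀ v, ∀ t : ℝ, ff (v + t • (fun e => E e a)) = ff v := by
    intro v t
    obtain ⟨m, rfl⟩ := H2 v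
    have h1 := H1 a (m + ((- t / 2 - m a) / l a) • l)
    have h2 : LM E (m + ((- t / 2 - m a) / l a) • l) = LM E m := by rw [map_add, map_smul, hl]; simp
    rw [LM_flp, h2] at h1
    rw [← h1]; congr 1
    have : (m + ((- t / 2 - m a) / l a) • l) a = - t / 2 := by simp; field_simp; ring
    rw [this]; module
  exact ff_not_inv (by omega) (fun _ => 1) g (by simp)
    (NT ff ff_flp (fun _ => True) _ g hg (fun v _ => h v) (by simp) (by simp) _ trivial)

lemma step1' : ∃ φ : A → ((Ed N → ℝ) →ₗ[ℝ] ℝ), 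
    (∀ e g, ∑ a, E e a * φ a (Pi.single g 1) = if e = g then 1 else 0) ∧
    (∀ a, (∃ e, E e a ≠ 0) → φ a (fun e => E e a) = 1 ∧ ∀ v, ff (v - (2 * φ a v) • (fun e => E e a)) = ff v) := by
  obtain ⟨S, hS⟩ := LinearMap.exists_rightInverse_of_surjective (LM E) (LinearMap.range_eq_top.mpr H2)
  have hS' : ∀ v, LM E (S v) = v := fun v => by
    have := congrArg (fun f => f v) hS; simpa using this
  refine ⟨fun a => (LinearMap.proj a).comp S, ?_, ?_⟩
  · intro e g
    have := congrFun (hS' (Pi.single g 1)) e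
    simpa [LM, Pi.single_apply] using this
  · intro a ha
    constructor
    · have h1 : LM E (S (LM E (Pi.single a 1)) - Pi.single a 1) = 0 := by rw [map_sub, hS', sub_self]
      have h2 := step1 hN E H1 H2 _ h1 a ha
      rw [LM_single] at h2
      simp at h2 ⊢
      linarith
    · intro v
      have := H1 a (S v)
      rw [LM_flp, hS'] at this
      simpa using this

variable (o : Fin N) (H3 : ∀ a (h : o ≠ a) c, 0 ≤ E (mkE o a h) c)
  (H4 : ∀ a b (ha : o ≠ a) (hb : o ≠ b) (hab : a ≠ b) c, 0 ≤ E (mkE o a ha) c + E (mkE a b hab) c + E (mkE o b hb) c)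
include H3 H4

omit H1 H2 H3 H4 in
lemma step3_core (u : Ed N → ℝ) (φ : (Ed N → ℝ) →ₗ[ℝ] ℝ)
    (hR : ∀ v, ff (v - (2 * φ v) • u) = ff v) (a b y : Fin N) (ha : o ≠ a) (hb : o ≠ b) (hab : a ≠ b)
    (hy : o ≠ y) (hya : a ≠ y) (hyb : b ≠ y) (huy : u (mkE o y hy) = 0) (hφy : φ (Pi.single (mkE o y hy) 1) = 0)
    (hφa : φ (Pi.single (mkE o a ha) 1) ≠ 0) (hub : u (mkE a b hab) ≠ 0) : False := by
  have hDl := Dl_lim o y hy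
  have hDs := Dl_self o y hy
  generalize hy' : mkE o y hy = y' at *
  let g : (Ed N → ℝ) → ℝ := fun v => Dl o y (fun e => v e ^ 2)
  have hgf : ∀ e v, g (flp e v) = g v := by intro e v; simp only [g, flp_sq]
  have hlim : ∀ v : Ed N → ℝ, v y' = 0 → Tendsto (fun s : ℝ => ff (v + s • Pi.single y' 1) / s ^ 4) atTop (𝓝 (g v)) := by
    intro v hv
    have h1 := (hDl (fun e => v e ^ 2)).comp (tendsto_pow_atTop (α := ℝ) (n := 2) (by norm_num))
    refine h1.congr ?_
    intro s
    simp only [Function.comp, ff]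
    congr 1
    · congr 1; funext e
      by_cases h : e = y'
      · subst h; simp [hv]
      · simp [h]
    · ring
  have h1 : ∀ v : Ed N → ℝ, v y' = 0 → g (v - (2 * φ v) • u) = g v := by
    intro v hv
    refine tendsto_nhds_unique (hlim _ (by simp [hv, huy])) ((hlim v hv).congr ?_)
    intro s
    rw [← hR (v + _)]
    congr 2
    rw [map_add, map_smul, hφy]; simp; module
  have hind : ∀ v (t : ℝ), g (v + t • Pi.single (mkE o a ha) 1) = g v := by
    intro v t
    have := Dl_indep o y a hy ha hya (fun e => v e ^ 2) (2 * v (mkE o a ha) * t + t ^ 2)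
    show _ = Dl o y (fun e => v e ^ 2)
    rw [← this]
    simp only [g]; congr 1; funext e
    by_cases h : e = mkE o a ha
    · subst h; simp; ring
    · simp [h]
  have hay : y' ≠ mkE o a ha := by rw [← hy']; simp [mkE_eq, Ne.symm hya, ha]
  have hby : y' ≠ mkE a b hab := by rw [← hy']; simp [mkE_eq, ha, hb]
  have h2 : ∀ v : Ed N → ℝ, v y' = 0 → ∀ t : ℝ, g (v + t • u) = g v := by
    intro v hv t
    set τ := (- t / 2 - φ v) / φ (Pi.single (mkE o a ha) 1) with hτ
    have h3 := h1 (v + τ • Pi.single (mkE o a ha) 1) (by simp [hv, hay])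
    rw [hind] at h3
    rw [← h3, ← hind (v + t • u) τ]
    congr 1
    have : φ (v + τ • Pi.single (mkE o a ha) 1) = - t / 2 := by
      rw [map_add, map_smul, hτ, smul_eq_mul]; field_simp; ring
    rw [this]; module
  have h3 := NT g hgf (fun v => v y' = 0) u (mkE a b hab) hub h2 (by intro v hv; simp [flp, hv, hby]) 
    (by intro v t hv; simp [hv, huy]) ((fun _ => 1) + (-1 : ℝ) • Pi.single y' 1) (by simp) (-1)
  have e1 : g ((fun _ => 1) + (-1 : ℝ) • Pi.single y' 1) = Dl o y (fun _ => (1:ℝ)) := by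
    rw [← hDs _ (-1)]
    simp only [g]; congr 1; funext e
    by_cases h : e = y'
    · subst h; simp 
    · simp [h]
  have e2 : g ((fun _ => 1) + (-1 : ℝ) • Pi.single y' 1 + (-1 : ℝ) • Pi.single (mkE a b hab) 1) = 0 := by
    rw [← Dl_ones_g o y a b hab ha.symm hya hb.symm hyb, ← hDs _ (-1)]
    simp only [g]; congr 1; funext e
    by_cases h : e = y'
    · subst h; simp only [Pi.add_apply, Pi.smul_apply, Pi.single_eq_same, Pi.single_eq_of_ne hby, Function.update_of_ne hby]; simp
    · by_cases h' : e = mkE a b hab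
      · subst h'; simp [h]
      · simp [h, h']
  rw [e1, e2] at h3
  exact Dl_ones (by omega) o y hy h3.symm

lemma step3_nonneg (e : Ed N) (c : A) : 0 ≤ E e c := by
  obtain ⟨φ, hφ, hφ2⟩ := step1' hN E H1 H2
  have hc : ∀ c e, (E e c = 0) ∨ 0 < E e c * φ c (Pi.single e 1) := by
    intro c e
    by_cases h : ∃ e, E e c ≠ 0
    · rcases refl_concl hN (fun e => E e c) (φ c) (hφ2 c h).1 (hφ2 c h).2 e with h | h
      · exact Or.inl h.1
      · exact Or.inr h
    · push Not at h; exact Or.inl (h e)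
  have hc' : ∀ c e, (∃ e, E e c ≠ 0) → E e c = 0 → φ c (Pi.single e 1) = 0 := by
    intro c e h h0
    rcases refl_concl hN (fun e => E e c) (φ c) (hφ2 c h).1 (hφ2 c h).2 e with h | h
    · exact h.2
    · simp [h0] at h
  have hdis : ∀ a b (ha : o ≠ a) (hb : o ≠ b) (hab : a ≠ b) c, E (mkE o a ha) c ≠ 0 → E (mkE o b hb) c = 0 := by
    intro a b ha hb hab c hca
    have h1 := hφ (mkE o a ha) (mkE o b hb)
    rw [if_neg (by simp [mkE_eq, hab, hb])] at h1
    have hnn : ∀ c ∈ Finset.univ, 0 ≤ E (mkE o a ha) c * φ c (Pi.single (mkE o b hb) 1) := by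
      intro c _
      by_cases h0 : E (mkE o a ha) c = 0
      · simp [h0]
      · apply mul_nonneg (H3 a ha c)
        rcases hc c (mkE o b hb) with h | h
        · rw [hc' c _ ⟨_, h0⟩ h]
        · exact (pos_of_mul_pos_right h (H3 b hb c)).le
    have h2 := (Finset.sum_eq_zero_iff_of_nonneg hnn).mp h1 c (Finset.mem_univ _)
    have h3 := (mul_eq_zero.mp h2).resolve_left hca
    rcases hc c (mkE o b hb) with h | h
    · exact h
    · rw [h3] at h; simp at h
  have main : ∀ a b (ha : o ≠ a) (hb : o ≠ b) (hab : a ≠ b), E (mkE a b hab) c < 0 → 0 < E (mkE o a ha) c → False := by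
    intro a b ha hb hab hlt hpos
    obtain ⟨y, hy⟩ : ∃ y, y ∉ ({o, a, b} : Finset (Fin N)) := by
      by_contra hcon; push Not at hcon
      have : (Finset.univ : Finset (Fin N)).card ≤ ({o, a, b} : Finset (Fin N)).card := Finset.card_le_card (fun x _ => hcon x)
      have h3 := Finset.card_le_three (a := o) (b := a) (c := b)
      simp at this; omega
    simp at hy
    have hy1 : o ≠ y := fun h => hy.1 h.symm
    have h0 := hdis a y ha hy1 (fun h => hy.2.1 h.symm) c hpos.ne'
    have hex : ∃ e, E e c ≠ 0 := ⟨_, hpos.ne'⟩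
    refine step3_core hN o (fun e => E e c) (φ c) (hφ2 c hex).2 a b y ha hb hab hy1 (fun h => hy.2.1 h.symm) (fun h => hy.2.2 h.symm) h0 (hc' c _ hex h0) ?_ hlt.ne
    rcases hc c (mkE o a ha) with h | h
    · exact absurd h hpos.ne'
    · intro h'; rw [h'] at h; simp at h
  induction e using Ed_ind with
  | H a b hab =>
    by_cases ha : o = a
    · subst ha; exact H3 b hab c
    · by_cases hb : o = b
      · subst hb; rw [mkE_comm]; exact H3 a _ c
      · by_contra hlt; push Not at hlt
        have h4 := H4 a b ha hb hab c
        have h5 := H3 a ha c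
        have h6 := H3 b hb c
        by_cases h7 : 0 < E (mkE o a ha) c
        · exact main a b ha hb hab hlt h7
        · exact main b a hb ha (Ne.symm hab) (by rwa [mkE_comm]) (by linarith)

theorem stepD : ∃ (τ : Ed N → A) (k : Ed N → ℝ), Function.Injective τ ∧ (∀ e, 0 < k e) ∧
    ∀ e a, E e a = if a = τ e then k e else 0 := by
  have hnn := step3_nonneg hN E H1 H2 o H3 H4
  obtain ⟨φ, hφ, hφ2⟩ := step1' hN E H1 H2
  have hcol : ∀ c e g, e ≠ g → E e c ≠ 0 → E g c = 0 := by
    intro c e g heg hec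
    have h1 := hφ e g
    rw [if_neg heg] at h1
    have hpos : ∀ c ∈ Finset.univ, 0 ≤ E e c * φ c (Pi.single g 1) := by
      intro c _
      by_cases h0 : E e c = 0
      · simp [h0]
      · apply mul_nonneg (hnn e c)
        rcases refl_concl hN (fun e => E e c) (φ c) (hφ2 c ⟨_, h0⟩).1 (hφ2 c ⟨_, h0⟩).2 g with h | h
        · rw [h.2]
        · exact (pos_of_mul_pos_right h (hnn g c)).le
    have h2 := (Finset.sum_eq_zero_iff_of_nonneg hpos).mp h1 c (Finset.mem_univ _)
    have h3 := (mul_eq_zero.mp h2).resolve_left hec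
    rcases refl_concl hN (fun e => E e c) (φ c) (hφ2 c ⟨_, hec⟩).1 (hφ2 c ⟨_, hec⟩).2 g with h | h
    · exact h.1
    · rw [h3] at h; simp at h
  have hex : ∀ e, ∃ a, E e a ≠ 0 := by
    intro e
    by_contra hcon; push Not at hcon
    have := hφ e e
    simp [hcon] at this
  choose τ hτ using hex
  have huniq : ∀ e a, E e a ≠ 0 → a = τ e := by
    intro e a ha
    by_contra hne
    have h0 : LM E (Pi.single a (E e (τ e)) - Pi.single (τ e) (E e a)) = 0 := by
      funext g
      simp only [LM, LinearMap.coe_mk, AddHom.coe_mk, Pi.sub_apply, mul_sub, Finset.sum_sub_distrib, Pi.single_apply]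
      simp
      by_cases hg : e = g
      · subst hg; ring
      · rw [hcol a e g hg ha, hcol (τ e) e g hg (hτ e)]; simp
    have := step1 hN E H1 H2 _ h0 a ⟨e, ha⟩
    simp [hne] at this
    exact hτ e this
  refine ⟨τ, fun e => E e (τ e), ?_, ?_, ?_⟩
  · intro e g heg
    by_contra hne
    have := hcol (τ e) e g hne (hτ e)
    rw [heg] at this
    exact hτ g this
  · intro e; exact lt_of_le_of_ne (hnn _ _) (hτ e).symm
  · intro e a
    split_ifs with h
    · rw [h]
    · by_contra h'; exact h (huniq e a h')

end step
end UPL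


namespace UPL
set_option linter.all false

open MvPolynomial Matrix Filter Topology

lemma comb_star {N : ℕ} (X : Ed N → Prop) (hne : ∃ e, X e)
    (hpair : ∀ a b c d (hab : a ≠ b) (hcd : c ≠ d), X (mkE a b hab) → X (mkE c d hcd) → a = c ∨ a = d ∨ b = c ∨ b = d)
    (htri : ∀ a b c (hab : a ≠ b) (hac : a ≠ c) (hbc : b ≠ c), X (mkE a b hab) → X (mkE a c hac) → X (mkE b c hbc) → False) :
    ∃ r, ∀ e, X e → r ∈ e.1 := by
  obtain ⟨e, he⟩ := hne
  induction e using Ed_ind with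
  | H a b hab =>
    by_contra hcon; push Not at hcon
    obtain ⟨g, hg, hga⟩ := hcon a
    obtain ⟨h, hh, hhb⟩ := hcon b
    induction g using Ed_ind with
    | H c1 c2 hc =>
      induction h using Ed_ind with
      | H d1 d2 hd =>
        simp [mkE] at hga hhb
        have p1 := hpair a b c1 c2 hab hc he hg
        have p2 := hpair a b d1 d2 hab hd he hh
        have p3 := hpair c1 c2 d1 d2 hc hd hg hh
        obtain ⟨c, hbc, hgc, hca⟩ : ∃ c, ∃ h : b ≠ c, X (mkE b c h) ∧ a ≠ c := by
          rcases p1 with h | h | h | h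
          · exact absurd h hga.1
          · exact absurd h hga.2
          · subst h; exact ⟨c2, hc, hg, hga.2⟩
          · subst h; exact ⟨c1, hc.symm, by rwa [mkE_comm], hga.1⟩
        obtain ⟨c', hbc', hgc', hca'⟩ : ∃ c, ∃ h : a ≠ c, X (mkE a c h) ∧ b ≠ c := by
          rcases p2 with h | h | h | h
          · subst h; exact ⟨d2, hd, hh, hhb.2⟩
          · subst h; exact ⟨d1, hd.symm, by rwa [mkE_comm], hhb.1⟩
          · exact absurd h hhb.1
          · exact absurd h hhb.2
        have p4 := hpair b c a c' hbc hbc' hgc hgc'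
        rcases p4 with h | h | h | h
        · exact hab h.symm
        · exact hca' h
        · exact hca h.symm
        · subst h; exact htri a b c hab hbc' hbc he hgc' hgc

section E
variable {n d : ℕ} (hd : 1 ≤ d) (τ : Ed (d+3) → Ed n) (hτ : Function.Injective τ) (k : Ed (d+3) → ℝ) (hk : ∀ e, 0 < k e)
  (hV : ∀ q : Fin n → Fin (d+1) → ℝ, F (fun e => k e ^ 2 * zv q (τ e)) = 0)

/-- pulled back polynomial -/
noncomputable def GE (τ : Ed (d+3) → Ed n) (k : Ed (d+3) → ℝ) : MvPolynomial (Ed n) ℝ := (cm (fun e => C (k e ^ 2) * X (τ e))).det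

lemma eval_GE (z : Ed n → ℝ) : eval z (GE τ k) = F (fun e => k e ^ 2 * z (τ e)) := by
  rw [GE, RingHom.map_det, cm_map]; simp [F]

lemma deg_GE : (GE τ k).totalDegree ≤ d + 2 := by
  have := totalDegree_det_cm (D := 1) (fun e => C (k e ^ 2) * X (τ e) : Ed (d+3) → MvPolynomial (Ed n) ℝ) (by
    intro e
    refine (totalDegree_mul _ _).trans ?_
    rw [totalDegree_C, totalDegree_X])
  simpa [GE] using this

/-- base point -/
noncomputable def zE (τ : Ed (d+3) → Ed n) (k : Ed (d+3) → ℝ) : Ed n → ℝ := Function.extend τ (fun e => (k e ^ 2)⁻¹) 0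
/-- direction lift -/
noncomputable def hE (τ : Ed (d+3) → Ed n) (k : Ed (d+3) → ℝ) (h : Ed (d+3) → ℝ) : Ed n → ℝ := Function.extend τ (fun e => (k e ^ 2)⁻¹ * h e) 0

include hτ hk
lemma zE_app (e) : k e ^ 2 * zE τ k (τ e) = 1 := by
  rw [zE, hτ.extend_apply]; have := hk e; field_simp
lemma hE_app (h) (e) : k e ^ 2 * hE τ k h (τ e) = h e := by
  rw [hE, hτ.extend_apply]; have := hk e; field_simp
lemma hE_star (h) (i : Fin n) (hh : ∀ e, i ∉ (τ e).1 → h e = 0) (e : Ed n) (he : i ∉ e.1) : hE τ k h e = 0 := by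
  by_cases h1 : ∃ x, τ x = e
  · obtain ⟨x, rfl⟩ := h1
    rw [hE, hτ.extend_apply, hh x he, mul_zero]
  · rw [hE, Function.extend_apply' _ _ _ h1]; rfl

include hV
lemma no_tri (hd : 1 ≤ d) (i : Fin n) (a b c : Fin (d+3)) (hab : a ≠ b) (hac : a ≠ c) (hbc : b ≠ c) 
    (h1 : i ∈ (τ (mkE a b hab)).1) (h2 : i ∈ (τ (mkE a c hac)).1) (h3 : i ∈ (τ (mkE b c hbc)).1) : False := by
  classical
  let h : Ed (d+3) → ℝ := fun e => if e = mkE a b hab ∨ e = mkE a c hac ∨ e = mkE b c hbc then 1 else 0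
  obtain ⟨c0, hc0, hl⟩ := tri_lim (by omega) a b c hab hac hbc h (by
    intro x y hxy
    simp only [h, mkE_eq, Finset.mem_insert, Finset.mem_singleton]
    congr 1
    apply propext
    constructor
    · grind
    · rintro ⟨hx, hy⟩
      rcases hx with rfl | rfl | rfl <;> rcases hy with rfl | rfl | rfl <;> simp_all)
  have hV' : ∀ q : Fin n → Fin (d+1) → ℝ, eval (zv q) (GE τ k) = 0 := by intro q; rw [eval_GE]; exact hV q
  have hr := R3 (GE τ k) (deg_GE τ k) hV' i (hE τ k h) (hE_star τ hτ k hk h i (by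
    intro e he; simp only [h]; rw [if_neg]; rintro (rfl | rfl | rfl) <;> contradiction))
  have := lim_zero_of_iter 3 (linePoly (zE τ k) (hE τ k h) (GE τ k)) (by
    rw [iterate_derivative_linePoly]; simp [hr])
  apply hc0
  refine tendsto_nhds_unique hl (this.congr ?_)
  intro t
  rw [eval_linePoly, eval_GE]
  congr 2
  funext e
  simp only [Pi.add_apply, Pi.smul_apply, smul_eq_mul, mul_add, zE_app τ hτ k hk, mul_left_comm, hE_app τ hτ k hk]

lemma no_disj (hd : 1 ≤ d) (i : Fin n) (a b c c' : Fin (d+3)) (hab : a ≠ b) (hcc : c ≠ c') (h1 : i ∈ (τ (mkE a b hab)).1) (h2 : i ∈ (τ (mkE c c' hcc)).1) :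
    a = c ∨ a = c' ∨ b = c ∨ b = c' := by
  by_contra hcon; push Not at hcon
  obtain ⟨q1, q2, q3, q4⟩ := hcon
  have hV' : ∀ q : Fin n → Fin (d+1) → ℝ, eval (zv q) (GE τ k) = 0 := by intro q; rw [eval_GE]; exact hV q
  set G := GE τ k with hG
  set h := hE τ k (Pi.single (mkE a b hab) 1) with hh
  set g := hE τ k (-Pi.single (mkE c c' hcc) 1) with hg
  set z := zE τ k with hz
  have hr := R3' G (deg_GE τ k) hV' i h g (hE_star τ hτ k hk _ i (by
    intro e he; rw [Pi.single_eq_of_ne]; rintro rfl; contradiction)) (hE_star τ hτ k hk _ i (by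
    intro e he; rw [Pi.neg_apply, Pi.single_eq_of_ne]; simp; rintro rfl; contradiction))
  have hinv : ∀ y, eval (y + g) (dd h (dd h G)) = eval y (dd h (dd h G)) := by
    intro y
    have h0 : Polynomial.derivative (linePoly y g (dd h (dd h G))) = 0 := by
      rw [derivative_linePoly, dd_comm g h, dd_comm g h, hr]; simp
    rw [Polynomial.derivative_eq_zero] at h0
    obtain ⟨r, hr⟩ := Polynomial.natDegree_eq_zero.mp h0
    have e1 := eval_linePoly y g (dd h (dd h G)) 1
    have e2 := eval_linePoly y g (dd h (dd h G)) 0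
    rw [← hr] at e1 e2
    simp at e1 e2
    rw [← e1, ← e2]
  have hit : Polynomial.derivative^[2] (linePoly z h G - linePoly (z + g) h G) = 0 := by
    rw [Polynomial.iterate_derivative_sub, iterate_derivative_linePoly, iterate_derivative_linePoly]
    apply Polynomial.funext
    intro t
    rw [Polynomial.eval_sub, eval_linePoly, eval_linePoly]
    simp only [Function.iterate_succ, Function.iterate_zero, Function.comp, id]
    rw [add_right_comm, hinv]; simp
  have hl := lim_zero_of_iter 2 _ hit
  have hD := (Dl_lim a b hab (fun _ => 1)).sub (Dl_lim a b hab (Function.update (fun _ => 1) (mkE c c' hcc) 0))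
  rw [Dl_ones_g a b c c' hcc q1.symm q3.symm q2.symm q4.symm, sub_zero] at hD
  apply Dl_ones (by omega) a b hab
  refine tendsto_nhds_unique hD (hl.congr ?_)
  intro t
  rw [Polynomial.eval_sub, eval_linePoly, eval_linePoly, eval_GE, eval_GE, sub_div]
  congr 3
  · funext e
    simp only [Pi.add_apply, Pi.smul_apply, smul_eq_mul, mul_add, hz, hh, zE_app τ hτ k hk, mul_left_comm, hE_app τ hτ k hk]
  · funext e
    simp only [Pi.add_apply, Pi.smul_apply, smul_eq_mul, mul_add, hz, hh, hg, zE_app τ hτ k hk, mul_left_comm _ t, hE_app τ hτ k hk]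
    by_cases he : e = mkE c c' hcc
    · subst he; simp
    · simp [he]

lemma star_const (hd : 1 ≤ d) (i : Fin n) (hne : ∃ e, i ∈ (τ e).1) : 
    ∃ r : Fin (d+3), (∀ e, i ∈ (τ e).1 ↔ r ∈ e.1) ∧ ∀ e g : Ed (d+3), r ∈ e.1 → r ∈ g.1 → k e = k g := by
  classical
  obtain ⟨r, hr⟩ := comb_star (fun e => i ∈ (τ e).1) hne 
    (fun a b c c' hab hcc => no_disj τ hτ k hk hV hd i a b c c' hab hcc)
    (fun a b c hab hac hbc => no_tri τ hτ k hk hV hd i a b c hab hac hbc)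
  have hV' : ∀ q : Fin n → Fin (d+1) → ℝ, eval (zv q) (GE τ k) = 0 := by intro q; rw [eval_GE]; exact hV q
  let h : Ed n → ℝ := fun e => if i ∈ e.1 then 1 else 0
  let h' : Ed (d+3) → ℝ := fun e => k e ^ 2 * h (τ e)
  have hr2 := Rstar (GE τ k) (deg_GE τ k) hV' i h (fun e => rfl)
  have hconst : ∀ a b (ha : r ≠ a) (hb : r ≠ b), h' (mkE r a ha) = h' (mkE r b hb) := by
    intro a b ha hb
    by_contra hab
    obtain ⟨c0, hc0, hl⟩ := star_lim r h' (by
      intro e he; simp only [h', h]; rw [if_neg (fun h => he (hr e h)), mul_zero]) a b ha hb hab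
    have := lim_zero_of_iter 2 (linePoly (zE τ k) h (GE τ k)) (by
      rw [iterate_derivative_linePoly]; simp [hr2])
    apply hc0
    refine tendsto_nhds_unique hl (this.congr ?_)
    intro t
    rw [eval_linePoly, eval_GE]
    congr 2
    funext e
    simp only [Pi.add_apply, Pi.smul_apply, smul_eq_mul, mul_add, zE_app τ hτ k hk, mul_left_comm _ t, h']
  have hconst' : ∀ e g : Ed (d+3), r ∈ e.1 → r ∈ g.1 → h' e = h' g := by
    have hform : ∀ e : Ed (d+3), r ∈ e.1 → ∃ a, ∃ ha : r ≠ a, e = mkE r a ha := by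
      intro e he
      induction e using Ed_ind with
      | H a b hab =>
        simp [mkE] at he
        rcases he with rfl | rfl
        · exact ⟨b, hab, rfl⟩
        · exact ⟨a, hab.symm, mkE_comm _ _ _⟩
    intro e g he hg
    obtain ⟨a, ha, rfl⟩ := hform e he
    obtain ⟨b, hb, rfl⟩ := hform g hg
    exact hconst a b ha hb
  obtain ⟨e0, he0⟩ := hne
  have hpos : ∀ e, 0 < k e ^ 2 := fun e => by have := hk e; positivity
  have hmem : ∀ e : Ed (d+3), r ∈ e.1 → i ∈ (τ e).1 := by
    intro e he
    have := hconst' e e0 he (hr e0 he0)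
    by_contra hc
    simp [h', h, hc, he0] at this
    exact (hpos e0).ne this
  refine ⟨r, fun e => ⟨hr e, hmem e⟩, ?_⟩
  intro e g he hg
  have := hconst' e g he hg
  simp only [h', h, hmem e he, hmem g hg, if_true, mul_one] at this
  exact (pow_left_inj₀ (hk e).le (hk g).le (by norm_num)).mp this

theorem stepE (hd : 1 ≤ d) : ∃ (θ : Fin (d+3) → Fin n) (hθ : Function.Injective θ) (s : ℝ), 0 < s ∧ (∀ e, k e = s) ∧
    ∀ a b (h : a ≠ b), τ (mkE a b h) = mkE (θ a) (θ b) (hθ.ne h) := by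
  have hsc := star_const τ hτ k hk hV hd
  have hother : ∀ a b : Fin (d+3), ∃ c, a ≠ c ∧ b ≠ c := by
    intro a b
    by_contra hcon; push Not at hcon
    have : (Finset.univ : Finset (Fin (d+3))).card ≤ ({a, b} : Finset (Fin (d+3))).card := by
      apply Finset.card_le_card
      intro x _
      simp only [Finset.mem_insert, Finset.mem_singleton]
      by_cases hx : a = x
      · exact Or.inl hx.symm
      · exact Or.inr (hcon x hx).symm
    have h2 := Finset.card_le_two (a := a) (b := b)
    simp at this; omega
  -- for each edge
  have hedge : ∀ a b (hab : a ≠ b), ∃ i j, ∃ hij : i ≠ j, τ (mkE a b hab) = mkE i j hij ∧ (∀ e, i ∈ (τ e).1 ↔ a ∈ e.1) ∧ (∀ e, j ∈ (τ e).1 ↔ b ∈ e.1) := by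
    intro a b hab
    have hex : ∃ i j, ∃ hij : i ≠ j, τ (mkE a b hab) = mkE i j hij := by
      generalize τ (mkE a b hab) = g
      induction g using Ed_ind with
      | H i j hij => exact ⟨i, j, hij, rfl⟩
    obtain ⟨i, j, hij, he⟩ := hex
    have hi : i ∈ (τ (mkE a b hab)).1 := by rw [he]; simp [mkE]
    have hj : j ∈ (τ (mkE a b hab)).1 := by rw [he]; simp [mkE]
    obtain ⟨r, hr, -⟩ := hsc i ⟨_, hi⟩
    obtain ⟨r', hr', -⟩ := hsc j ⟨_, hj⟩
    have h1 := (hr _).mp hi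
    have h2 := (hr' _).mp hj
    have hrr : r ≠ r' := by
      rintro rfl
      obtain ⟨c, hc, -⟩ := hother r r
      obtain ⟨c2, hc2, hc3⟩ := hother r c
      have key : ∀ x (hx : r ≠ x), τ (mkE r x hx) = mkE i j hij := by
        intro x hx
        have m1 := (hr (mkE r x hx)).mpr (by simp [mkE])
        have m2 := (hr' (mkE r x hx)).mpr (by simp [mkE])
        apply Subtype.ext
        exact (Sym2.mem_and_mem_iff hij).mp ⟨m1, m2⟩
      have := hτ ((key c hc).trans (key c2 hc2).symm)
      rw [mkE_eq] at this
      rcases this with ⟨_, h⟩ | ⟨h, _⟩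
      · exact hc3 h
      · exact hc2 h
    simp [mkE] at h1 h2
    rcases h1 with rfl | rfl
    · rcases h2 with rfl | rfl
      · exact absurd rfl hrr
      · exact ⟨i, j, hij, he, hr, hr'⟩
    · rcases h2 with rfl | rfl
      · exact ⟨j, i, hij.symm, by rw [he, mkE_comm], hr', hr⟩
      · exact absurd rfl hrr
  have huniq : ∀ a i j, (∀ e : Ed (d+3), i ∈ (τ e).1 ↔ a ∈ e.1) → (∀ e : Ed (d+3), j ∈ (τ e).1 ↔ a ∈ e.1) → i = j := by
    intro r i j hr hr'
    by_contra hij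
    obtain ⟨c, hc, -⟩ := hother r r
    obtain ⟨c2, hc2, hc3⟩ := hother r c
    have key : ∀ x (hx : r ≠ x), τ (mkE r x hx) = mkE i j hij := by
      intro x hx
      have m1 := (hr (mkE r x hx)).mpr (by simp [mkE])
      have m2 := (hr' (mkE r x hx)).mpr (by simp [mkE])
      apply Subtype.ext
      exact (Sym2.mem_and_mem_iff hij).mp ⟨m1, m2⟩
    have := hτ ((key c hc).trans (key c2 hc2).symm)
    rw [mkE_eq] at this
    rcases this with ⟨_, h⟩ | ⟨h, _⟩
    · exact hc3 h
    · exact hc2 h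
  have hθ : ∀ a, ∃ i, ∀ e : Ed (d+3), i ∈ (τ e).1 ↔ a ∈ e.1 := by
    intro a
    obtain ⟨c, hc, -⟩ := hother a a
    obtain ⟨i, j, hij, _, h, _⟩ := hedge a c hc
    exact ⟨i, h⟩
  choose θ hθ using hθ
  have hinj : Function.Injective θ := by
    intro a b hab
    by_contra hne
    obtain ⟨c, hc, hc2⟩ := hother a b
    have := (hθ b (mkE a c hc)).mp (by rw [← hab]; exact (hθ a _).mpr (by simp [mkE]))
    simp [mkE] at this
    rcases this with h | h
    · exact hne h.symm
    · exact hc2 h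
  obtain ⟨c0, hc0, -⟩ := hother 0 0
  have hkc : ∀ a b c (hab : a ≠ b) (hac : a ≠ c), k (mkE a b hab) = k (mkE a c hac) := by
    intro a b c hab hac
    obtain ⟨r, hr, hk'⟩ := hsc (θ a) ⟨mkE a b hab, (hθ a _).mpr (by simp [mkE])⟩
    exact hk' _ _ ((hr _).mp ((hθ a _).mpr (by simp [mkE]))) ((hr _).mp ((hθ a _).mpr (by simp [mkE])))
  refine ⟨θ, hinj, k (mkE 0 c0 hc0), hk _, ?_, ?_⟩
  · intro e
    induction e using Ed_ind with
    | H a b hab =>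
      by_cases h0 : (0 : Fin (d+3)) = a
      · subst h0; exact hkc _ _ _ _ _
      · rw [hkc a b 0 hab (Ne.symm h0), mkE_comm]; exact hkc _ _ _ _ _
  · intro a b hab
    obtain ⟨i, j, hij, he, h1, h2⟩ := hedge a b hab
    rw [he, mkE_eq]
    exact Or.inl ⟨huniq a _ _ h1 (hθ a), huniq b _ _ h2 (hθ b)⟩
end E
end UPL


namespace UPL
set_option linter.all false

open MvPolynomial

/-- quadratic extension -/
def quadExt (K : Subfield ℝ) (r : ℝ) (hr : r ^ 2 ∈ K) (hr' : r ∉ K) : Subfield ℝ where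
  carrier := {z | ∃ x ∈ K, ∃ y ∈ K, z = x + y * r}
  one_mem' := ⟨1, K.one_mem, 0, K.zero_mem, by simp⟩
  zero_mem' := ⟨0, K.zero_mem, 0, K.zero_mem, by simp⟩
  add_mem' := by
    rintro _ _ ⟨x, hx, y, hy, rfl⟩ ⟨x', hx', y', hy', rfl⟩
    exact ⟨x + x', K.add_mem hx hx', y + y', K.add_mem hy hy', by ring⟩
  neg_mem' := by
    rintro _ ⟨x, hx, y, hy, rfl⟩
    exact ⟨-x, K.neg_mem hx, -y, K.neg_mem hy, by ring⟩
  mul_mem' := by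
    rintro _ _ ⟨x, hx, y, hy, rfl⟩ ⟨x', hx', y', hy', rfl⟩
    exact ⟨x * x' + y * y' * r ^ 2, K.add_mem (K.mul_mem hx hx') (K.mul_mem (K.mul_mem hy hy') hr), 
      x * y' + y * x', K.add_mem (K.mul_mem hx hy') (K.mul_mem hy hx'), by ring⟩
  inv_mem' := by
    rintro _ ⟨x, hx, y, hy, rfl⟩
    by_cases h : x - y * r = 0
    · have hy0 : y = 0 := by
        by_contra hy0
        apply hr'
        have : r = x / y := by field_simp; linarith
        rw [this]; exact K.div_mem hx hy
      subst hy0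
      exact ⟨x⁻¹, K.inv_mem hx, 0, K.zero_mem, by simp⟩
    · set D := x ^ 2 - y ^ 2 * r ^ 2 with hD
      have hDK : D ∈ K := K.sub_mem (K.pow_mem hx 2) (K.mul_mem (K.pow_mem hy 2) hr)
      refine ⟨x * D⁻¹, K.mul_mem hx (K.inv_mem hDK), -(y * D⁻¹), K.neg_mem (K.mul_mem hy (K.inv_mem hDK)), ?_⟩
      have hD2 : D = (x + y * r) * (x - y * r) := by rw [hD]; ring
      by_cases h0 : x + y * r = 0
      · rw [hD2, h0]; simp
      · rw [hD2]; field_simp; ring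

lemma mem_quadExt (K : Subfield ℝ) (r : ℝ) (hr : r ^ 2 ∈ K) (hr' : r ∉ K) (z : ℝ) : 
    z ∈ quadExt K r hr hr' ↔ ∃ x ∈ K, ∃ y ∈ K, z = x + y * r := Iff.rfl

lemma kummer {ι : Type*} [DecidableEq ι] (r : ι → ℝ) (T : Finset ι) : ∀ (K : Subfield ℝ), (∀ i ∈ T, r i ^ 2 ∈ K) →
    (∀ S ⊆ T, S.Nonempty → ∏ i ∈ S, r i ∉ K) → ∀ c : Finset ι → ℝ, (∀ S, c S ∈ K) →
    ∑ S ∈ T.powerset, c S * ∏ i ∈ S, r i = 0 → ∀ S ⊆ T, c S = 0 := by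
  induction T using Finset.induction_on with
  | empty =>
    intro K _ _ c _ h S hS
    rw [Finset.subset_empty.mp hS]
    simpa using h
  | insert a s ha ih =>
    intro K h1 h2 c hc h
    have hra : r a ∉ K := by
      have := h2 {a} (by simp) (by simp); simpa using this
    have hra2 : r a ^ 2 ∈ K := h1 a (by simp)
    have hra0 : r a ≠ 0 := by intro h; rw [h] at hra; exact hra K.zero_mem
    set L := quadExt K (r a) hra2 hra with hL
    have hKL : ∀ x ∈ K, x ∈ L := fun x hx => ⟨x, hx, 0, K.zero_mem, by simp⟩
    have hrL : r a ∈ L := ⟨0, K.zero_mem, 1, K.one_mem, by simp⟩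
    rw [Finset.sum_powerset_insert ha, ← Finset.sum_add_distrib] at h
    have ih' := ih L (fun i hi => hKL _ (h1 i (by simp [hi]))) ?_ (fun S => c S + c (insert a S) * r a) 
      (fun S => L.add_mem (hKL _ (hc S)) (L.mul_mem (hKL _ (hc _)) hrL)) ?_
    · have key : ∀ S ⊆ s, c S = 0 ∧ c (insert a S) = 0 := by
        intro S hS
        have h3 := ih' S hS
        have h4 : c (insert a S) = 0 := by
          by_contra h4
          apply hra
          have : r a = - c S / c (insert a S) := by field_simp; linarith
          rw [this]; exact K.div_mem (K.neg_mem (hc _)) (hc _)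
        rw [h4] at h3
        exact ⟨by simpa using h3, h4⟩
      intro S hS
      by_cases haS : a ∈ S
      · have := (key (S.erase a) (by rw [Finset.subset_insert_iff] at hS; exact hS)).2
        rwa [Finset.insert_erase haS] at this
      · exact (key S ((Finset.subset_insert_iff_of_notMem haS).mp hS)).1
    · intro S hS hSn hmem
      obtain ⟨x, hx, y, hy, hxy⟩ := (mem_quadExt K (r a) hra2 hra _).mp hmem
      have hsq : (∏ i ∈ S, r i) ^ 2 ∈ K := by
        rw [← Finset.prod_pow]
        exact K.prod_mem (fun i hi => h1 i (by simp [hS hi]))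
      have haS : a ∉ S := fun h => ha (hS h)
      by_cases hy0 : y = 0
      · apply h2 S (hS.trans (Finset.subset_insert _ _)) hSn
        rw [hxy, hy0]; simpa using hx
      · by_cases hx0 : x = 0
        · apply h2 (insert a S) (Finset.insert_subset_insert _ hS) (by simp)
          rw [Finset.prod_insert haS, hxy, hx0]
          have : r a * (0 + y * r a) = y * r a ^ 2 := by ring
          rw [this]; exact K.mul_mem hy hra2
        · apply hra
          have : r a = ((∏ i ∈ S, r i) ^ 2 - x ^ 2 - y ^ 2 * r a ^ 2) / (2 * x * y) := by
            rw [hxy]; field_simp; ring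
          rw [this]
          refine K.div_mem (K.sub_mem (K.sub_mem hsq (K.pow_mem hx 2)) (K.mul_mem (K.pow_mem hy 2) hra2)) (K.mul_mem (K.mul_mem ?_ hx) hy)
          exact_mod_cast natCast_mem K 2
    · rw [← h]
      apply Finset.sum_congr rfl
      intro S hS
      have haS : a ∉ S := fun h => ha (Finset.mem_powerset.mp hS h)
      rw [Finset.prod_insert haS]; ring

/-- squared lengths over any ring -/
def zg {n d : ℕ} {S : Type*} [CommRing S] (x : Fin n × Fin d → S) : Ed n → S := fun e =>
  Sym2.lift ⟨fun i j => ∑ k, (x (i, k) - x (j, k)) ^ 2,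
    fun i j => Finset.sum_congr rfl fun k _ => by ring⟩ e.1

lemma zg_mk {n d : ℕ} {S : Type*} [CommRing S] (x : Fin n × Fin d → S) (i j) (h : i ≠ j) : zg x (mkE i j h) = ∑ k, (x (i, k) - x (j, k)) ^ 2 := rfl

lemma zg_map {n d : ℕ} {S T : Type*} [CommRing S] [CommRing T] (f : S →+* T) (x : Fin n × Fin d → S) (e : Ed n) : f (zg x e) = zg (fun a => f (x a)) e := by
  induction e using Ed_ind with
  | H i j h => simp [zg_mk]

lemma zg_real {n d : ℕ} (q : Fin n → Fin d → ℝ) : zg (fun a => q a.1 a.2) = zv q := by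
  funext e; induction e using Ed_ind with
  | H i j h => rw [zg_mk, zv_mk]

/-- polynomial squared lengths -/
noncomputable def zp (n d : ℕ) : Ed n → MvPolynomial (Fin n × Fin d) ℚ := zg (fun a => X a)

lemma aeval_zp {n d : ℕ} {S : Type*} [CommRing S] [Algebra ℚ S] (x : Fin n × Fin d → S) (e : Ed n) : aeval x (zp n d e) = zg x e := by
  rw [zp]
  have := zg_map (aeval x : MvPolynomial (Fin n × Fin d) ℚ →ₐ[ℚ] S).toRingHom (fun a => X a) e
  simpa using this

lemma aeval_aeval_zp {n d : ℕ} {S : Type*} [CommRing S] [Algebra ℚ S] (x : Fin n × Fin d → S) (G : MvPolynomial (Ed n) ℚ) : 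
    aeval x (aeval (zp n d) G) = aeval (zg x) G := by
  have : (aeval x : MvPolynomial (Fin n × Fin d) ℚ →ₐ[ℚ] S).comp (aeval (zp n d)) = aeval (zg x) := by
    apply MvPolynomial.algHom_ext; intro e; simp [aeval_zp]
  exact congrArg (fun f => f G) this

lemma gen_van {n d : ℕ} (p : Fin n → Fin d → ℝ) (hp : GenericConfig p) (G : MvPolynomial (Ed n) ℚ) 
    (h : aeval (zv p) G = 0) (q : Fin n → Fin d → ℝ) : aeval (zv q) G = 0 := by
  rw [← zg_real, ← aeval_aeval_zp] at h ⊢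
  have : aeval (zp n d) G = 0 := by
    by_contra h0; exact hp _ h0 h
  rw [this]; simp

lemma zp_not_sq {n d : ℕ} (hd : 2 ≤ d) (S : Finset (Ed n)) (hS : S.Nonempty) (h : MvPolynomial (Fin n × Fin d) ℚ)
    (hh : ∏ e ∈ S, zp n d e = h ^ 2) : False := by
  obtain ⟨e, he⟩ := hS
  induction e using Ed_ind with
  | H i j hij =>
  let k0 : Fin d := ⟨0, by omega⟩
  let k1 : Fin d := ⟨1, by omega⟩
  have hk01 : k0 ≠ k1 := by simp [k0, k1]
  let x : Fin n × Fin d → Polynomial ℂ := fun a => 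
    if a.1 = j then 0 else if a.1 = i then (if a.2 = k0 then 1 else if a.2 = k1 then Polynomial.C Complex.I + Polynomial.X else 0)
    else if a.2 = k0 then Polynomial.C ((a.1.val : ℂ) + 3) else 0
  have sum2 : ∀ (f : Fin d → Polynomial ℂ), (∀ k, k ≠ k0 → k ≠ k1 → f k = 0) → ∑ k, f k = f k0 + f k1 := by
    intro f hf
    rw [← Finset.sum_pair hk01]
    symm
    apply Finset.sum_subset (Finset.subset_univ _)
    intro k _ hk
    simp at hk
    exact hf k hk.1 hk.2
  have hxz : ∀ a k, k ≠ k0 → k ≠ k1 → x (a, k) = 0 := by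
    intro a k h0 h1; simp [x, h0, h1]
  have hz : ∀ a b, ∑ k, (x (a, k) - x (b, k)) ^ 2 = (x (a, k0) - x (b, k0)) ^ 2 + (x (a, k1) - x (b, k1)) ^ 2 := by
    intro a b
    apply sum2
    intro k h0 h1; simp [hxz _ k h0 h1]
  have he1 : zg x (mkE i j hij) = Polynomial.X * (Polynomial.C (2 * Complex.I) + Polynomial.X) := by
    rw [zg_mk, hz]
    have : (Polynomial.C Complex.I : Polynomial ℂ) ^ 2 = -1 := by rw [← Polynomial.C_pow, Complex.I_sq]; simp
    simp [x, hij, hk01.symm, hk01]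
    have h2 : (Polynomial.C (2:ℂ)) = 2 := rfl
    linear_combination this - (Polynomial.C Complex.I * Polynomial.X) * h2
  have hne : ∀ b, b ≠ mkE i j hij → (zg x b).eval 0 ≠ 0 := by
    intro b hb
    induction b using Ed_ind with
    | H a b hab =>
    rw [zg_mk, hz]
    have main : ∀ a b : Fin n, a ≠ b → a ≠ i → a ≠ j → 
        Polynomial.eval 0 ((x (a, k0) - x (b, k0)) ^ 2 + (x (a, k1) - x (b, k1)) ^ 2) ≠ 0 := by
      intro a b hab hai haj
      by_cases hbj : b = j
      · have : ((a.val : ℂ) + 3) ^ 2 ≠ 0 := by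
          apply pow_ne_zero; norm_cast
        simpa [x, hai, haj, hbj, hk01.symm] using this
      · by_cases hbi : b = i
        · have : ((a.val : ℂ) + 3 - 1) ^ 2 + (- Complex.I) ^ 2 ≠ 0 := by
            have : ((a.val : ℂ) + 3 - 1) ^ 2 + (- Complex.I) ^ 2 = (((a.val + 1) * (a.val + 3) : ℕ) : ℂ) := by
              rw [neg_sq, Complex.I_sq]; push_cast; ring
            rw [this]; norm_cast
          simpa [x, hai, haj, hij, hbj, hbi, hk01.symm] using this
        · have : ((a.val : ℂ) + 3 - ((b.val : ℂ) + 3)) ^ 2 ≠ 0 := by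
            apply pow_ne_zero
            rw [add_sub_add_right_eq_sub, sub_ne_zero]
            norm_cast
            intro h; exact hab (Fin.ext h)
          simpa [x, hai, haj, hbj, hbi, hk01.symm] using this
    by_cases ha : a ≠ i ∧ a ≠ j
    · exact main a b hab ha.1 ha.2
    · have hb' : b ≠ i ∧ b ≠ j := by
        rw [Ne, mkE_eq] at hb
        grind
      have := main b a hab.symm hb'.1 hb'.2
      rwa [sub_sq_comm (x (a, k0)), sub_sq_comm (x (a, k1))]
  have h1 := congrArg (aeval x) hh
  rw [map_prod, map_pow] at h1
  simp only [aeval_zp] at h1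
  rw [← Finset.mul_prod_erase S _ he, he1, mul_assoc] at h1
  have h2 : Polynomial.X ∣ aeval x h := by
    apply Polynomial.prime_X.dvd_of_dvd_pow (n := 2)
    rw [← h1]; exact dvd_mul_right _ _
  obtain ⟨y, hy⟩ := h2
  rw [hy, mul_pow, pow_two, mul_assoc] at h1
  have h3 := mul_left_cancel₀ Polynomial.X_ne_zero h1
  have h4 := congrArg (Polynomial.eval 0) h3
  simp [Polynomial.eval_prod] at h4
  obtain ⟨b, hb⟩ := Finset.prod_eq_zero_iff.mp h4
  exact hne b (Finset.ne_of_mem_erase hb.1) hb.2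

/-- length vector -/
noncomputable def lv {n d : ℕ} (q : Fin n → Fin d → ℝ) : Ed n → ℝ := fun e => Real.sqrt (zv q e)

lemma zv_nonneg {n d : ℕ} (q : Fin n → Fin d → ℝ) (e : Ed n) : 0 ≤ zv q e := by
  induction e using Ed_ind with
  | H i j h => rw [zv_mk]; positivity

lemma lv_sq {n d : ℕ} (q : Fin n → Fin d → ℝ) (e : Ed n) : lv q e ^ 2 = zv q e := Real.sq_sqrt (zv_nonneg q e)

lemma lv_not_mem {n d : ℕ} (hd : 2 ≤ d) (p : Fin n → Fin d → ℝ) (hp : GenericConfig p) (S : Finset (Ed n)) (hS : S.Nonempty)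
    (f g : MvPolynomial (Fin n × Fin d) ℚ) (hg : g ≠ 0) 
    (h : (aeval (fun a => p a.1 a.2) g : ℝ) * ∏ e ∈ S, lv p e = aeval (fun a => p a.1 a.2) f) : False := by
  have h1 : g ^ 2 * ∏ e ∈ S, zp n d e = f ^ 2 := by
    have : aeval (fun a => p a.1 a.2) (g ^ 2 * ∏ e ∈ S, zp n d e - f ^ 2) = (0:ℝ) := by
      rw [map_sub, map_mul, map_pow, map_pow, map_prod, ← h, mul_pow, ← Finset.prod_pow]
      simp only [aeval_zp, zg_real, lv_sq, sub_self]
    by_contra hne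
    exact hp _ (sub_ne_zero.mpr hne) this
  have h2 : g ^ 2 ∣ f ^ 2 := ⟨_, h1.symm⟩
  rw [IsIntegrallyClosed.pow_dvd_pow_iff (by norm_num)] at h2
  obtain ⟨y, rfl⟩ := h2
  rw [mul_pow] at h1
  exact zp_not_sq hd S hS y (mul_left_cancel₀ (pow_ne_zero 2 hg) h1)

theorem kum {n d : ℕ} (hd : 2 ≤ d) (p : Fin n → Fin d → ℝ) (hp : GenericConfig p) (Q : Finset (Ed n) → MvPolynomial (Ed n) ℚ)
    (h : ∑ S : Finset (Ed n), aeval (zv p) (Q S) * ∏ e ∈ S, lv p e = 0) (S : Finset (Ed n)) : aeval (zv p) (Q S) = 0 := by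
  classical
  have hinj : Function.Injective (aeval (fun a : Fin n × Fin d => p a.1 a.2) : MvPolynomial (Fin n × Fin d) ℚ →ₐ[ℚ] ℝ).toRingHom := by
    rw [injective_iff_map_eq_zero]
    intro f hf; by_contra h0; exact hp f h0 hf
  let K := (IsFractionRing.lift (K := FractionRing (MvPolynomial (Fin n × Fin d) ℚ)) hinj).fieldRange
  have hmem : ∀ f : MvPolynomial (Fin n × Fin d) ℚ, (aeval (fun a : Fin n × Fin d => p a.1 a.2) f : ℝ) ∈ K := by
    intro f
    refine ⟨algebraMap _ _ f, ?_⟩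
    rw [IsFractionRing.lift_algebraMap]; rfl
  have hmz : ∀ G : MvPolynomial (Ed n) ℚ, aeval (zv p) G ∈ K := by
    intro G; rw [← zg_real, ← aeval_aeval_zp]; exact hmem _
  refine kummer (lv p) Finset.univ K ?_ ?_ (fun S => aeval (zv p) (Q S)) (fun S => hmz _) (by simpa using h) S (Finset.subset_univ _)
  · intro e _
    rw [lv_sq, ← aeval_X (R := ℚ) (zv p) e]; exact hmz _
  · rintro T - hT ⟨x, hx⟩
    obtain ⟨f, g, hg, rfl⟩ := IsFractionRing.div_surjective (A := MvPolynomial (Fin n × Fin d) ℚ) x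
    have hg0 : g ≠ 0 := nonZeroDivisors.ne_zero hg
    rw [map_div₀, IsFractionRing.lift_algebraMap, IsFractionRing.lift_algebraMap] at hx
    have hge : (aeval (fun a : Fin n × Fin d => p a.1 a.2) g : ℝ) ≠ 0 := hp g hg0
    refine lv_not_mem hd p hp T hT f g hg0 ?_
    rw [← hx]
    change _ * (aeval (fun a : Fin n × Fin d => p a.1 a.2) f / aeval (fun a : Fin n × Fin d => p a.1 a.2) g : ℝ) = _
    field_simp

end UPL


namespace UPL
set_option linter.all false

open MvPolynomial

theorem transfer_alg {σ : Type} [Finite σ] (x y : σ → ℝ)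
    (hs : ∀ G : MvPolynomial σ ℚ, aeval x G = 0 → aeval y G = 0)
    (hal : ∀ i, IsAlgebraic (Algebra.adjoin ℚ (Set.range y)) (x i)) 
    (G : MvPolynomial σ ℚ) (hG : aeval y G = 0) : aeval x G = 0 := by
  classical
  set M := AlgebraicIndependent.matroid ℚ ℝ with hM
  obtain ⟨B, hB⟩ := M.exists_isBasis (Set.range y)
  have hBi := hB.indep
  have hBy := hB.subset
  have hBfin : B.Finite := (Set.finite_range y).subset hBy
  choose f hf using fun b : B => hBy b.2
  have hyf : AlgebraicIndependent ℚ (fun b : B => y (f b)) := by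
    have h := AlgebraicIndependent.matroid_indep_iff.mp hBi
    have : (fun b : B => y (f b)) = fun b : B => id (b : ℝ) := by funext b; exact hf b
    rw [this]; exact h
  have hyf0 : ∀ C : MvPolynomial B ℚ, aeval y (rename f C) = 0 → C = 0 := by
    intro C hC
    rw [aeval_rename] at hC
    exact (injective_iff_map_eq_zero _).mp hyf C hC
  have hxf : AlgebraicIndependent ℚ (fun b : B => x (f b)) := by
    refine (injective_iff_map_eq_zero _).mpr ?_
    intro C hC
    apply hyf0
    apply hs
    rw [aeval_rename]; exact hC
  set X' := Set.range (fun b : B => x (f b)) with hX'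
  have hX'i : M.Indep X' := AlgebraicIndependent.matroid_indep_iff.mpr hxf.to_subtype_range
  have hX'c : X'.encard = B.encard := by
    rw [hX', Set.encard, Set.encard]
    simp only [ENat.card_congr (Equiv.ofInjective _ hxf.injective).symm]
  have hcl : ∀ i, x i ∈ M.closure B := by
    intro i
    rw [hB.closure_eq_closure, AlgebraicIndependent.matroid_closure_eq]
    exact hal i
  have hbas : M.IsBasis X' (M.closure B) := by
    refine hX'i.isBasis_of_eRk_ge ?_ ?_ ?_
    · have := hBfin.to_subtype; exact Set.finite_range _
    · rintro _ ⟨b, rfl⟩; exact hcl _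
    · rw [M.eRk_closure_eq, hBi.eRk_eq_encard, hX'i.eRk_eq_encard, hX'c]
  by_contra hne
  have halg : IsAlgebraic (Algebra.adjoin ℚ X') (aeval x G) := by
    have h1 : ∀ i, x i ∈ Subalgebra.algebraicClosure (Algebra.adjoin ℚ X') ℝ := by
      intro i
      have := hcl i
      rw [← M.closure_closure B, ← hbas.closure_eq_closure, AlgebraicIndependent.matroid_closure_eq] at this
      exact this
    have h2 : aeval x G ∈ ((Subalgebra.algebraicClosure (Algebra.adjoin ℚ X') ℝ).restrictScalars ℚ) := by
      have h3 : Algebra.adjoin ℚ (Set.range x) ≤ ((Subalgebra.algebraicClosure (Algebra.adjoin ℚ X') ℝ).restrictScalars ℚ) := by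
        apply Algebra.adjoin_le; rintro _ ⟨i, rfl⟩; exact h1 i
      apply h3
      rw [Algebra.adjoin_range_eq_range_aeval]; exact ⟨G, rfl⟩
    exact h2
  obtain ⟨t, ht, r, hr, htr⟩ := halg.exists_nonzero_eq_adjoin_mul (mem_nonZeroDivisors_of_ne_zero hne)
  have ht' : t ∈ Algebra.adjoin ℚ (Set.range x) := by
    have h1 : Algebra.adjoin ℚ X' ≤ Algebra.adjoin ℚ (Set.range x) := by
      apply Algebra.adjoin_mono; rintro _ ⟨b, rfl⟩; exact ⟨_, rfl⟩
    clear htr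
    induction ht using Algebra.adjoin_induction with
    | mem a ha => 
      rw [Set.mem_singleton_iff] at ha
      rw [ha, Algebra.adjoin_range_eq_range_aeval]; exact ⟨G, rfl⟩
    | algebraMap r => exact h1 r.2
    | add a b _ _ ha hb => exact add_mem ha hb
    | mul a b _ _ ha hb => exact mul_mem ha hb
  rw [Algebra.adjoin_range_eq_range_aeval] at ht'
  obtain ⟨H, rfl⟩ := ht'
  obtain ⟨r, hr'⟩ := r
  have hr'' := hr'
  rw [hX', Algebra.adjoin_range_eq_range_aeval] at hr''
  obtain ⟨C, hC⟩ := hr''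
  have e1 : aeval x (G * H - rename f C) = 0 := by
    rw [map_sub, map_mul, aeval_rename]
    have : (aeval (x ∘ f)) C = r := hC
    rw [this]
    have : aeval x G * aeval x H = r := htr
    rw [this, sub_self]
  have e2 := hs _ e1
  rw [map_sub, map_mul, hG, zero_mul, zero_sub, neg_eq_zero] at e2
  have := hyf0 _ e2
  apply hr
  apply Subtype.ext
  change r = 0
  rw [← hC, this]; simp

end UPL


namespace UPL
set_option linter.all false

open MvPolynomial

section par
variable {σ : Type} [Fintype σ] [DecidableEq σ]

/-- odd part -/
def oddp (m : σ →₀ ℕ) : Finset σ := Finset.univ.filter (fun e => m e % 2 = 1)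
/-- half -/
noncomputable def halfm (m : σ →₀ ℕ) : σ →₀ ℕ := m.mapRange (· / 2) (by simp)
/-- parity component -/
noncomputable def parQ (P : MvPolynomial σ ℚ) (S : Finset σ) : MvPolynomial σ ℚ :=
  ∑ m ∈ P.support.filter (fun m => oddp m = S), monomial (halfm m) (coeff m P)

lemma aeval_par (P : MvPolynomial σ ℚ) (l : σ → ℝ) : 
    aeval l P = ∑ S : Finset σ, aeval (fun e => l e ^ 2) (parQ P S) * ∏ e ∈ S, l e := by
  conv_lhs => rw [P.as_sum, map_sum]
  rw [← Finset.sum_fiberwise_of_maps_to (s := P.support) (t := Finset.univ) (g := oddp) (fun _ _ => Finset.mem_univ _)]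
  apply Finset.sum_congr rfl
  intro S _
  rw [parQ, map_sum, Finset.sum_mul]
  apply Finset.sum_congr rfl
  intro m hm
  rw [Finset.mem_filter] at hm
  rw [← hm.2, aeval_monomial, aeval_monomial, mul_assoc]
  congr 1
  rw [Finsupp.prod_fintype _ _ (by simp), Finsupp.prod_fintype _ _ (by simp), oddp, Finset.prod_filter, ← Finset.prod_mul_distrib]
  apply Finset.prod_congr rfl
  intro e _
  simp only [halfm, Finsupp.mapRange_apply]
  conv_lhs => rw [← Nat.div_add_mod (m e) 2]
  rw [pow_add, pow_mul]
  congr 1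
  rcases Nat.mod_two_eq_zero_or_one (m e) with h | h <;> simp [h]

lemma deg_parQ (P : MvPolynomial σ ℚ) (S : Finset σ) (hS : S.Nonempty) (D : ℕ) (hD : P.totalDegree ≤ 2 * D + 2) : 
    (parQ P S).totalDegree ≤ D := by
  apply totalDegree_finsetSum_le
  intro m hm
  rw [Finset.mem_filter] at hm
  refine (totalDegree_monomial_le _ _).trans ?_
  have h1 := (le_totalDegree hm.1).trans hD
  rw [Finsupp.sum_fintype _ _ (by simp)] at h1 ⊢
  obtain ⟨a, ha⟩ := hS
  rw [← hm.2, oddp, Finset.mem_filter] at ha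
  have : 2 * ∑ e, halfm m e < ∑ e, m e := by
    rw [Finset.mul_sum]
    apply Finset.sum_lt_sum
    · intro e _; simp only [halfm, Finsupp.mapRange_apply]; omega
    · exact ⟨a, Finset.mem_univ _, by simp only [halfm, Finsupp.mapRange_apply]; omega⟩
  simp only [id] at h1 ⊢
  omega

/-- sign change -/
noncomputable def sgn (ε : σ → ℤˣ) : MvPolynomial σ ℚ →ₐ[ℚ] MvPolynomial σ ℚ := aeval (fun e => C ((ε e : ℤ) : ℚ) * X e)

lemma aeval_sgn (ε : σ → ℤˣ) (P : MvPolynomial σ ℚ) (l : σ → ℝ) : aeval l (sgn ε P) = aeval (fun e => ((ε e : ℤ) : ℝ) * l e) P := by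
  have : (aeval l : MvPolynomial σ ℚ →ₐ[ℚ] ℝ).comp (sgn ε) = aeval (fun e => ((ε e : ℤ) : ℝ) * l e) := by
    apply MvPolynomial.algHom_ext; intro e; simp [sgn]
  exact congrArg (fun f => f P) this

lemma sgn_sgn (ε δ : σ → ℤˣ) (P : MvPolynomial σ ℚ) : sgn δ (sgn ε P) = sgn (δ * ε) P := by
  have : (sgn δ).comp (sgn ε) = sgn (δ * ε) := by
    apply MvPolynomial.algHom_ext; intro e; simp [sgn, mul_comm, mul_left_comm, mul_assoc]
  exact congrArg (fun f => f P) this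

lemma sgn_one (P : MvPolynomial σ ℚ) : sgn 1 P = P := by
  have : sgn (1 : σ → ℤˣ) = AlgHom.id _ _ := by
    apply MvPolynomial.algHom_ext; intro e; simp [sgn]
  rw [this]; rfl

lemma coeff_sgn (ε : σ → ℤˣ) (P : MvPolynomial σ ℚ) (m : σ →₀ ℕ) : coeff m (sgn ε P) = (∏ e, ((ε e : ℤ) : ℚ) ^ m e) * coeff m P := by
  induction P using MvPolynomial.induction_on' with
  | monomial u a =>
    have : sgn ε (monomial u a) = monomial u ((∏ e, ((ε e : ℤ) : ℚ) ^ u e) * a) := by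
      rw [sgn, aeval_monomial, Finsupp.prod_fintype _ _ (by simp)]
      simp only [mul_pow]
      rw [Finset.prod_mul_distrib]
      simp only [← map_pow]
      rw [← map_prod, monomial_eq, Finsupp.prod_fintype _ _ (by simp), map_mul, algebraMap_eq]
      ring
    rw [this, coeff_monomial, coeff_monomial]
    split_ifs with h
    · rw [h]
    · simp
  | add p q hp hq => rw [map_add, coeff_add, coeff_add, hp, hq]; ring

lemma totalDegree_sgn (ε : σ → ℤˣ) (P : MvPolynomial σ ℚ) : (sgn ε P).totalDegree ≤ P.totalDegree := by
  apply totalDegree_le_of_support_subset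
  intro m hm
  rw [mem_support_iff] at hm ⊢
  intro h; apply hm; rw [coeff_sgn, h, mul_zero]

/-- norm -/
noncomputable def Nm (P : MvPolynomial σ ℚ) : MvPolynomial σ ℚ := ∏ ε : σ → ℤˣ, sgn ε P

lemma sgn_Nm (δ : σ → ℤˣ) (P : MvPolynomial σ ℚ) : sgn δ (Nm P) = Nm P := by
  rw [Nm, map_prod]
  simp only [sgn_sgn]
  exact Fintype.prod_equiv (Equiv.mulLeft δ) _ _ (fun ε => rfl)

lemma parQ_Nm (P : MvPolynomial σ ℚ) (S : Finset σ) (hS : S.Nonempty) : parQ (Nm P) S = 0 := by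
  rw [parQ, Finset.filter_eq_empty_iff.mpr, Finset.sum_empty]
  rintro m hm rfl
  rw [mem_support_iff] at hm
  obtain ⟨a, ha⟩ := hS
  rw [oddp, Finset.mem_filter] at ha
  have h := coeff_sgn (Function.update 1 a (-1)) (Nm P) m
  rw [sgn_Nm, Finset.prod_eq_single a] at h
  · rw [Function.update_self, ← Nat.div_add_mod (m a) 2, ha.2, pow_add, pow_mul] at h
    simp at h
    apply hm; linarith
  · intro b _ hb; rw [Function.update_of_ne hb]; simp
  · simp

end par

/-- transfer property -/
def Tr {n d : ℕ} (p q : Fin n → Fin d → ℝ) : Prop := ∀ G : MvPolynomial (Ed n) ℚ, aeval (zv q) G = 0 → aeval (zv p) G = 0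

theorem even_thm {n d : ℕ} (hd : 2 ≤ d) (p q : Fin n → Fin d → ℝ) (hp : GenericConfig p) (ht : Tr p q) (P : MvPolynomial (Ed n) ℚ)
    (hP : aeval (lv q) P = 0) (hdeg : P.totalDegree ≤ 2 * d + 2) (l l' : Ed n → ℝ) (hl : ∀ e, l e ^ 2 = l' e ^ 2) : 
    aeval l P = aeval l' P := by
  classical
  have hz : ∀ q : Fin n → Fin d → ℝ, (fun e => lv q e ^ 2) = zv q := fun q => funext (lv_sq q)
  have h1 : aeval (lv q) (Nm P) = 0 := by
    rw [Nm, map_prod]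
    apply Finset.prod_eq_zero (Finset.mem_univ 1)
    rw [sgn_one, hP]
  have hN : ∀ l : Ed n → ℝ, aeval l (Nm P) = aeval (fun e => l e ^ 2) (parQ (Nm P) ∅) := by
    intro l
    rw [aeval_par, Finset.sum_eq_single ∅]
    · simp
    · intro S _ hS; rw [parQ_Nm P S (Finset.nonempty_iff_ne_empty.mpr hS)]; simp
    · simp
  have h2 : aeval (lv p) (Nm P) = 0 := by
    rw [hN, hz] at h1 ⊢
    exact ht _ h1
  rw [Nm, map_prod, Finset.prod_eq_zero_iff] at h2
  obtain ⟨ε, -, hε⟩ := h2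
  rw [aeval_par, hz] at hε
  have h3 := kum hd p hp _ hε
  have h4 : ∀ S : Finset (Ed n), S.Nonempty → parQ (sgn ε P) S = 0 := by
    intro S hS
    have h5 : MvPolynomial.map (algebraMap ℚ ℝ) (parQ (sgn ε P) S) = 0 := by
      apply lowDeg d
      · refine (Finset.sup_mono (support_map_subset _ _)).trans (deg_parQ _ S hS d ((totalDegree_sgn _ _).trans hdeg))
      · intro q'
        rw [eval_map, ← aeval_def]
        exact gen_van p hp _ (h3 S) q'
    exact map_injective _ (algebraMap ℚ ℝ).injective (by rw [h5, map_zero])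
  have h6 : ∀ l : Ed n → ℝ, aeval l (sgn ε P) = aeval (fun e => l e ^ 2) (parQ (sgn ε P) ∅) := by
    intro l
    rw [aeval_par, Finset.sum_eq_single ∅]
    · simp
    · intro S _ hS; rw [h4 S (Finset.nonempty_iff_ne_empty.mpr hS)]; simp
    · simp
  have hss : ∀ e, ((ε e : ℤ) : ℝ) * ((ε e : ℤ) : ℝ) = 1 := by
    intro e; rcases Int.units_eq_one_or (ε e) with h | h <;> simp [h]
  have h7 : ∀ l : Ed n → ℝ, aeval l P = aeval (fun e => (((ε e : ℤ) : ℝ) * l e) ^ 2) (parQ (sgn ε P) ∅) := by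
    intro l
    rw [← h6, aeval_sgn]
    congr 2; funext e; rw [← mul_assoc, hss, one_mul]
  rw [h7 l, h7 l']
  congr 2; funext e; rw [mul_pow, mul_pow, hl]

end UPL


namespace UPL
set_option linter.all false

open MvPolynomial

/-- linear form -/
noncomputable def lf {σ : Type} [Fintype σ] (c : σ → ℚ) : MvPolynomial σ ℚ := ∑ a, C (c a) * X a

lemma aeval_lf {σ : Type} [Fintype σ] (c : σ → ℚ) (l : σ → ℝ) : aeval l (lf c) = ∑ a, (c a : ℝ) * l a := by
  simp [lf]

lemma deg_lf {σ : Type} [Fintype σ] (c : σ → ℚ) : (lf c).totalDegree ≤ 1 := by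
  apply totalDegree_finsetSum_le
  intro a _
  refine (totalDegree_mul _ _).trans ?_
  rw [totalDegree_C, totalDegree_X]

lemma lin_indep {n d : ℕ} (hd : 2 ≤ d) (p q : Fin n → Fin d → ℝ) (hp : GenericConfig p) (ht : Tr p q) (c : Ed n → ℚ)
    (h : ∑ a, (c a : ℝ) * lv q a = 0) : ∀ a, c a = 0 := by
  intro a
  have := even_thm hd p q hp ht (lf c) (by rw [aeval_lf, h]) ((deg_lf c).trans (by omega)) (Pi.single a 1) (-Pi.single a 1) (by simp)
  rw [aeval_lf, aeval_lf] at this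
  simp [Pi.single_apply] at this
  have h2 : (c a : ℝ) = 0 := by linarith
  exact_mod_cast h2

lemma aeval_FP' {N : ℕ} {σ : Type} (g : Ed N → MvPolynomial σ ℚ) (l : σ → ℝ) : aeval l (aeval g (FP N ℚ)) = F (fun e => aeval l (g e)) := by
  rw [aeval_FP]
  have := RingHom.map_det (aeval l : MvPolynomial σ ℚ →ₐ[ℚ] ℝ).toRingHom (cm g)
  rw [cm_map] at this
  exact this

/-- edge map -/
def emap {N n : ℕ} (w : Fin N → Fin n) (hw : Function.Injective w) (e : Ed N) : Ed n :=
  ⟨Sym2.map w e.1, by rw [Sym2.isDiag_map hw]; exact e.2⟩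

lemma emap_mk {N n : ℕ} (w : Fin N → Fin n) (hw : Function.Injective w) (i j) (h : i ≠ j) : emap w hw (mkE i j h) = mkE (w i) (w j) (hw.ne h) := rfl

lemma emap_inj {N n : ℕ} (w : Fin N → Fin n) (hw : Function.Injective w) : Function.Injective (emap w hw) := by
  intro a b h
  apply Subtype.ext
  exact Sym2.map.injective hw (congrArg Subtype.val h)

lemma lv_emap {N n d : ℕ} (w : Fin N → Fin n) (hw : Function.Injective w) (p : Fin n → Fin d → ℝ) (e : Ed N) :
    lv p (emap w hw e) = lv (p ∘ w) e := by
  induction e using Ed_ind with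
  | H i j h => rw [emap_mk]; rfl

theorem mainH {n d : ℕ} (hd : 1 ≤ d) (p q : Fin n → Fin (d+1) → ℝ) (hp : GenericConfig p) (ht : Tr p q)
    (w : Fin (d+3) → Fin n) (hw : Function.Injective w) (E : Ed (d+3) → Ed n → ℚ) 
    (hrow : ∀ e, lv (p ∘ w) e = ∑ a, (E e a : ℝ) * lv q a) (o : Fin (d+3))
    (H3 : ∀ a (h : o ≠ a) c, 0 ≤ E (mkE o a h) c) 
    (H4 : ∀ a b (ha : o ≠ a) (hb : o ≠ b) (hab : a ≠ b) c, 0 ≤ E (mkE o a ha) c + E (mkE a b hab) c + E (mkE o b hb) c) :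
    ∃ (θ : Fin (d+3) → Fin n) (hθ : Function.Injective θ) (s : ℝ), 0 < s ∧ 
      ∀ e c, (E e c : ℝ) = if c = emap θ hθ e then s else 0 := by
  classical
  have hd2 : 2 ≤ d + 1 := by omega
  set ER : Ed (d+3) → Ed n → ℝ := fun e a => E e a with hER
  let P : MvPolynomial (Ed n) ℚ := aeval (fun e => lf (E e) ^ 2) (FP (d+3) ℚ)
  have hPe : ∀ l : Ed n → ℝ, aeval l P = ff (LM ER l) := by
    intro l
    rw [aeval_FP', ff]
    congr 1; funext e; rw [map_pow, aeval_lf]; rfl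
  have hPdeg : P.totalDegree ≤ 2 * (d+1) + 2 := by
    change (aeval (fun e => lf (E e) ^ 2) (FP (d+3) ℚ)).totalDegree ≤ _
    rw [aeval_FP]
    refine (totalDegree_det_cm (D := 2) _ ?_).trans (by omega)
    intro e
    refine (totalDegree_pow _ _).trans ?_
    have := deg_lf (E e); omega
  have hlm : LM ER (lv q) = lv (p ∘ w) := by
    funext e; rw [hrow]; rfl
  have hP0 : aeval (lv q) P = 0 := by
    rw [hPe, hlm, ff]
    have : (fun e => lv (p ∘ w) e ^ 2) = zv (p ∘ w) := funext (lv_sq _)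
    rw [this]; exact F_config (d := d+1) (p ∘ w)
  have H1 : ∀ a l, ff (LM ER (flp a l)) = ff (LM ER l) := by
    intro a l
    rw [← hPe, ← hPe]
    apply even_thm hd2 p q hp ht P hP0 hPdeg
    intro e; exact congrFun (flp_sq a l) e
  have H2 : Function.Surjective (LM ER) := by
    let LQ : (Ed n → ℚ) →ₗ[ℚ] (Ed (d+3) → ℚ) := Matrix.mulVecLin (Matrix.of E)
    have hLQ : Function.Surjective LQ := by
      rw [← LinearMap.range_eq_top]
      by_contra hne
      obtain ⟨f, hf0, hf⟩ := Submodule.exists_le_ker_of_lt_top _ (lt_top_iff_ne_top.mpr hne)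
      let c : Ed (d+3) → ℚ := fun e => f (Pi.single e 1)
      have hfc : ∀ v, f v = ∑ e, v e * c e := by
        intro v
        conv_lhs => rw [pi_eq_sum_univ' v]
        rw [map_sum]
        apply Finset.sum_congr rfl
        intro e _
        rw [map_smul, smul_eq_mul]
      have hca : ∀ a, ∑ e, E e a * c e = 0 := by
        intro a
        have : f (LQ (Pi.single a 1)) = 0 := hf ⟨_, rfl⟩
        rw [hfc] at this
        simpa [LQ, Matrix.mulVec_single] using this
      have hsum : ∑ e, (c e : ℝ) * lv (p ∘ w) e = 0 := by
        simp only [hrow, Finset.mul_sum]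
        rw [Finset.sum_comm]
        apply Finset.sum_eq_zero
        intro a _
        have := congrArg (fun x : ℚ => (x : ℝ) * lv q a) (hca a)
        simp only [Rat.cast_sum, Rat.cast_mul, Rat.cast_zero, zero_mul, Finset.sum_mul] at this
        rw [← this]
        apply Finset.sum_congr rfl; intros; ring
      let c' : Ed n → ℚ := fun a => ∑ e, if emap w hw e = a then c e else 0
      have hc' : ∑ a, (c' a : ℝ) * lv p a = 0 := by
        rw [← hsum]
        simp only [c', Rat.cast_sum, Finset.sum_mul]
        rw [Finset.sum_comm]
        apply Finset.sum_congr rfl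
        intro e _
        rw [Finset.sum_eq_single (emap w hw e)]
        · simp [lv_emap]
        · intro b _ hb; rw [if_neg hb.symm]; simp
        · simp
      have hc0 := lin_indep hd2 p p hp (fun G h => h) c' hc'
      apply hf0
      apply LinearMap.ext
      intro v
      rw [hfc, LinearMap.zero_apply]
      apply Finset.sum_eq_zero
      intro e _
      have := hc0 (emap w hw e)
      simp only [c'] at this
      rw [Finset.sum_eq_single e (fun b _ hb => if_neg (fun h => hb (emap_inj w hw h))) (by simp), if_pos rfl] at this
      rw [this, mul_zero]
    intro v
    choose x hx using fun e => hLQ (Pi.single e 1)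
    refine ⟨fun a => ∑ e, v e * x e a, ?_⟩
    funext e
    change ∑ a, (E e a : ℝ) * ∑ e', v e' * x e' a = _
    simp only [Finset.mul_sum]
    rw [Finset.sum_comm]
    have : ∀ e', ∑ a, (E e a : ℝ) * (v e' * x e' a) = v e' * (if e = e' then 1 else 0) := by
      intro e'
      have h := congrFun (hx e') e
      have h2 : ∑ a, E e a * x e' a = if e = e' then 1 else 0 := by
        rw [Pi.single_apply] at h; exact h
      have h3 := congrArg (fun x : ℚ => (x : ℝ)) h2
      push_cast at h3
      have h4 : (((if e = e' then 1 else 0 : ℚ)) : ℝ) = if e = e' then 1 else 0 := by split_ifs <;> simp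
      rw [h4] at h3
      rw [← h3, Finset.mul_sum]
      apply Finset.sum_congr rfl; intros; ring
    simp [this]
  obtain ⟨τ, k, hτ, hk, hEk⟩ := stepD (by omega) ER H1 H2 o (fun a h c => by simp only [hER]; exact_mod_cast H3 a h c) 
    (fun a b ha hb hab c => by simp only [hER]; exact_mod_cast H4 a b ha hb hab c)
  have hkE : ∀ e, (E e (τ e) : ℝ) = k e := by
    intro e; have := hEk e (τ e); rwa [if_pos rfl] at this
  have hlm2 : ∀ l e, LM ER l e = k e * l (τ e) := by
    intro l e
    change ∑ a, ER e a * l a = _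
    simp [hEk]
  let G : MvPolynomial (Ed n) ℚ := aeval (fun e => C (E e (τ e) ^ 2) * X (τ e)) (FP (d+3) ℚ)
  have hG : ∀ z : Ed n → ℝ, aeval z G = F (fun e => k e ^ 2 * z (τ e)) := by
    intro z
    rw [aeval_FP']
    congr 1; funext e
    simp [hkE]
  have hG0 : aeval (zv q) G = 0 := by
    rw [hG, ← hP0, hPe, ff]
    congr 1; funext e; rw [hlm2, mul_pow, lv_sq]
  obtain ⟨θ, hθ, s, hs, hks, hτθ⟩ := stepE τ hτ k hk (fun q' => by rw [← hG]; exact gen_van p hp _ (ht _ hG0) q') hd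
  refine ⟨θ, hθ, s, hs, ?_⟩
  intro e c
  have hτe : τ e = emap θ hθ e := by
    induction e using Ed_ind with
    | H a b h => rw [hτθ, emap_mk]
  rw [← hτe, ← hks e]
  exact hEk e c

end UPL


namespace UPL
set_option linter.all false

open MvPolynomial Matrix

/-- squared distance -/
def sd {d : ℕ} (x y : Fin d → ℝ) : ℝ := ∑ k, (x k - y k) ^ 2

lemma eudist_eq {d : ℕ} (x y : Fin d → ℝ) : eudist x y = Real.sqrt (sd x y) := rfl
lemma sd_nonneg {d : ℕ} (x y : Fin d → ℝ) : 0 ≤ sd x y := Finset.sum_nonneg (fun _ _ => sq_nonneg _)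
lemma eudist_sq {d : ℕ} (x y : Fin d → ℝ) : eudist x y ^ 2 = sd x y := Real.sq_sqrt (sd_nonneg x y)
lemma eudist_nonneg {d : ℕ} (x y : Fin d → ℝ) : 0 ≤ eudist x y := Real.sqrt_nonneg _
lemma sd_comm {d : ℕ} (x y : Fin d → ℝ) : sd x y = sd y x := Finset.sum_congr rfl (fun _ _ => by ring)
lemma eudist_comm {d : ℕ} (x y : Fin d → ℝ) : eudist x y = eudist y x := by rw [eudist_eq, sd_comm, ← eudist_eq]
lemma sd_self {d : ℕ} (x : Fin d → ℝ) : sd x x = 0 := by simp [sd]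
lemma eudist_self {d : ℕ} (x : Fin d → ℝ) : eudist x x = 0 := by simp [eudist_eq, sd_self]
lemma lv_mk {n d : ℕ} (p : Fin n → Fin d → ℝ) (i j) (h : i ≠ j) : lv p (mkE i j h) = eudist (p i) (p j) := rfl
lemma zv_mk' {n d : ℕ} (p : Fin n → Fin d → ℝ) (i j) (h : i ≠ j) : zv p (mkE i j h) = sd (p i) (p j) := rfl
lemma sd_dot {d : ℕ} (x y : Fin d → ℝ) : sd x y = (x - y) ⬝ᵥ (x - y) := by
  simp [sd, dotProduct, pow_two]
lemma polar {d : ℕ} (a b o : Fin d → ℝ) : (a - o) ⬝ᵥ (b - o) = (sd a o + sd b o - sd a b) / 2 := by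
  rw [eq_div_iff two_ne_zero, sd, sd, sd, dotProduct, ← Finset.sum_add_distrib, ← Finset.sum_sub_distrib, Finset.sum_mul]
  apply Finset.sum_congr rfl
  intro k _
  simp only [Pi.sub_apply]; ring

/-- difference matrix -/
def dm {d : ℕ} (y : Fin (d+1) → Fin d → ℝ) : Matrix (Fin d) (Fin d) ℝ := fun t => y t.succ - y 0

lemma dm_mulVec {d : ℕ} (y : Fin (d+1) → Fin d → ℝ) (u : Fin d → ℝ) (t : Fin d) : 
    (dm y *ᵥ (u - y 0)) t = (sd (y t.succ) (y 0) + sd u (y 0) - sd (y t.succ) u) / 2 := by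
  rw [← polar]; rfl

lemma dm_gram {d : ℕ} (y : Fin (d+1) → Fin d → ℝ) (t t' : Fin d) : 
    (dm y * (dm y)ᵀ) t t' = (sd (y t.succ) (y 0) + sd (y t'.succ) (y 0) - sd (y t.succ) (y t'.succ)) / 2 := by
  rw [← polar]; rfl

lemma gram2 {d : ℕ} (A : Matrix (Fin d) (Fin d) ℝ) (hA : A.det ≠ 0) (x : Fin d → ℝ) : 
    x ⬝ᵥ x = (A *ᵥ x) ⬝ᵥ ((A * Aᵀ)⁻¹ *ᵥ (A *ᵥ x)) := by
  have hu : IsUnit A.det := isUnit_iff_ne_zero.mpr hA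
  rw [Matrix.mul_inv_rev, mulVec_mulVec, Matrix.mul_assoc, Matrix.nonsing_inv_mul _ hu, Matrix.mul_one, 
    dotProduct_mulVec, ← mulVec_transpose, ← Matrix.transpose_nonsing_inv, Matrix.transpose_transpose, mulVec_mulVec, 
    Matrix.nonsing_inv_mul _ hu, one_mulVec]

lemma sd_formula {d : ℕ} (y : Fin (d+1) → Fin d → ℝ) (hy : (dm y).det ≠ 0) (u v : Fin d → ℝ) : 
    sd u v = (dm y *ᵥ (u - y 0) - dm y *ᵥ (v - y 0)) ⬝ᵥ ((dm y * (dm y)ᵀ)⁻¹ *ᵥ (dm y *ᵥ (u - y 0) - dm y *ᵥ (v - y 0))) := by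
  rw [← mulVec_sub, sub_sub_sub_cancel_right, ← gram2 _ hy, sd_dot]

lemma gram_congr {d : ℕ} (y y' : Fin (d+1) → Fin d → ℝ) (h : ∀ t t', sd (y t) (y t') = sd (y' t) (y' t')) : 
    dm y * (dm y)ᵀ = dm y' * (dm y')ᵀ := by
  ext t t'; rw [dm_gram, dm_gram, h, h, h]

lemma det_congr {d : ℕ} (y y' : Fin (d+1) → Fin d → ℝ) (h : ∀ t t', sd (y t) (y t') = sd (y' t) (y' t')) (hy : (dm y).det ≠ 0) : 
    (dm y').det ≠ 0 := by
  have := congrArg Matrix.det (gram_congr y y' h)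
  rw [det_mul, det_mul, det_transpose, det_transpose] at this
  intro h0; rw [h0] at this; simp at this; exact hy this

lemma sd_eq {d : ℕ} (y y' : Fin (d+1) → Fin d → ℝ) (h : ∀ t t', sd (y t) (y t') = sd (y' t) (y' t')) (hy : (dm y).det ≠ 0) 
    (u v u' v' : Fin d → ℝ) (hu : ∀ t, sd (y t) u = sd (y' t) u') (hv : ∀ t, sd (y t) v = sd (y' t) v') : sd u v = sd u' v' := by
  have hb : ∀ u u', (∀ t, sd (y t) u = sd (y' t) u') → dm y *ᵥ (u - y 0) = dm y' *ᵥ (u' - y' 0) := by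
    intro u u' hu
    ext t; rw [dm_mulVec, dm_mulVec, sd_comm u, sd_comm u', hu, hu, h]
  rw [sd_formula y hy, sd_formula y' (det_congr y y' h hy), hb u u' hu, hb v v' hv, gram_congr y y' h]

lemma inv_mem_sub {d : ℕ} (K : Subfield ℝ) (G : Matrix (Fin d) (Fin d) ℝ) (hG : ∀ i j, G i j ∈ K) (hdet : G.det ≠ 0) (i j) : G⁻¹ i j ∈ K := by
  let G' : Matrix (Fin d) (Fin d) K := fun i j => ⟨G i j, hG i j⟩
  have hm : K.subtype.mapMatrix G' = G := rfl
  have hd' : G'.det ≠ 0 := by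
    intro h0; apply hdet; rw [← hm, ← RingHom.map_det, h0, map_zero]
  have h1 : K.subtype.mapMatrix (G'⁻¹) = G⁻¹ := by
    symm
    apply Matrix.inv_eq_left_inv
    conv_lhs => rw [← hm]
    rw [← map_mul, Matrix.nonsing_inv_mul _ (isUnit_iff_ne_zero.mpr hd'), map_one]
  rw [← h1]
  exact (G'⁻¹ i j).2

lemma sd_mem {d : ℕ} (K : Subfield ℝ) (y : Fin (d+1) → Fin d → ℝ) (hy : (dm y).det ≠ 0) (h : ∀ t t', sd (y t) (y t') ∈ K) (u v : Fin d → ℝ)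
    (hu : ∀ t, sd (y t) u ∈ K) (hv : ∀ t, sd (y t) v ∈ K) : sd u v ∈ K := by
  have h2 : (2 : ℝ) ∈ K := by exact_mod_cast natCast_mem K 2
  have hb : ∀ u, (∀ t, sd (y t) u ∈ K) → ∀ t, (dm y *ᵥ (u - y 0)) t ∈ K := by
    intro u hu t
    rw [dm_mulVec, sd_comm u]
    exact K.div_mem (K.sub_mem (K.add_mem (h _ _) (hu _)) (hu _)) h2
  rw [sd_formula y hy]
  refine K.sum_mem (fun i _ => K.mul_mem (K.sub_mem (hb u hu i) (hb v hv i)) ?_)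
  rw [mulVec, dotProduct]
  refine K.sum_mem (fun j _ => K.mul_mem ?_ (K.sub_mem (hb u hu j) (hb v hv j)))
  apply inv_mem_sub
  · intro i j; rw [dm_gram]; exact K.div_mem (K.sub_mem (K.add_mem (h _ _) (h _ _)) (h _ _)) h2
  · rw [det_mul, det_transpose]; exact mul_ne_zero hy hy

lemma gen_det {n d : ℕ} (p : Fin n → Fin d → ℝ) (hp : GenericConfig p) (I : Fin (d+1) → Fin n) (hI : Function.Injective I) : 
    (dm (p ∘ I)).det ≠ 0 := by
  classical
  let D : Matrix (Fin d) (Fin d) (MvPolynomial (Fin n × Fin d) ℚ) := fun t k => X (I t.succ, k) - X (I 0, k)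
  have hD : ∀ q : Fin n → Fin d → ℝ, aeval (fun a => q a.1 a.2) D.det = (dm (q ∘ I)).det := by
    intro q
    have := RingHom.map_det (aeval (fun a => q a.1 a.2) : MvPolynomial (Fin n × Fin d) ℚ →ₐ[ℚ] ℝ).toRingHom D
    refine this.trans ?_
    congr 1
    ext t k
    change aeval (fun a : Fin n × Fin d => q a.1 a.2) (X (I t.succ, k) - X (I 0, k)) = _
    simp [dm]
  rw [← hD]
  apply hp
  intro h0
  have := hD (fun i k => if i = I k.succ then 1 else 0)
  rw [h0, map_zero] at this
  have h1 : dm ((fun i k => if i = I k.succ then 1 else 0 : Fin n → Fin d → ℝ) ∘ I) = 1 := by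
    ext t k
    have e1 : (I t.succ = I k.succ) ↔ t = k := by rw [hI.eq_iff]; exact Fin.succ_inj
    have e2 : I 0 ≠ I k.succ := fun h => (Fin.succ_ne_zero k) (hI h).symm
    simp [dm, e1, e2, Matrix.one_apply]
  rw [h1, det_one] at this
  exact zero_ne_one this

lemma exists_cong {d : ℕ} {ι : Type*} (x x' : ι → Fin d → ℝ) (h : ∀ i j, sd (x i) (x j) = sd (x' i) (x' j)) (I : Fin (d+1) → ι) 
    (hI : (dm (x ∘ I)).det ≠ 0) : ∃ f : (Fin d → ℝ) → (Fin d → ℝ), IsCongruence f ∧ ∀ i, x' i = f (x i) := by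
  set A := dm (x ∘ I) with hA
  set B := dm (x' ∘ I) with hB
  have hgr : A * Aᵀ = B * Bᵀ := gram_congr _ _ (fun t t' => h _ _)
  have hBd : B.det ≠ 0 := det_congr _ _ (fun t t' => h _ _) hI
  have hAu : IsUnit A.det := isUnit_iff_ne_zero.mpr hI
  have hBu : IsUnit B.det := isUnit_iff_ne_zero.mpr hBd
  -- O = B⁻¹ A
  have hO : (B⁻¹ * A)ᵀ * (B⁻¹ * A) = 1 := by
    rw [← mul_eq_one_comm, transpose_mul, Matrix.mul_assoc, ← Matrix.mul_assoc A, hgr, transpose_nonsing_inv, Matrix.mul_assoc B, 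
      Matrix.mul_nonsing_inv _ (by rwa [det_transpose]), Matrix.mul_one, Matrix.nonsing_inv_mul _ hBu]
  have hO' : (B⁻¹ * A) * (B⁻¹ * A)ᵀ = 1 := mul_eq_one_comm.mp hO
  refine ⟨fun v => (B⁻¹ * A) *ᵥ (v - x (I 0)) + x' (I 0), ⟨⟨?_, ?_⟩, ?_⟩, ?_⟩
  · intro u v huv
    have h1 := add_right_cancel huv
    have h2 := congrArg (fun z => (B⁻¹ * A)ᵀ *ᵥ z) h1
    simp only [mulVec_mulVec, hO, one_mulVec] at h2
    exact sub_left_injective h2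
  · intro v
    refine ⟨(B⁻¹ * A)ᵀ *ᵥ (v - x' (I 0)) + x (I 0), ?_⟩
    simp only [add_sub_cancel_right, mulVec_mulVec, hO', one_mulVec, sub_add_cancel]
  · intro u v
    rw [eudist_eq, eudist_eq]
    congr 1
    rw [sd_dot, sd_dot, add_sub_add_right_eq_sub, ← mulVec_sub, sub_sub_sub_cancel_right, dotProduct_mulVec, ← mulVec_transpose,
      mulVec_mulVec, hO, one_mulVec]
  · intro i
    have hb : A *ᵥ (x i - x (I 0)) = B *ᵥ (x' i - x' (I 0)) := by
      ext t
      refine (dm_mulVec (x ∘ I) (x i) t).trans ((Eq.trans ?_ (dm_mulVec (x' ∘ I) (x' i) t).symm))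
      simp only [Function.comp, h]
    simp only [← mulVec_mulVec, hb]
    rw [mulVec_mulVec, Matrix.nonsing_inv_mul _ hBu, one_mulVec, sub_add_cancel]

/-- relative algebraic closure -/
def acl (R : Subalgebra ℚ ℝ) : Subfield ℝ where
  carrier := {x | IsAlgebraic R x}
  one_mem' := isAlgebraic_one
  zero_mem' := isAlgebraic_zero
  add_mem' := fun h h' => h.add h'
  mul_mem' := fun h h' => h.mul h'
  neg_mem' := fun h => h.neg
  inv_mem' := fun x h => h.inv

lemma mem_acl_of_sq (R : Subalgebra ℚ ℝ) (x : ℝ) (h : x ^ 2 ∈ acl R) : x ∈ acl R := 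
  IsAlgebraic.of_pow (by norm_num) h

end UPL


namespace UPL
set_option linter.all false

open MvPolynomial Matrix

/-- abstract trilateration -/
def TA {n : ℕ} (d : ℕ) (hn : d + 2 ≤ n) (p : Fin n → Fin d → ℝ) (M : AddSubmonoid ℝ) : Prop :=
  (∀ a b : Fin (d+2), a ≠ 0 → b ≠ 0 → a ≠ b → 
    2 * eudist (p (Fin.castLE hn 0)) (p (Fin.castLE hn a)) ∈ M ∧ 
    eudist (p (Fin.castLE hn 0)) (p (Fin.castLE hn a)) + eudist (p (Fin.castLE hn a)) (p (Fin.castLE hn b)) 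
      + eudist (p (Fin.castLE hn 0)) (p (Fin.castLE hn b)) ∈ M) ∧
  ∀ j : Fin n, d + 2 ≤ j.val → ∃ I : Fin (d+1) → Fin n, Function.Injective I ∧ (∀ t, (I t).val < j.val) ∧ 
    ((∀ t u, eudist (p (I t)) (p (I u)) ∈ M) → 2 * eudist (p (I 0)) (p j) ∈ M ∧ 
      ∀ t, t ≠ 0 → eudist (p (I 0)) (p (I t)) + eudist (p (I t)) (p j) + eudist (p (I 0)) (p j) ∈ M)

lemma half_mem (K : Subfield ℝ) (x : ℝ) (h : 2 * x ∈ K) : x ∈ K := by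
  have h2 : (2 : ℝ) ∈ K := by exact_mod_cast natCast_mem K 2
  have := K.div_mem h h2
  rwa [mul_div_cancel_left₀ _ two_ne_zero] at this

lemma mid_mem (K : Subfield ℝ) (x y z : ℝ) (h : x + y + z ∈ K) (hx : x ∈ K) (hz : z ∈ K) : y ∈ K := by
  have := K.sub_mem (K.sub_mem h hx) hz
  have e : x + y + z - x - z = y := by ring
  rwa [e] at this

theorem all_mem {n d : ℕ} (hd : 2 ≤ d) (hn : d + 2 ≤ n) (p : Fin n → Fin d → ℝ) (hp : GenericConfig p) (R : Subalgebra ℚ ℝ) 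
    (h : TA d hn p (acl R).toAddSubmonoid) : ∀ m, d + 2 ≤ m → m ≤ n → ∀ i j : Fin n, i.val < m → j.val < m → 
      eudist (p i) (p j) ∈ acl R := by
  intro m hm
  induction m, hm using Nat.le_induction with
  | base =>
    intro _ i j hi hj
    have h0 : ∀ a : Fin (d+2), eudist (p (Fin.castLE hn 0)) (p (Fin.castLE hn a)) ∈ acl R := by
      intro a
      by_cases ha : a = 0
      · rw [ha, eudist_self]; exact (acl R).zero_mem
      · have : ∃ b : Fin (d+2), b ≠ 0 ∧ a ≠ b := by
          by_cases h1 : a = 1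
          · refine ⟨⟨2, by omega⟩, by simp [Fin.ext_iff], by rw [h1]; simp [Fin.ext_iff]⟩
          · exact ⟨1, by simp [Fin.ext_iff], h1⟩
        obtain ⟨b, hb, hab⟩ := this
        exact half_mem _ _ (h.1 a b ha hb hab).1
    have h1 : ∀ a b : Fin (d+2), eudist (p (Fin.castLE hn a)) (p (Fin.castLE hn b)) ∈ acl R := by
      intro a b
      by_cases ha : a = 0
      · rw [ha]; exact h0 b
      by_cases hb : b = 0
      · rw [hb, eudist_comm]; exact h0 a
      by_cases hab : a = b
      · rw [hab, eudist_self]; exact (acl R).zero_mem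
      exact mid_mem _ _ _ _ (h.1 a b ha hb hab).2 (h0 a) (h0 b)
    exact h1 ⟨i, hi⟩ ⟨j, hj⟩
  | succ m hm ih =>
    intro hmn
    have ih := ih (by omega)
    obtain ⟨I, hI, hIj, hst⟩ := h.2 ⟨m, by omega⟩ hm
    have hII : ∀ t u, eudist (p (I t)) (p (I u)) ∈ acl R := fun t u => ih _ _ (hIj t) (hIj u)
    obtain ⟨s1, s2⟩ := hst hII
    have hj : ∀ t, eudist (p (I t)) (p ⟨m, by omega⟩) ∈ acl R := by
      intro t
      by_cases ht : t = 0
      · rw [ht]; exact half_mem _ _ s1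
      · exact mid_mem _ _ _ _ (s2 t ht) (hII _ _) (half_mem _ _ s1)
    have hsq : ∀ x y : Fin d → ℝ, eudist x y ∈ acl R → sd x y ∈ acl R := by
      intro x y hxy; rw [← eudist_sq]; exact (acl R).pow_mem hxy 2
    have key : ∀ i : Fin n, i.val < m → eudist (p i) (p ⟨m, by omega⟩) ∈ acl R := by
      intro i hi
      apply mem_acl_of_sq
      rw [eudist_sq]
      refine sd_mem (acl R) (p ∘ I) (gen_det p hp I hI) (fun t t' => hsq _ _ (hII t t')) _ _ (fun t => hsq _ _ (ih _ _ (hIj t) hi)) (fun t => hsq _ _ (hj t))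
    intro i j hi hj
    by_cases him : i.val < m
    · by_cases hjm : j.val < m
      · exact ih i j him hjm
      · have : j = ⟨m, by omega⟩ := Fin.ext (by simp; omega)
        rw [this]; exact key i him
    · have hi' : i = ⟨m, by omega⟩ := Fin.ext (by simp; omega)
      by_cases hjm : j.val < m
      · rw [hi', eudist_comm]; exact key j hjm
      · have hij : i = j := Fin.ext (by omega)
        rw [hij, eudist_self]; exact (acl R).zero_mem

theorem Tr_of_TA {n d : ℕ} (hd : 2 ≤ d) (hn : d + 2 ≤ n) (p q : Fin n → Fin d → ℝ) (hp : GenericConfig p) 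
    (h : ∀ M : AddSubmonoid ℝ, (∀ e, lv q e ∈ M) → TA d hn p M) : Tr p q := by
  intro G hG
  set R := Algebra.adjoin ℚ (Set.range (zv q)) with hR
  refine transfer_alg (zv p) (zv q) (fun G hG => gen_van p hp G hG q) ?_ G hG
  have hz : ∀ e, zv q e ∈ acl R := by
    intro e
    exact isAlgebraic_algebraMap (⟨zv q e, Algebra.subset_adjoin ⟨e, rfl⟩⟩ : R)
  have := all_mem hd hn p hp R (h _ (fun e => mem_acl_of_sq R _ (by rw [lv_sq]; exact hz e))) n hn le_rfl
  intro e
  induction e using Ed_ind with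
  | H i j hij =>
    rw [zv_mk', ← eudist_sq]
    exact (acl R).pow_mem (this i j i.2 j.2) 2

/-- natural combinations -/
def NR {n d : ℕ} (q : Fin n → Fin d → ℝ) : AddSubmonoid ℝ where
  carrier := {x | ∃ r : Ed n → ℕ, x = ∑ e, ((r e : ℚ) : ℝ) * lv q e}
  zero_mem' := ⟨0, by simp⟩
  add_mem' := by
    rintro _ _ ⟨r, rfl⟩ ⟨r', rfl⟩
    exact ⟨r + r', by simp [add_mul, Finset.sum_add_distrib]⟩

lemma sum_single {n : ℕ} (c : Ed n) (s : ℚ) (l : Ed n → ℝ) : 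
    ∑ e, (((if e = c then s else 0 : ℚ)) : ℝ) * l e = s * l c := by
  rw [Finset.sum_eq_single c]
  · simp
  · intro b _ hb; simp [hb]
  · simp

lemma lv_NR {n d : ℕ} (q : Fin n → Fin d → ℝ) (e : Ed n) : lv q e ∈ NR q := by
  refine ⟨fun c => if c = e then 1 else 0, ?_⟩
  have := sum_single e 1 (lv q)
  simp only [Rat.cast_one, one_mul] at this
  rw [← this]
  apply Finset.sum_congr rfl
  intro c _; by_cases h : c = e <;> simp [h]

lemma eu_NR {n d : ℕ} (q : Fin n → Fin d → ℝ) (a b : Fin n) : eudist (q a) (q b) ∈ NR q := by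
  by_cases h : a = b
  · rw [h, eudist_self]; exact (NR q).zero_mem
  · exact lv_NR q (mkE a b h)

lemma row_unique {n d : ℕ} (hd : 2 ≤ d) (p q : Fin n → Fin d → ℝ) (hp : GenericConfig p) (ht : Tr p q) (c c' : Ed n → ℚ)
    (h : ∑ a, (c a : ℝ) * lv q a = ∑ a, (c' a : ℝ) * lv q a) : ∀ a, c a = c' a := by
  intro a
  have := lin_indep hd p q hp ht (fun a => c a - c' a) (by push_cast; simp only [sub_mul, Finset.sum_sub_distrib]; linarith) a
  linarith

lemma eu_ne {n d : ℕ} (hd : 2 ≤ d) (p : Fin n → Fin d → ℝ) (hp : GenericConfig p) (a b : Fin n) (h : a ≠ b) : eudist (p a) (p b) ≠ 0 := by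
  intro h0
  have := row_unique hd p p hp (fun G h => h) (fun e => if e = mkE a b h then 1 else 0) 0 
    (by rw [sum_single, lv_mk, h0]; simp) (mkE a b h)
  simp at this

theorem mainH2 {n d : ℕ} (hd : 1 ≤ d) (p q : Fin n → Fin (d+1) → ℝ) (hp : GenericConfig p) (ht : Tr p q)
    (w : Fin (d+3) → Fin n) (hw : Function.Injective w) 
    (h1 : ∀ a, a ≠ 0 → 2 * eudist (p (w 0)) (p (w a)) ∈ NR q)
    (h2 : ∀ a b, a ≠ 0 → b ≠ 0 → a ≠ b → eudist (p (w 0)) (p (w a)) + eudist (p (w a)) (p (w b)) + eudist (p (w 0)) (p (w b)) ∈ NR q) :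
    ∃ (θ : Fin (d+3) → Fin n) (s : ℕ), Function.Injective θ ∧ 1 ≤ s ∧ 
      ∀ a b, eudist (p (w a)) (p (w b)) = s * eudist (q (θ a)) (q (θ b)) := by
  classical
  have hd2 : 2 ≤ d + 1 := by omega
  have r0 : ∀ a, a ≠ 0 → ∃ r : Ed n → ℚ, eudist (p (w 0)) (p (w a)) = ∑ c, (r c : ℝ) * lv q c := by
    intro a ha
    obtain ⟨r, hr⟩ := h1 a ha
    refine ⟨fun c => r c / 2, ?_⟩
    have : eudist (p (w 0)) (p (w a)) = (∑ e, ((r e : ℚ) : ℝ) * lv q e) / 2 := by linarith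
    rw [this, Finset.sum_div]
    apply Finset.sum_congr rfl; intro c _; push_cast; ring
  have r1 : ∀ a b, a ≠ b → ∃ r : Ed n → ℚ, eudist (p (w a)) (p (w b)) = ∑ c, (r c : ℝ) * lv q c := by
    intro a b hab
    by_cases ha : a = 0
    · rw [ha]; exact r0 b (by rw [← ha]; exact hab.symm)
    by_cases hb : b = 0
    · rw [hb, eudist_comm]; exact r0 a ha
    obtain ⟨r, hr⟩ := h2 a b ha hb hab
    obtain ⟨ra, hra⟩ := r0 a ha
    obtain ⟨rb, hrb⟩ := r0 b hb
    refine ⟨fun c => r c - ra c - rb c, ?_⟩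
    have : eudist (p (w a)) (p (w b)) = (∑ e, ((r e : ℚ) : ℝ) * lv q e) - eudist (p (w 0)) (p (w a)) - eudist (p (w 0)) (p (w b)) := by linarith
    rw [this, hra, hrb, ← Finset.sum_sub_distrib, ← Finset.sum_sub_distrib]
    apply Finset.sum_congr rfl; intro c _; push_cast; ring
  have r2 : ∀ e : Ed (d+3), ∃ r : Ed n → ℚ, lv (p ∘ w) e = ∑ c, (r c : ℝ) * lv q c := by
    intro e
    induction e using Ed_ind with
    | H a b h => exact r1 a b h
  choose E hE using r2
  have e1 : ∀ a (h : 0 ≠ a), ∃ r : Ed n → ℕ, ∀ c, 2 * E (mkE 0 a h) c = r c := by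
    intro a h
    obtain ⟨r, hr⟩ := h1 a h.symm
    refine ⟨r, row_unique hd2 p q hp ht (fun c => 2 * E (mkE 0 a h) c) (fun c => r c) ?_⟩
    rw [← hr]
    have := hE (mkE 0 a h)
    rw [lv_mk] at this
    simp only [Function.comp] at this
    rw [this, Finset.mul_sum]
    apply Finset.sum_congr rfl; intro c _; push_cast; ring
  have e2 : ∀ a b (ha : 0 ≠ a) (hb : 0 ≠ b) (hab : a ≠ b), ∃ r : Ed n → ℕ, ∀ c, 
      E (mkE 0 a ha) c + E (mkE a b hab) c + E (mkE 0 b hb) c = r c := by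
    intro a b ha hb hab
    obtain ⟨r, hr⟩ := h2 a b ha.symm hb.symm hab
    refine ⟨r, row_unique hd2 p q hp ht (fun c => E (mkE 0 a ha) c + E (mkE a b hab) c + E (mkE 0 b hb) c) (fun c => r c) ?_⟩
    rw [← hr]
    have i1 := hE (mkE 0 a ha)
    have i2 := hE (mkE a b hab)
    have i3 := hE (mkE 0 b hb)
    rw [lv_mk] at i1 i2 i3
    simp only [Function.comp] at i1 i2 i3
    rw [i1, i2, i3, ← Finset.sum_add_distrib, ← Finset.sum_add_distrib]
    apply Finset.sum_congr rfl; intro c _; push_cast; ring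
  obtain ⟨θ, hθ, s, hs, hEs⟩ := mainH hd p q hp ht w hw E hE 0 
    (fun a h c => by obtain ⟨r, hr⟩ := e1 a h; have := hr c; have : (0:ℚ) ≤ r c := by positivity
                     linarith)
    (fun a b ha hb hab c => by obtain ⟨r, hr⟩ := e2 a b ha hb hab; rw [hr]; positivity)
  have h01 : (0 : Fin (d+3)) ≠ 1 := by simp [Fin.ext_iff]
  have h02 : (0 : Fin (d+3)) ≠ ⟨2, by omega⟩ := by simp [Fin.ext_iff]
  have h12 : (1 : Fin (d+3)) ≠ ⟨2, by omega⟩ := by simp [Fin.ext_iff]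
  obtain ⟨r, hr⟩ := e2 1 ⟨2, by omega⟩ h01 h02 h12
  have hsr : s = r (emap θ hθ (mkE 0 1 h01)) := by
    have h3 := congrArg (fun x : ℚ => (x : ℝ)) (hr (emap θ hθ (mkE 0 1 h01)))
    simp only [Rat.cast_add, Rat.cast_natCast] at h3
    rw [hEs, hEs, hEs, if_pos rfl, if_neg, if_neg] at h3
    · linarith
    · intro h; have := emap_inj θ hθ h; rw [mkE_eq] at this; grind
    · intro h; have := emap_inj θ hθ h; rw [mkE_eq] at this; grind
  refine ⟨θ, r (emap θ hθ (mkE 0 1 h01)), hθ, ?_, ?_⟩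
  · rw [hsr] at hs; exact_mod_cast hs
  · intro a b
    by_cases hab : a = b
    · rw [hab, eudist_self, eudist_self, mul_zero]
    · have := hE (mkE a b hab)
      rw [lv_mk] at this
      simp only [Function.comp] at this
      rw [this, ← hsr, Finset.sum_eq_single (emap θ hθ (mkE a b hab))]
      · rw [hEs, if_pos rfl, emap_mk, lv_mk]
      · intro c _ hc; rw [hEs, if_neg hc, zero_mul]
      · simp

end UPL


namespace UPL
set_option linter.all false

open MvPolynomial Matrix

lemma edge_match {n d : ℕ} (hd : 2 ≤ d) (p q : Fin n → Fin d → ℝ) (hp : GenericConfig p) (ht : Tr p q) 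
    (a b x y : Fin n) (h : a ≠ b) (h' : x ≠ y) (s s' : ℕ) (hs : 1 ≤ s) 
    (he : s * eudist (q a) (q b) = s' * eudist (q x) (q y)) : mkE a b h = mkE x y h' ∧ s = s' := by
  have := row_unique hd p q hp ht (fun e => if e = mkE a b h then (s:ℚ) else 0) (fun e => if e = mkE x y h' then (s':ℚ) else 0)
    (by rw [sum_single, sum_single, lv_mk, lv_mk]; exact_mod_cast he) (mkE a b h)
  have hs' : (s : ℚ) ≠ 0 := by positivity
  by_cases hh : mkE a b h = mkE x y h'
  · refine ⟨hh, ?_⟩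
    rw [if_pos rfl, if_pos hh] at this
    exact_mod_cast this
  · rw [if_pos rfl, if_neg hh] at this
    exact absurd this hs'

lemma sd_smul {d : ℕ} (c : ℝ) (x y : Fin d → ℝ) : sd (c • x) (c • y) = c ^ 2 * sd x y := by
  simp only [sd, Pi.smul_apply, smul_eq_mul, Finset.mul_sum]
  exact Finset.sum_congr rfl fun k _ => by ring

lemma sd_of_eu {d : ℕ} (c : ℝ) (x y z w : Fin d → ℝ) (h : eudist x y = c * eudist z w) : sd x y = sd (c • z) (c • w) := by
  rw [sd_smul, ← eudist_sq, ← eudist_sq, h]; ring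

lemma eu_of_sd {d : ℕ} (c : ℝ) (hc : 0 ≤ c) (x y z w : Fin d → ℝ) (h : sd x y = sd (c • z) (c • w)) : eudist x y = c * eudist z w := by
  rw [sd_smul] at h
  rw [eudist_eq, eudist_eq, h, Real.sqrt_mul (sq_nonneg c), Real.sqrt_sq hc]

lemma nat_NR {n d : ℕ} (q : Fin n → Fin d → ℝ) (s : ℕ) (a b : Fin n) : s * eudist (q a) (q b) ∈ NR q := by
  have := (NR q).nsmul_mem (eu_NR q a b) s
  rwa [nsmul_eq_mul] at this

lemma match_pts {n m : ℕ} (hm : 3 ≤ m) (f g : Fin m → Fin n) (hf : Function.Injective f) (hg : Function.Injective g) 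
    (h : ∀ t u, t ≠ u → s(f t, f u) = s(g t, g u)) (t : Fin m) : f t = g t := by
  have : ∃ u v : Fin m, t ≠ u ∧ t ≠ v ∧ u ≠ v := by
    by_cases h0 : t.val = 0
    · exact ⟨⟨1, by omega⟩, ⟨2, by omega⟩, by grind, by grind, by grind⟩
    · by_cases h1 : t.val = 1
      · exact ⟨⟨0, by omega⟩, ⟨2, by omega⟩, by grind, by grind, by grind⟩
      · exact ⟨⟨0, by omega⟩, ⟨1, by omega⟩, by grind, by grind, by grind⟩
  obtain ⟨u, v, h1, h2, h3⟩ := this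
  have a1 := h t u h1
  have a2 := h t v h2
  have b2 := hg.ne h1
  have b3 := hg.ne h2
  have b4 := hg.ne h3
  have b5 := hf.ne h3
  simp only [Sym2.eq_iff] at a1 a2
  grind

theorem rigid {n d : ℕ} (hd : 1 ≤ d) (hn : d + 1 + 2 ≤ n) (p q : Fin n → Fin (d+1) → ℝ) (hp : GenericConfig p) 
    (ht : Tr p q) (h : TA (d+1) hn p (NR q)) : ∃ (s : ℕ) (σ : Fin n → Fin n), 1 ≤ s ∧ 
      ∀ a b, eudist (p a) (p b) = s * eudist (q (σ a)) (q (σ b)) := by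
  classical
  have hd2 : 2 ≤ d + 1 := by omega
  obtain ⟨hb, hst⟩ := h
  have : ∃ s : ℕ, 1 ≤ s ∧ ∀ m, d + 1 + 2 ≤ m → m ≤ n → ∃ σ : Fin n → Fin n, ∀ a b : Fin n, a.val < m → b.val < m →
      eudist (p a) (p b) = s * eudist (q (σ a)) (q (σ b)) := by
    obtain ⟨θ, s, hθ, hs, H⟩ := mainH2 hd p q hp ht (Fin.castLE hn) (Fin.castLE_injective hn) 
      (fun a ha => by
        obtain ⟨b, hb0, hab⟩ : ∃ b : Fin (d+1+2), b ≠ 0 ∧ a ≠ b := by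
          by_cases h1 : a.val = 1
          · exact ⟨⟨2, by omega⟩, by simp [Fin.ext_iff], by simp [Fin.ext_iff]; omega⟩
          · exact ⟨⟨1, by omega⟩, by simp [Fin.ext_iff], by simp [Fin.ext_iff]; omega⟩
        exact (hb a b ha hb0 hab).1)
      (fun a b ha hb' hab => (hb a b ha hb' hab).2)
    refine ⟨s, hs, ?_⟩
    intro m hm
    induction m, hm using Nat.le_induction with
    | base =>
      intro _
      refine ⟨fun i => if hi : i.val < d + 1 + 2 then θ ⟨i.val, hi⟩ else i, ?_⟩
      intro a b ha hb
      simp only [ha, hb, dif_pos]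
      exact H ⟨a, ha⟩ ⟨b, hb⟩
    | succ m hm ih =>
      intro hmn
      obtain ⟨σ, hσ⟩ := ih (by omega)
      set j : Fin n := ⟨m, by omega⟩ with hj
      obtain ⟨I, hI, hIj, hI2⟩ := hst j hm
      have hIm : ∀ t, (I t).val < m := hIj
      obtain ⟨k1, k2⟩ := hI2 (fun t u => by rw [hσ _ _ (hIm t) (hIm u)]; exact nat_NR q s _ _)
      have hIne : ∀ t, I t ≠ j := fun t he => by have := hIm t; rw [he] at this; simp [hj] at this
      let w : Fin (d+3) → Fin n := Fin.snoc (α := fun _ => Fin n) I j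
      have w1 : ∀ t : Fin (d+2), w t.castSucc = I t := fun t => by simp [w]
      have w2 : w (Fin.last _) = j := by simp [w]
      have w0 : w 0 = I 0 := w1 0
      have hw : Function.Injective w := by
        intro x y
        refine Fin.lastCases ?_ (fun x => ?_) x <;> refine Fin.lastCases ?_ (fun y => ?_) y
        · intro _; rfl
        · rw [w2, w1]; intro e; exact absurd e.symm (hIne y)
        · rw [w2, w1]; intro e; exact absurd e (hIne x)
        · rw [w1, w1]; intro e; rw [hI e]
      have hIN : ∀ t u, eudist (p (I t)) (p (I u)) ∈ NR q := 
        fun t u => by rw [hσ _ _ (hIm t) (hIm u)]; exact nat_NR q s _ _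
      obtain ⟨θ', s', hθ', hs', H'⟩ := mainH2 hd p q hp ht w hw
        (by
          intro a
          refine Fin.lastCases ?_ (fun a => ?_) a
          · intro _; rw [w0, w2]; exact k1
          · intro _; rw [w0, w1, two_mul]; exact (NR q).add_mem (hIN _ _) (hIN _ _))
        (by
          intro a b
          refine Fin.lastCases ?_ (fun a => ?_) a <;> refine Fin.lastCases ?_ (fun b => ?_) b
          · intro _ _ e; exact absurd rfl e
          · intro _ hb _
            rw [w0, w1, w2]
            have := k2 b (by rintro rfl; exact hb rfl)
            rw [eudist_comm (p j)]
            convert this using 1; ring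
          · intro ha _ _
            rw [w0, w1, w2]
            exact k2 a (by rintro rfl; exact ha rfl)
          · intro _ _ _
            rw [w0, w1, w1]
            exact (NR q).add_mem ((NR q).add_mem (hIN _ _) (hIN _ _)) (hIN _ _))
      have hσI : Function.Injective (fun t => σ (I t)) := by
        intro t u e
        by_contra hne
        have := hσ _ _ (hIm t) (hIm u)
        rw [show σ (I t) = σ (I u) from e, eudist_self, mul_zero] at this
        exact eu_ne hd2 p hp _ _ (hI.ne hne) this
      have hθI : Function.Injective (fun t : Fin (d+2) => θ' t.castSucc) := fun t u e => Fin.castSucc_injective _ (hθ' e)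
      have hm : ∀ t u, ∀ htu : t ≠ u, mkE _ _ (hσI.ne htu) = mkE _ _ (hθI.ne htu) ∧ s = s' := by
        intro t u htu
        apply edge_match hd2 p q hp ht _ _ _ _ _ _ _ _ hs
        have := H' t.castSucc u.castSucc
        rw [w1, w1, hσ _ _ (hIm t) (hIm u)] at this
        exact this
      have hss : s = s' := (hm 0 1 (by simp)).2
      have hpt : ∀ t, σ (I t) = θ' t.castSucc := match_pts (by omega) _ _ hσI hθI (fun t u htu => congrArg Subtype.val (hm t u htu).1)
      have key : ∀ i : Fin n, i.val < m → eudist (p i) (p j) = s * eudist (q (σ i)) (q (θ' (Fin.last _))) := by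
        intro i hi
        apply eu_of_sd _ (Nat.cast_nonneg s)
        refine sd_eq (p ∘ I) (fun t => (s:ℝ) • q (σ (I t))) ?_ (gen_det p hp I hI) _ _ _ _ ?_ ?_
        · intro t t'; exact sd_of_eu _ _ _ _ _ (hσ _ _ (hIm t) (hIm t'))
        · intro t; exact sd_of_eu _ _ _ _ _ (hσ _ _ (hIm t) hi)
        · intro t
          apply sd_of_eu
          have := H' t.castSucc (Fin.last _)
          rw [w1, w2, ← hss, ← hpt] at this
          exact this
      refine ⟨Function.update σ j (θ' (Fin.last _)), ?_⟩
      have hlt : ∀ i : Fin n, i.val < m → Function.update σ j (θ' (Fin.last _)) i = σ i := fun i hi => 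
        Function.update_of_ne (by rintro rfl; simp [hj] at hi) _ _
      have hjj : Function.update σ j (θ' (Fin.last _)) j = θ' (Fin.last _) := Function.update_self _ _ _
      have hdich : ∀ i : Fin n, i.val < m + 1 → i.val < m ∨ i = j := by
        intro i hi
        by_cases h : i.val < m
        · exact Or.inl h
        · exact Or.inr (Fin.ext (by simp [hj]; omega))
      intro a b ha hb
      rcases hdich a ha with ha | ha <;> rcases hdich b hb with hb | hb
      · rw [hlt a ha, hlt b hb]; exact hσ a b ha hb
      · rw [hlt a ha, hb, hjj]; exact key a ha
      · rw [hlt b hb, ha, hjj, eudist_comm, key b hb, eudist_comm]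
      · rw [ha, hb, eudist_self, eudist_self, mul_zero]
  obtain ⟨s, hs, H⟩ := this
  obtain ⟨σ, hσ⟩ := H n hn le_rfl
  exact ⟨s, σ, hs, fun a b => hσ a b a.2 b.2⟩

end UPL


namespace UPL
set_option linter.all false

open MvPolynomial Matrix

lemma gen_perm {n d : ℕ} (p : Fin n → Fin d → ℝ) (hp : GenericConfig p) (π : Equiv.Perm (Fin n)) : GenericConfig (p ∘ π) := by
  intro f hf h0
  have hinj : Function.Injective (fun a : Fin n × Fin d => (π a.1, a.2)) := by
    rintro ⟨a, b⟩ ⟨c, e⟩ h; simpa using h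
  refine hp (rename (fun a : Fin n × Fin d => (π a.1, a.2)) f) ?_ ?_
  · intro h; exact hf (rename_injective _ hinj (by rw [h, map_zero]))
  · rw [aeval_rename]; exact h0

lemma pathLen_eq {n d : ℕ} (p : Fin n → Fin d → ℝ) (α : List (Fin n)) : 
    pathLen p α = ((pathEdges α).map (lenR p)).sum := by
  simp only [pathLen, pathEdges, Multiset.map_coe, Multiset.sum_coe, List.map_map]
  rfl

lemma lenR_mk {n d : ℕ} (p : Fin n → Fin d → ℝ) (a b : Fin n) : lenR p s(a, b) = eudist (p a) (p b) := rfl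

lemma eu_mem {n d : ℕ} (q : Fin n → Fin d → ℝ) (M : AddSubmonoid ℝ) (h : ∀ e, lv q e ∈ M) (a b : Fin n) : eudist (q a) (q b) ∈ M := by
  by_cases hab : a = b
  · rw [hab, eudist_self]; exact M.zero_mem
  · exact h (mkE a b hab)

lemma pathLen_mem {n d : ℕ} (q : Fin n → Fin d → ℝ) (M : AddSubmonoid ℝ) (h : ∀ e, lv q e ∈ M) (α : List (Fin n)) : pathLen q α ∈ M := by
  apply AddSubmonoid.list_sum_mem
  intro x hx
  simp only [List.mem_map] at hx
  obtain ⟨e, _, rfl⟩ := hx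
  exact eu_mem q M h _ _

lemma TA_loop {n m d : ℕ} (hn : d + 2 ≤ n) (p : Fin n → Fin d → ℝ) (A : Fin m → List (Fin n)) (h : LoopTrilat d hn A) : 
    ∃ π : Equiv.Perm (Fin n), ∀ M : AddSubmonoid ℝ, (∀ k, pathLen p (A k) ∈ M) → TA d hn (p ∘ π) M := by
  obtain ⟨π, h1, h2, h3⟩ := h
  refine ⟨π, fun M hM => ⟨?_, ?_⟩⟩
  · have tri : ∀ a b : Fin (d+2), a ≠ 0 → a.val < b.val → eudist ((p ∘ π) (Fin.castLE hn 0)) ((p ∘ π) (Fin.castLE hn a)) + eudist ((p ∘ π) (Fin.castLE hn a)) ((p ∘ π) (Fin.castLE hn b)) 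
      + eudist ((p ∘ π) (Fin.castLE hn 0)) ((p ∘ π) (Fin.castLE hn b)) ∈ M := by
      intro a b ha hab
      obtain ⟨k, hk⟩ := h2 (Fin.castLE hn a) (Fin.castLE hn b) (Nat.pos_of_ne_zero fun e => ha (Fin.ext e)) (by simpa using hab) (by simp)
      have := hM k
      rw [pathLen_eq, hk] at this
      simp only [Multiset.insert_eq_cons, Multiset.map_cons, Multiset.map_singleton, Multiset.sum_cons, Multiset.sum_singleton, lenR_mk] at this
      rw [eudist_comm (p (π (Fin.castLE hn b))), ← add_assoc] at this
      exact this
    intro a b ha hb hab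
    constructor
    · obtain ⟨k, hk⟩ := h1 (Fin.castLE hn a) (Nat.pos_of_ne_zero fun e => ha (Fin.ext e)) (by simp)
      have := hM k
      rw [pathLen_eq, hk] at this
      simp only [Multiset.insert_eq_cons, Multiset.map_cons, Multiset.map_singleton, Multiset.sum_cons, Multiset.sum_singleton, lenR_mk] at this
      rw [two_mul]; exact this
    · rcases lt_or_gt_of_ne (Fin.val_ne_of_ne hab) with h | h
      · exact tri a b ha h
      · have := tri b a hb h
        rw [eudist_comm ((p ∘ π) (Fin.castLE hn b)) ((p ∘ π) (Fin.castLE hn a))] at this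
        convert this using 1; ring
  · intro j hj
    obtain ⟨I, hI, hIj, ⟨k, hk⟩, hk2⟩ := h3 j hj
    refine ⟨I, hI, hIj, fun _ => ⟨?_, ?_⟩⟩
    · have := hM k
      rw [pathLen_eq, hk] at this
      simp only [Multiset.insert_eq_cons, Multiset.map_cons, Multiset.map_singleton, Multiset.sum_cons, Multiset.sum_singleton, lenR_mk] at this
      rw [two_mul]; exact this
    · intro t ht
      obtain ⟨k, hk⟩ := hk2 t ht
      have := hM k
      rw [pathLen_eq, hk] at this
      simp only [Multiset.insert_eq_cons, Multiset.map_cons, Multiset.map_singleton, Multiset.sum_cons, Multiset.sum_singleton, lenR_mk] at this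
      rw [eudist_comm (p (π j)) (p (π (I 0))), ← add_assoc] at this
      exact this

lemma TA_path {n m d : ℕ} (hn : d + 2 ≤ n) (p : Fin n → Fin d → ℝ) (A : Fin m → List (Fin n)) (h : PathTrilat d hn A) : 
    ∃ π : Equiv.Perm (Fin n), ∀ M : AddSubmonoid ℝ, (∀ k, pathLen p (A k) ∈ M) → TA d hn (p ∘ π) M := by
  obtain ⟨π, h1, h3⟩ := h
  refine ⟨π, fun M hM => ⟨?_, ?_⟩⟩
  · have ed : ∀ a b : Fin (d+2), a ≠ b → eudist ((p ∘ π) (Fin.castLE hn a)) ((p ∘ π) (Fin.castLE hn b)) ∈ M := by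
      intro a b hab
      obtain ⟨k, hk⟩ := h1 (Fin.castLE hn a) (Fin.castLE hn b) (by simp) (by simp) (fun e => hab (Fin.castLE_injective hn e))
      have := hM k
      rw [pathLen_eq, hk] at this
      simp only [Multiset.map_singleton, Multiset.sum_singleton, lenR_mk] at this
      exact this
    intro a b ha hb hab
    refine ⟨?_, M.add_mem (M.add_mem (ed _ _ ha.symm) (ed _ _ hab)) (ed _ _ hb.symm)⟩
    rw [two_mul]; exact M.add_mem (ed _ _ ha.symm) (ed _ _ ha.symm)
  · intro j hj
    obtain ⟨I, hI, hk⟩ := h3 j hj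
    have hj' : ∀ t, eudist ((p ∘ π) (I t)) ((p ∘ π) j) ∈ M := by
      intro t
      obtain ⟨k, hk⟩ := (hk t).2
      have := hM k
      rw [pathLen_eq, hk] at this
      simp only [Multiset.map_singleton, Multiset.sum_singleton, lenR_mk] at this
      exact this
    refine ⟨I, hI, fun t => (hk t).1, fun hh => ⟨?_, fun t _ => M.add_mem (M.add_mem (hh _ _) (hj' _)) (hj' _)⟩⟩
    rw [two_mul]; exact M.add_mem (hj' _) (hj' _)

lemma TA_all {n m d : ℕ} (hn : d + 2 ≤ n) (loop : Bool) (p : Fin n → Fin d → ℝ) (A : Fin m → List (Fin n)) (h : Trilat loop d hn A) : 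
    ∃ π : Equiv.Perm (Fin n), ∀ M : AddSubmonoid ℝ, (∀ k, pathLen p (A k) ∈ M) → TA d hn (p ∘ π) M := by
  cases loop
  · exact TA_path hn p A h
  · exact TA_loop hn p A h

theorem core {d n m : ℕ} (hd : 2 ≤ d) (hn : d + 2 ≤ n) (loop : Bool)
    (p q : Fin n → Fin d → ℝ) (hp : GenericConfig p)
    (A B : Fin m → List (Fin n)) (hAtri : Trilat loop d hn A)
    (hv : ∀ k, pathLen p (A k) = pathLen q (B k)) : 
    ∃ (σ : Equiv.Perm (Fin n)) (s : ℕ), 1 ≤ s ∧ (∀ a b, eudist (p a) (p b) = s * eudist (q (σ a)) (q (σ b))) ∧ 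
      ∀ c c' : Ed n → ℚ, ∑ a, (c a : ℝ) * lv q a = ∑ a, (c' a : ℝ) * lv q a → ∀ a, c a = c' a := by
  obtain ⟨π, hπ⟩ := TA_all hn loop p A hAtri
  have hp' := gen_perm p hp π
  have hT : ∀ M : AddSubmonoid ℝ, (∀ e, lv q e ∈ M) → TA d hn (p ∘ π) M := 
    fun M hM => hπ M (fun k => by rw [hv k]; exact pathLen_mem q M hM _)
  have ht : Tr (p ∘ π) q := Tr_of_TA hd hn _ _ hp' hT
  have : ∃ (s : ℕ) (σ : Fin n → Fin n), 1 ≤ s ∧ 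
      ∀ a b, eudist ((p ∘ π) a) ((p ∘ π) b) = s * eudist (q (σ a)) (q (σ b)) := by
    obtain ⟨e, rfl⟩ : ∃ e, d = e + 1 := ⟨d - 1, by omega⟩
    exact rigid (by omega) hn _ _ hp' ht (hT _ (lv_NR q))
  obtain ⟨s, σ, hs, h⟩ := this
  have hinj : Function.Injective σ := by
    intro a b hab
    by_contra hne
    have := h a b
    rw [hab, eudist_self, mul_zero] at this
    exact eu_ne hd _ hp' _ _ hne this
  let τ := Equiv.ofBijective σ (Finite.injective_iff_bijective.mp hinj)
  refine ⟨π.symm.trans τ, s, hs, ?_, fun c c' => row_unique hd _ q hp' ht c c'⟩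
  intro a b
  have := h (π.symm a) (π.symm b)
  simp only [Function.comp, Equiv.apply_symm_apply] at this
  exact this

lemma dm_smul {d : ℕ} (c : ℝ) (y : Fin (d+1) → Fin d → ℝ) : dm (fun t => c • y t) = c • dm y := by
  ext i j
  simp [dm]; ring

lemma cong_of {d n : ℕ} (hn : d + 2 ≤ n) (p q : Fin n → Fin d → ℝ) (hp : GenericConfig p) (σ : Equiv.Perm (Fin n)) (s : ℕ) (hs : 1 ≤ s)
    (h : ∀ a b, eudist (p a) (p b) = s * eudist (q (σ a)) (q (σ b))) : 
    ∃ f : (Fin d → ℝ) → (Fin d → ℝ), IsCongruence f ∧ ∀ i, q (σ i) = f ((s : ℝ)⁻¹ • p i) := by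
  have hs0 : (s : ℝ) ≠ 0 := by positivity
  have hI : Function.Injective (Fin.castLE (by omega) : Fin (d+1) → Fin n) := Fin.castLE_injective _
  refine exists_cong (fun i => (s : ℝ)⁻¹ • p i) (fun i => q (σ i)) ?_ (Fin.castLE (by omega)) ?_
  · intro i j
    rw [sd_smul, ← eudist_sq, ← eudist_sq, h]
    field_simp
  · have := gen_det p hp _ hI
    have e := dm_smul (s : ℝ)⁻¹ (p ∘ (Fin.castLE (by omega) : Fin (d+1) → Fin n))
    have e2 : (dm ((fun i => (s : ℝ)⁻¹ • p i) ∘ (Fin.castLE (by omega) : Fin (d+1) → Fin n))).det = ((s : ℝ)⁻¹ • dm (p ∘ (Fin.castLE (by omega) : Fin (d+1) → Fin n))).det := 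
      congrArg Matrix.det e
    rw [e2, Matrix.det_smul]
    exact mul_ne_zero (pow_ne_zero _ (inv_ne_zero hs0)) this

lemma nondiag {n : ℕ} (α : List (Fin n)) (h : α.Chain' (· ≠ ·)) : ∀ e ∈ pathEdges α, ¬ e.IsDiag := by
  induction α with
  | nil => intro e he; simp [pathEdges] at he
  | cons a l ih =>
    cases l with
    | nil => intro e he; simp [pathEdges] at he
    | cons b l =>
      intro e he
      have h' := List.isChain_cons_cons.mp h
      have : pathEdges (a :: b :: l) = s(a, b) ::ₘ pathEdges (b :: l) := rfl
      rw [this, Multiset.mem_cons] at he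
      rcases he with rfl | he
      · simpa using h'.1
      · exact ih h'.2 e he

lemma sum_count {n d : ℕ} (q : Fin n → Fin d → ℝ) (S : Multiset (Sym2 (Fin n))) (h : ∀ e ∈ S, ¬ e.IsDiag) : 
    (S.map (lenR q)).sum = ∑ a : Ed n, (((S.count a.1 : ℕ) : ℚ) : ℝ) * lv q a := by
  classical
  induction S using Multiset.induction_on with
  | empty => simp
  | cons e S ih =>
    rw [Multiset.map_cons, Multiset.sum_cons, ih (fun e he => h e (Multiset.mem_cons_of_mem he))]
    have he := h e (Multiset.mem_cons_self _ _)
    have := sum_single (⟨e, he⟩ : Ed n) 1 (lv q)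
    have e1 : lenR q e = lv q ⟨e, he⟩ := rfl
    rw [Rat.cast_one, one_mul] at this
    rw [e1, ← this, ← Finset.sum_add_distrib]
    apply Finset.sum_congr rfl
    intro a _
    rw [Multiset.count_cons]
    by_cases hh : a = ⟨e, he⟩
    · have : a.1 = e := by rw [hh]
      simp only [if_pos hh, if_pos this]; push_cast; ring
    · have : ¬ a.1 = e := fun h' => hh (Subtype.ext h')
      simp only [if_neg hh, if_neg this]; push_cast; ring

lemma ms_eq {n d : ℕ} (q : Fin n → Fin d → ℝ)
    (hu : ∀ c c' : Ed n → ℚ, ∑ a, (c a : ℝ) * lv q a = ∑ a, (c' a : ℝ) * lv q a → ∀ a, c a = c' a) 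
    (S T : Multiset (Sym2 (Fin n))) (hS : ∀ e ∈ S, ¬ e.IsDiag) (hT : ∀ e ∈ T, ¬ e.IsDiag) (h : (S.map (lenR q)).sum = (T.map (lenR q)).sum) : S = T := by
  classical
  rw [sum_count q S hS, sum_count q T hT] at h
  have := hu _ _ h
  ext e
  by_cases he : e.IsDiag
  · rw [Multiset.count_eq_zero.mpr (fun h => hS e h he), Multiset.count_eq_zero.mpr (fun h => hT e h he)]
  · exact_mod_cast this ⟨e, he⟩

lemma edges_eq {n d : ℕ} (p q : Fin n → Fin d → ℝ) (σ : Equiv.Perm (Fin n)) (s : ℕ)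
    (h : ∀ a b, eudist (p a) (p b) = s * eudist (q (σ a)) (q (σ b)))
    (hu : ∀ c c' : Ed n → ℚ, ∑ a, (c a : ℝ) * lv q a = ∑ a, (c' a : ℝ) * lv q a → ∀ a, c a = c' a) 
    (α β : List (Fin n)) (hα : α.Chain' (· ≠ ·)) (hβ : β.Chain' (· ≠ ·)) (hv : pathLen p α = pathLen q β) : 
    Multiset.map (Sym2.map ⇑σ.symm) (pathEdges β) = s • pathEdges α := by
  have key : pathEdges β = Multiset.map (Sym2.map σ) (s • pathEdges α) := by
    refine ms_eq q hu _ _ (nondiag β hβ) ?_ ?_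
    · intro e he
      rw [Multiset.mem_map] at he
      obtain ⟨a, ha, rfl⟩ := he
      have := nondiag α hα a (Multiset.mem_of_mem_nsmul ha)
      induction a using Sym2.ind with
      | _ x y => simpa using this
    · rw [← pathLen_eq, ← hv, pathLen_eq, Multiset.map_nsmul, Multiset.map_nsmul, Multiset.sum_nsmul, nsmul_eq_mul, Multiset.map_map, 
        ← Multiset.sum_map_mul_left]
      congr 1
      apply Multiset.map_congr rfl
      intro e _
      induction e using Sym2.ind with
      | _ x y => exact h x y
  rw [key, Multiset.map_map]
  have : (Sym2.map σ.symm ∘ Sym2.map σ) = id := by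
    funext e
    induction e using Sym2.ind with
    | _ x y => simp
  rw [this, Multiset.map_id]

lemma s_one {n : ℕ} (σ : Equiv.Perm (Fin n)) (s : ℕ) (hs : 1 ≤ s) (X Y : Multiset (Sym2 (Fin n))) (h : Multiset.map (Sym2.map ⇑σ.symm) Y = s • X) 
    (hY : Y.Nodup) (h0 : Y ≠ 0) : s = 1 := by
  classical
  have hn : (s • X).Nodup := by rw [← h]; exact hY.map (Sym2.map.injective σ.symm.injective)
  have hX : X ≠ 0 := by
    rintro rfl
    rw [nsmul_zero, Multiset.map_eq_zero] at h
    exact h0 h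
  obtain ⟨e, he⟩ := Multiset.exists_mem_of_ne_zero hX
  have h1 := Multiset.nodup_iff_count_le_one.mp hn e
  rw [Multiset.count_nsmul] at h1
  have h2 := Multiset.count_pos.mpr he
  nlinarith

lemma exists_nodup {n m d : ℕ} (hd : 2 ≤ d) (hn : d + 2 ≤ n) (loop : Bool) (B : Fin m → List (Fin n)) (h : Trilat loop d hn B) : 
    ∃ k, (pathEdges (B k)).Nodup ∧ pathEdges (B k) ≠ 0 := by
  cases loop
  · obtain ⟨π, h1, _⟩ := h
    obtain ⟨k, hk⟩ := h1 ⟨0, by omega⟩ ⟨1, by omega⟩ (by simp) (by simp) (by simp)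
    exact ⟨k, by rw [hk]; simp, by rw [hk]; simp⟩
  · obtain ⟨π, _, h1, _⟩ := h
    obtain ⟨k, hk⟩ := h1 ⟨1, by omega⟩ ⟨2, by omega⟩ (by simp) (by simp) (by simp; omega)
    refine ⟨k, by rw [hk]; simp, by rw [hk]; simp⟩

lemma good_chain {n : ℕ} (loop : Bool) (α : List (Fin n)) (h : GoodSeq loop α) : α.Chain' (· ≠ ·) := by
  cases loop
  · exact h.2
  · exact h.1.2

end UPL

/-- **main global rigidity theorem.**  Let `d ≥ 2` and let `p` be a
generic configuration of `n ≥ d+2` points in ℝ^d.  Let `v = ⟨α,p⟩` where `α` is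
a path (resp. loop, according to the flag `loop`) measurement ensemble that
allows for trilateration.  Suppose a configuration `q` of `n` points together
with a path (resp. loop) measurement ensemble `β` satisfies `v = ⟨β,q⟩`.  Then
there are a vertex relabeling `σ` of `q`, a whole number `s ≥ 1` and a
congruence `f` such that `q ∘ σ = f ∘ ((1/s)·p)` and, under this relabeling,
`β = s·α` (as sequences of paths identified by their edge multisets).  If
moreover `β` also allows for trilateration, then there are a vertex relabeling
`σ` and a congruence `f` with `q ∘ σ = f ∘ p`, and under this relabeling
`β = α`. -/
theorem unlabeled_path_loop_global_rigidity
    {d n m : ℕ} (hd : 2 ≤ d) (hn : d + 2 ≤ n) (loop : Bool)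
    (p q : Fin n → Fin d → ℝ) (hp : GenericConfig p)
    (A B : Fin m → List (Fin n))
    (hA : ∀ k, GoodSeq loop (A k)) (hB : ∀ k, GoodSeq loop (B k))
    (hAtri : Trilat loop d hn A)
    (hv : ∀ k, pathLen p (A k) = pathLen q (B k)) :
    (∃ (σ : Equiv.Perm (Fin n)) (s : ℕ) (f : (Fin d → ℝ) → (Fin d → ℝ)),
      1 ≤ s ∧ IsCongruence f ∧
      (∀ i, q (σ i) = f ((s : ℝ)⁻¹ • p i)) ∧
      (∀ k, Multiset.map (Sym2.map ⇑σ.symm) (pathEdges (B k)) = s • pathEdges (A k))) ∧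
    (Trilat loop d hn B →
      ∃ (σ : Equiv.Perm (Fin n)) (f : (Fin d → ℝ) → (Fin d → ℝ)),
        IsCongruence f ∧ (∀ i, q (σ i) = f (p i)) ∧
        (∀ k, Multiset.map (Sym2.map ⇑σ.symm) (pathEdges (B k)) = pathEdges (A k))) := by
  obtain ⟨σ, s, hs, h, hu⟩ := UPL.core hd hn loop p q hp A B hAtri hv
  obtain ⟨f, hf, hfq⟩ := UPL.cong_of hn p q hp σ s hs h
  have hE := fun k => UPL.edges_eq p q σ s h hu (A k) (B k) (UPL.good_chain loop _ (hA k)) (UPL.good_chain loop _ (hB k)) (hv k)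
  refine ⟨⟨σ, s, f, hs, hf, hfq, hE⟩, fun hBt => ?_⟩
  obtain ⟨k, hk, hk0⟩ := UPL.exists_nodup hd hn loop B hBt
  have h1 : s = 1 := UPL.s_one σ s hs _ _ (hE k) hk hk0
  subst h1
  exact ⟨σ, f, hf, fun i => by simpa using hfq i, fun k => by simpa using hE k⟩
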